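/- Suppose d ∈ {1, 2} and d/3 < α < 2d/5. Then there are constants C₁ < ∞ and ε₀ > 0 (depending only on d, α, c, C) such that χ(β) ≤ C₁ (β_c − β)^{−α/(2d−5α)} for every β ∈ (β_c − ε₀, β_c). In particular, the critical exponent γ satisfies γ ≤ α/(2d−5α) whenever it is well-defined. -/

import Mathlib

open MeasureTheory ENNReal

namespace LRP

/-- The vertex set `ℤ^d`. -/
abbrev V (d : ℕ) : Type := Fin d → ℤ

/-- The `ℓ^∞` norm of a lattice point, as a natural number. -/
def normInf {d : ℕ} (x : V d) : ℕ := Finset.univ.sup fun i => (x i).natAbs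

/-- A percolation configuration: each (unordered) pair of vertices is open or closed. -/
abbrev Config (d : ℕ) : Type := Sym2 (V d) → Bool

/-- The probability `1 - exp (-β J(x,y))` that the edge `e = {x,y}` is open
(the symmetrization `(J x y + J y x)/2` equals `J x y` for symmetric `J`). -/
noncomputable def edgeProb {d : ℕ} (J : V d → V d → ℝ) (β : ℝ) (e : Sym2 (V d)) : ℝ≥0∞ :=
  ENNReal.ofReal (1 - Real.exp (-β *
    Sym2.lift ⟨fun x y => (J x y + J y x) / 2, fun x y => by dsimp only; rw [add_comm]⟩ e))

/-- `IsLRP J P` asserts that for each `β`, `P β` is the law of long-range percolation on `ℤ^d`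
with kernel `J` at inverse temperature `β`: distinct edges are open independently, edge `{x,y}`
being open with probability `1 - exp (-β J(x,y))`.  This is expressed by prescribing the
probability of every finite cylinder event, which characterizes the measure uniquely. -/
def IsLRP {d : ℕ} (J : V d → V d → ℝ) (P : ℝ → Measure (Config d)) : Prop :=
  ∀ (β : ℝ) (s : Finset (Sym2 (V d))) (f : Sym2 (V d) → Bool),
    P β {ω | ∀ e ∈ s, ω e = f e} =
      ∏ e ∈ s, (if f e then edgeProb J β e else 1 - edgeProb J β e)

/-- Two vertices are adjacent if they are distinct and the edge between them is open. -/
def adj {d : ℕ} (ω : Config d) (x y : V d) : Prop := x ≠ y ∧ ω s(x, y) = true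

/-- `x ↔ y`: the vertices are connected by a path of open edges. -/
def conn {d : ℕ} (ω : Config d) (x y : V d) : Prop := Relation.ReflTransGen (adj ω) x y

/-- `x ↔ y` inside `A`: connected by an open path all of whose vertices lie in `A`. -/
def connIn {d : ℕ} (ω : Config d) (A : Set (V d)) (x y : V d) : Prop :=
  x ∈ A ∧ y ∈ A ∧ Relation.ReflTransGen (fun a b => a ∈ A ∧ b ∈ A ∧ adj ω a b) x y

/-- The cluster of `x`. -/
def cluster {d : ℕ} (ω : Config d) (x : V d) : Set (V d) := {y | conn ω x y}

/-- The critical point `β_c`. -/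
noncomputable def betaC {d : ℕ} (P : ℝ → Measure (Config d)) : ℝ :=
  sInf {β : ℝ | 0 ≤ β ∧ 0 < P β {ω | ∃ x, (cluster ω x).Infinite}}

/-- The two-point function `ℙ_β(x ↔ y)`. -/
noncomputable def twoPoint {d : ℕ} (P : ℝ → Measure (Config d)) (β : ℝ) (x y : V d) : ℝ≥0∞ :=
  P β {ω | conn ω x y}

/-- The susceptibility `χ(β) = Σ_x ℙ_β(0 ↔ x)`. -/
noncomputable def chi {d : ℕ} (P : ℝ → Measure (Config d)) (β : ℝ) : ℝ≥0∞ :=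
  ∑' x : V d, twoPoint P β 0 x

/-- `Σ_{x ∈ [-n,n]^d} ℙ_β(0 ↔ x)`. -/
noncomputable def boxSum {d : ℕ} (P : ℝ → Measure (Config d)) (β : ℝ) (n : ℕ) : ℝ≥0∞ :=
  ∑' x : V d, if normInf x ≤ n then twoPoint P β 0 x else 0

/-- The correlation length `ξ(β) = inf {r ≥ 1 : Σ_{x ∈ [-r,r]^d} ℙ_β(0↔x) ≥ χ(β)/2}`
(`= ∞` if no such `r` exists). -/
noncomputable def xi {d : ℕ} (P : ℝ → Measure (Config d)) (β : ℝ) : ℝ≥0∞ :=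
  sInf {r : ℝ≥0∞ | ∃ n : ℕ, r = (n : ℝ≥0∞) ∧ 1 ≤ n ∧ chi P β ≤ 2 * boxSum P β n}

/-- The triangle diagram `∇_β`. -/
noncomputable def triangle {d : ℕ} (P : ℝ → Measure (Config d)) (β : ℝ) : ℝ≥0∞ :=
  ∑' x : V d, ∑' y : V d, twoPoint P β 0 x * twoPoint P β x y * twoPoint P β y 0

/-- The standing assumptions on the kernel `J`: symmetric, integrable, translation-invariant,
with `c ‖x-y‖^{-d-α} ≤ J(x,y) ≤ C ‖x-y‖^{-d-α}` for distinct `x, y`, where `0 < α < d`. -/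
structure KernelHyp (d : ℕ) (J : V d → V d → ℝ) (α c C : ℝ) : Prop where
  d_pos : 1 ≤ d
  symm : ∀ x y, J x y = J y x
  transInv : ∀ x y z : V d, J (x + z) (y + z) = J x y
  nonneg : ∀ x y, 0 ≤ J x y
  integrable : Summable fun x : V d => J 0 x
  alpha_pos : 0 < α
  alpha_lt_d : α < (d : ℝ)
  c_pos : 0 < c
  c_le_C : c ≤ C
  lower : ∀ x y : V d, x ≠ y → c * (normInf (x - y) : ℝ) ^ (-(d : ℝ) - α) ≤ J x y
  upper : ∀ x y : V d, x ≠ y → J x y ≤ C * (normInf (x - y) : ℝ) ^ (-(d : ℝ) - α)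

section M1
open Classical
set_option linter.unusedSectionVars false
variable {ι : Type*} [DecidableEq ι]

/-- weight of a configuration -/
noncomputable def wt (p : ι → ℝ) (E ω : Finset ι) : ℝ := (∏ e ∈ ω, p e) * ∏ e ∈ E \ ω, (1 - p e)

/-- finite product expectation -/
noncomputable def Ex (p : ι → ℝ) (E : Finset ι) (F : Finset ι → ℝ) : ℝ :=
  ∑ ω ∈ E.powerset, wt p E ω * F ω

/-- indicator -/
noncomputable def ind (A : Prop) : ℝ := if A then 1 else 0

lemma ind_pos {A : Prop} (h : A) : ind A = 1 := if_pos h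

lemma ind_neg {A : Prop} (h : ¬ A) : ind A = 0 := if_neg h

lemma ind_nonneg (A : Prop) : 0 ≤ ind A := by unfold ind; split_ifs <;> norm_num

lemma ind_le_one (A : Prop) : ind A ≤ 1 := by unfold ind; split_ifs <;> norm_num

lemma ind_mono {A B : Prop} (h : A → B) : ind A ≤ ind B := by
  by_cases hA : A
  · rw [ind_pos hA, ind_pos (h hA)]
  · rw [ind_neg hA]; exact ind_nonneg B

/-- finite product probability -/
noncomputable def Pr (p : ι → ℝ) (E : Finset ι) (A : Finset ι → Prop) : ℝ :=
  Ex p E (fun ω => ind (A ω))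

lemma Ex_empty (p : ι → ℝ) (F : Finset ι → ℝ) : Ex p ∅ F = F ∅ := by
  simp [Ex, wt]

lemma Ex_insert (p : ι → ℝ) {E : Finset ι} {e : ι} (he : e ∉ E) (F : Finset ι → ℝ) :
    Ex p (insert e E) F = (1 - p e) * Ex p E F + p e * Ex p E (fun ω => F (insert e ω)) := by
  unfold Ex
  rw [Finset.sum_powerset_insert he, Finset.mul_sum, Finset.mul_sum]
  congr 1
  · refine Finset.sum_congr rfl fun ω hω => ?_
    have h : e ∉ ω := fun h => he (Finset.mem_powerset.1 hω h)
    unfold wt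
    rw [Finset.insert_sdiff_of_notMem _ h, Finset.prod_insert (by simp [he])]
    ring
  · refine Finset.sum_congr rfl fun ω hω => ?_
    have h : e ∉ ω := fun h => he (Finset.mem_powerset.1 hω h)
    unfold wt
    have : insert e E \ insert e ω = E \ ω := by
      ext x; simp only [Finset.mem_sdiff, Finset.mem_insert]
      constructor
      · rintro ⟨h1 | h1, h2⟩
        · exact absurd (Or.inl h1) h2
        · exact ⟨h1, fun h => h2 (Or.inr h)⟩
      · rintro ⟨h1, h2⟩
        refine ⟨Or.inr h1, ?_⟩
        rintro (h3 | h3)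
        · exact he (h3 ▸ h1)
        · exact h2 h3
    rw [this, Finset.prod_insert h]
    ring

lemma Ex_congr (p : ι → ℝ) {E : Finset ι} {F G : Finset ι → ℝ} (h : ∀ ω ⊆ E, F ω = G ω) :
    Ex p E F = Ex p E G :=
  Finset.sum_congr rfl fun ω hω => by rw [h ω (Finset.mem_powerset.1 hω)]

lemma Ex_add (p : ι → ℝ) (E : Finset ι) (F G : Finset ι → ℝ) :
    Ex p E (fun ω => F ω + G ω) = Ex p E F + Ex p E G := by
  simp [Ex, mul_add, Finset.sum_add_distrib]

lemma Ex_sub (p : ι → ℝ) (E : Finset ι) (F G : Finset ι → ℝ) :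
    Ex p E (fun ω => F ω - G ω) = Ex p E F - Ex p E G := by
  simp [Ex, mul_sub, Finset.sum_sub_distrib]

lemma Ex_mul (p : ι → ℝ) (E : Finset ι) (c : ℝ) (F : Finset ι → ℝ) :
    Ex p E (fun ω => c * F ω) = c * Ex p E F := by
  simp only [Ex, Finset.mul_sum]
  exact Finset.sum_congr rfl fun _ _ => by ring

lemma Ex_mul_right (p : ι → ℝ) (E : Finset ι) (c : ℝ) (F : Finset ι → ℝ) :
    Ex p E (fun ω => F ω * c) = Ex p E F * c := by
  simp only [Ex, Finset.sum_mul]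
  exact Finset.sum_congr rfl fun _ _ => by ring

lemma Ex_sum (p : ι → ℝ) (E : Finset ι) {κ : Type*} (s : Finset κ) (F : κ → Finset ι → ℝ) :
    Ex p E (fun ω => ∑ k ∈ s, F k ω) = ∑ k ∈ s, Ex p E (F k) := by
  simp only [Ex, Finset.mul_sum]
  exact Finset.sum_comm

lemma Ex_const (p : ι → ℝ) (E : Finset ι) (c : ℝ) : Ex p E (fun _ => c) = c := by
  induction E using Finset.induction_on with
  | empty => simp [Ex_empty]
  | insert e E he ih => rw [Ex_insert p he, ih]; ring

lemma wt_nonneg {p : ι → ℝ} (h0 : ∀ e, 0 ≤ p e) (h1 : ∀ e, p e ≤ 1) (E ω : Finset ι) :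
    0 ≤ wt p E ω :=
  mul_nonneg (Finset.prod_nonneg fun e _ => h0 e)
    (Finset.prod_nonneg fun e _ => sub_nonneg.2 (h1 e))

lemma Ex_mono {p : ι → ℝ} (h0 : ∀ e, 0 ≤ p e) (h1 : ∀ e, p e ≤ 1) {E : Finset ι}
    {F G : Finset ι → ℝ} (h : ∀ ω ⊆ E, F ω ≤ G ω) : Ex p E F ≤ Ex p E G :=
  Finset.sum_le_sum fun ω hω =>
    mul_le_mul_of_nonneg_left (h ω (Finset.mem_powerset.1 hω)) (wt_nonneg h0 h1 E ω)

lemma Ex_nonneg {p : ι → ℝ} (h0 : ∀ e, 0 ≤ p e) (h1 : ∀ e, p e ≤ 1) {E : Finset ι}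
    {F : Finset ι → ℝ} (h : ∀ ω ⊆ E, 0 ≤ F ω) : 0 ≤ Ex p E F := by
  have := Ex_mono h0 h1 (F := fun _ => 0) h
  rwa [Ex_const] at this

/-- Fubini -/
lemma Ex_union (p : ι → ℝ) {E₁ E₂ : Finset ι} (h : Disjoint E₁ E₂) (F : Finset ι → ℝ) :
    Ex p (E₁ ∪ E₂) F = Ex p E₁ (fun ω₁ => Ex p E₂ (fun ω₂ => F (ω₁ ∪ ω₂))) := by
  induction E₁ using Finset.induction_on generalizing F with
  | empty => simp [Ex_empty]
  | insert e E he ih =>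
    rw [Finset.disjoint_insert_left] at h
    rw [Finset.insert_union, Ex_insert p (by simp [he, h.1]), ih h.2, ih h.2, Ex_insert p he]
    simp only [Finset.insert_union]

lemma Ex_restrict (p : ι → ℝ) {E E' : Finset ι} (h : E' ⊆ E) (F : Finset ι → ℝ) :
    Ex p E (fun ω => F (ω ∩ E')) = Ex p E' F := by
  have hE : E = E' ∪ (E \ E') := (Finset.union_sdiff_of_subset h).symm
  rw [hE, Ex_union p Finset.disjoint_sdiff]
  refine Ex_congr p fun ω hω => ?_
  rw [← Ex_const p (E \ E') (F ω)]
  refine Ex_congr p fun ω' hω' => ?_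
  congr 1
  ext x
  simp only [Finset.mem_inter, Finset.mem_union]
  constructor
  · rintro ⟨h1 | h1, h2⟩
    · exact h1
    · exact absurd h2 (Finset.mem_sdiff.1 (hω' h1)).2
  · exact fun h => ⟨Or.inl h, hω h⟩

/-- independence -/
lemma Ex_indep (p : ι → ℝ) {E E₁ E₂ : Finset ι} (h1 : E₁ ⊆ E) (h2 : E₂ ⊆ E)
    (hd : Disjoint E₁ E₂) (F G : Finset ι → ℝ) :
    Ex p E (fun ω => F (ω ∩ E₁) * G (ω ∩ E₂)) = Ex p E₁ F * Ex p E₂ G := by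
  have h3 : E₁ ∪ E₂ ⊆ E := Finset.union_subset h1 h2
  have e1 : ∀ ω : Finset ι, ω ∩ E₁ = (ω ∩ (E₁ ∪ E₂)) ∩ E₁ := fun ω => by
    ext x; simp only [Finset.mem_inter, Finset.mem_union]; tauto
  have e2 : ∀ ω : Finset ι, ω ∩ E₂ = (ω ∩ (E₁ ∪ E₂)) ∩ E₂ := fun ω => by
    ext x; simp only [Finset.mem_inter, Finset.mem_union]; tauto
  calc _ = Ex p E (fun ω => (fun η => F (η ∩ E₁) * G (η ∩ E₂)) (ω ∩ (E₁ ∪ E₂))) := by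
        refine Ex_congr p fun ω _ => ?_
        simp only [← e1, ← e2]
    _ = _ := by
        refine (Ex_restrict p h3 (fun η => F (η ∩ E₁) * G (η ∩ E₂))).trans ?_
        rw [Ex_union p hd, ← Ex_mul_right]
        refine Ex_congr p fun ω hω => ?_
        rw [← Ex_mul]
        refine Ex_congr p fun ω' hω' => ?_
        have hd' := Finset.disjoint_left.1 hd
        congr 2
        · ext x; simp only [Finset.mem_inter, Finset.mem_union]
          constructor
          · rintro ⟨h1 | h1, h2⟩
            · exact h1
            · exact absurd (hω' h1) (hd' h2)
          · exact fun h => ⟨Or.inl h, hω h⟩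
        · ext x; simp only [Finset.mem_inter, Finset.mem_union]
          constructor
          · rintro ⟨h1 | h1, h2⟩
            · exact absurd h2 (hd' (hω h1))
            · exact h1
          · exact fun h => ⟨Or.inr h, hω' h⟩

lemma Ex_image {κ : Type*} [DecidableEq κ] (p : ι → ℝ) (σ : κ → ι) (hσ : Function.Injective σ) (E : Finset κ)
    (F : Finset ι → ℝ) :
    Ex p (E.image σ) F = Ex (fun e => p (σ e)) E (fun ω => F (ω.image σ)) := by
  induction E using Finset.induction_on generalizing F with
  | empty => simp [Ex_empty]
  | insert e E he ih =>
    rw [Finset.image_insert, Ex_insert p, Ex_insert _ he, ih, ih]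
    · simp only [Finset.image_insert]
    · simpa [hσ.eq_iff] using he

section BK
variable {p : ι → ℝ} (h0 : ∀ e, 0 ≤ p e) (h1 : ∀ e, p e ≤ 1)
include h0 h1

lemma Pr_mono {E : Finset ι} {A B : Finset ι → Prop} (h : ∀ ω ⊆ E, A ω → B ω) :
    Pr p E A ≤ Pr p E B :=
  Ex_mono h0 h1 fun ω hω => ind_mono (h ω hω)

lemma Pr_nonneg {E : Finset ι} {A : Finset ι → Prop} : 0 ≤ Pr p E A :=
  Ex_nonneg h0 h1 fun ω _ => ind_nonneg _

lemma Pr_le_one {E : Finset ι} {A : Finset ι → Prop} : Pr p E A ≤ 1 := by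
  have := Ex_mono h0 h1 (E := E) (F := fun ω => ind (A ω)) (G := fun _ => 1)
    fun ω _ => ind_le_one _
  rwa [Ex_const] at this

lemma Pr_exists_le {E : Finset ι} {κ : Type*} (s : Finset κ) (A : κ → Finset ι → Prop) :
    Pr p E (fun ω => ∃ k ∈ s, A k ω) ≤ ∑ k ∈ s, Pr p E (A k) := by
  unfold Pr
  rw [← Ex_sum]
  refine Ex_mono h0 h1 fun ω _ => ?_
  have hn : ∀ k ∈ s, 0 ≤ ind (A k ω) := fun k _ => ind_nonneg _
  by_cases h : ∃ k ∈ s, A k ω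
  · obtain ⟨k, hk, hA⟩ := h
    rw [ind_pos ⟨k, hk, hA⟩, ← ind_pos hA]
    exact Finset.single_le_sum hn hk
  · rw [ind_neg h]; exact Finset.sum_nonneg hn

lemma Pr_or_le {E : Finset ι} (A B : Finset ι → Prop) :
    Pr p E (fun ω => A ω ∨ B ω) ≤ Pr p E A + Pr p E B := by
  unfold Pr
  rw [← Ex_add]
  refine Ex_mono h0 h1 fun ω _ => ?_
  by_cases hA : A ω <;> by_cases hB : B ω <;> simp [ind, hA, hB]

lemma BK_aux (E : Finset ι) : ∀ (W : Finset ι → Finset ι → Prop)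
    (_ : ∀ a a' b b', a ⊆ a' → b ⊆ b' → W a b → W a' b'),
    Pr p E (fun ω => ∃ a b, a ⊆ ω ∧ b ⊆ ω ∧ Disjoint a b ∧ W a b) ≤
      Ex p E (fun a => Ex p E (fun b => ind (W a b))) := by
  induction E using Finset.induction_on with
  | empty =>
    intro W hW
    simp only [Pr, Ex_empty]
    by_cases h : W ∅ ∅
    · rw [ind_pos h]; exact ind_le_one _
    · rw [ind_neg, ind_neg h]
      rintro ⟨a, b, ha, hb, _, hab⟩
      rw [Finset.subset_empty] at ha hb
      subst ha; subst hb; exact h hab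
  | insert e E he ih =>
    intro W hW
    have i1 := ih W hW
    have i2 := ih (fun a b => W (insert e a) b ∨ W a (insert e b)) (by
      rintro a a' b b' ha hb (h | h)
      · exact Or.inl (hW _ _ _ _ (Finset.insert_subset_insert _ ha) hb h)
      · exact Or.inr (hW _ _ _ _ ha (Finset.insert_subset_insert _ hb) h))
    have i3 : Pr p E (fun ω => ∃ a b, a ⊆ insert e ω ∧ b ⊆ insert e ω ∧ Disjoint a b ∧ W a b) ≤
        Pr p E (fun ω => ∃ a b, a ⊆ ω ∧ b ⊆ ω ∧ Disjoint a b ∧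
          (W (insert e a) b ∨ W a (insert e b))) := by
      refine Pr_mono h0 h1 fun ω hω => ?_
      rintro ⟨a, b, ha, hb, hab, hw⟩
      have hab' := Finset.disjoint_left.1 hab
      refine ⟨a.erase e, b.erase e, ?_, ?_, ?_, ?_⟩
      · exact fun x hx => by
          have := ha (Finset.mem_of_mem_erase hx)
          exact (Finset.mem_insert.1 this).resolve_left (Finset.ne_of_mem_erase hx)
      · exact fun x hx => by
          have := hb (Finset.mem_of_mem_erase hx)
          exact (Finset.mem_insert.1 this).resolve_left (Finset.ne_of_mem_erase hx)
      · exact Finset.disjoint_left.2 fun x hx hx' =>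
          hab' (Finset.mem_of_mem_erase hx) (Finset.mem_of_mem_erase hx')
      · by_cases hea : e ∈ a
        · left
          rw [Finset.insert_erase hea, Finset.erase_eq_of_notMem (hab' hea)]
          exact hw
        · right
          rw [Finset.erase_eq_of_notMem hea]
          refine hW _ _ _ _ subset_rfl ?_ hw
          intro x hx
          by_cases hxe : x = e
          · simp [hxe]
          · simp [hxe, hx]
    set I : (Finset ι → Finset ι → Prop) → ℝ :=
      fun U => Ex p E (fun a => Ex p E (fun b => ind (U a b))) with hI
    have key : I (fun a b => W (insert e a) b ∨ W a (insert e b)) + I W ≤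
        I (fun a b => W (insert e a) b) + I (fun a b => W a (insert e b)) := by
      simp only [hI]
      rw [← Ex_add, ← Ex_add]
      refine Ex_mono h0 h1 fun a _ => ?_
      rw [← Ex_add, ← Ex_add]
      refine Ex_mono h0 h1 fun b _ => ?_
      have m1 : W a b → W (insert e a) b := hW _ _ _ _ (Finset.subset_insert _ _) subset_rfl
      have m2 : W a b → W a (insert e b) := hW _ _ _ _ subset_rfl (Finset.subset_insert _ _)
      by_cases q1 : W a b
      · simp [ind, q1, m1 q1, m2 q1]
      · by_cases q2 : W (insert e a) b <;> by_cases q3 : W a (insert e b) <;> simp [ind, q1, q2, q3]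
    have key2 : I (fun a b => W (insert e a) b ∨ W a (insert e b)) ≤
        I (fun a b => W (insert e a) (insert e b)) := by
      simp only [hI]
      refine Ex_mono h0 h1 fun a _ => Ex_mono h0 h1 fun b _ => ?_
      have m1 : (W (insert e a) b ∨ W a (insert e b)) → W (insert e a) (insert e b) := by
        rintro (h | h)
        · exact hW _ _ _ _ subset_rfl (Finset.subset_insert _ _) h
        · exact hW _ _ _ _ (Finset.subset_insert _ _) subset_rfl h
      exact ind_mono m1
    unfold Pr at i1 i3 i2 ⊢
    rw [Ex_insert p he, Ex_insert p he]
    simp only [Ex_insert p he]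
    rw [Ex_add, Ex_add, Ex_mul, Ex_mul, Ex_mul, Ex_mul]
    have q0 := h0 e
    have q1 : 0 ≤ 1 - p e := sub_nonneg.2 (h1 e)
    change _ ≤ (1 - p e) * ((1 - p e) * I W + p e * I (fun a b => W a (insert e b))) +
      p e * ((1 - p e) * I (fun a b => W (insert e a) b) +
        p e * I (fun a b => W (insert e a) (insert e b)))
    have j1 := mul_le_mul_of_nonneg_left i1 q1
    have j2 := mul_le_mul_of_nonneg_left (i3.trans i2) q0
    have j3 := mul_le_mul_of_nonneg_left key (mul_nonneg q0 q1)
    have j4 := mul_le_mul_of_nonneg_left key2 (mul_nonneg q0 q0)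
    change _ ≤ (1 - p e) * I W at j1
    change _ ≤ p e * I (fun a b => W (insert e a) b ∨ W a (insert e b)) at j2
    nlinarith

/-- van den Berg--Kesten -/
lemma BK (E : Finset ι) (A B : Finset ι → Prop) (hA : ∀ a a', a ⊆ a' → A a → A a')
    (hB : ∀ a a', a ⊆ a' → B a → B a') :
    Pr p E (fun ω => ∃ a b, a ⊆ ω ∧ b ⊆ ω ∧ Disjoint a b ∧ A a ∧ B b) ≤ Pr p E A * Pr p E B := by
  refine (BK_aux h0 h1 E (fun a b => A a ∧ B b)
    (fun a a' b b' ha hb h => ⟨hA _ _ ha h.1, hB _ _ hb h.2⟩)).trans (le_of_eq ?_)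
  unfold Pr
  rw [← Ex_mul_right]
  refine Ex_congr p fun a _ => ?_
  rw [← Ex_mul]
  refine Ex_congr p fun b _ => ?_
  by_cases h : A a <;> by_cases h' : B b <;> simp [ind, h, h']
end BK

/-- Russo's formula -/
lemma Ex_hasDerivAt (J : ι → ℝ) (β : ℝ) (E : Finset ι) (F : Finset ι → ℝ) :
    HasDerivAt (fun b => Ex (fun e => 1 - Real.exp (-b * J e)) E F)
      (∑ e ∈ E, J e * Ex (fun e => 1 - Real.exp (-β * J e)) E
        (fun ω => if e ∈ ω then 0 else F (insert e ω) - F ω)) β := by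
  induction E using Finset.induction_on generalizing F with
  | empty => simpa [Ex_empty] using hasDerivAt_const β (F ∅)
  | insert e E he ih =>
    have hp : HasDerivAt (fun b => Real.exp (-b * J e)) (Real.exp (-β * J e) * (-1 * J e)) β := by
      have := ((hasDerivAt_id β).neg.mul_const (J e)).exp
      simpa using this
    have hh := ((hp.const_sub 1).const_sub 1).mul (ih F) |>.add
      ((hp.const_sub 1).mul (ih (fun ω => F (insert e ω))))
    simp only [Ex_insert _ he]
    refine HasDerivAt.congr_deriv hh ?_
    rw [Finset.sum_insert he]
    simp only [Finset.mem_insert_self, if_true]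
    rw [Ex_const]
    have e1 : Ex (fun e => 1 - Real.exp (-β * J e)) E
        (fun ω => if e ∈ ω then 0 else F (insert e ω) - F ω) =
        Ex (fun e => 1 - Real.exp (-β * J e)) E (fun ω => F (insert e ω)) -
        Ex (fun e => 1 - Real.exp (-β * J e)) E F := by
      rw [← Ex_sub]
      refine Ex_congr _ fun ω hω => ?_
      rw [if_neg fun h => he (hω h)]
    have e2 : ∀ e' ∈ E, Ex (fun e => 1 - Real.exp (-β * J e)) E (fun ω => if e' ∈ insert e ω then 0
          else F (insert e' (insert e ω)) - F (insert e ω)) =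
        Ex (fun e => 1 - Real.exp (-β * J e)) E (fun ω => if e' ∈ ω then 0
          else F (insert e (insert e' ω)) - F (insert e ω)) := by
      intro e' he'
      refine Ex_congr _ fun ω hω => ?_
      have : e' ≠ e := fun h => he (h ▸ he')
      simp only [Finset.mem_insert, this, false_or, Finset.insert_comm]
    rw [e1]
    have e3 : ∀ e' ∈ E, J e' * ((1 - (1 - Real.exp (-β * J e))) *
        Ex (fun e => 1 - Real.exp (-β * J e)) E
          (fun ω => if e' ∈ ω then 0 else F (insert e' ω) - F ω) + (1 - Real.exp (-β * J e)) *
        Ex (fun e => 1 - Real.exp (-β * J e)) E (fun ω => if e' ∈ insert e ω then 0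
          else F (insert e' (insert e ω)) - F (insert e ω))) =
        (1 - (1 - Real.exp (-β * J e))) * (J e' * Ex (fun e => 1 - Real.exp (-β * J e)) E
          (fun ω => if e' ∈ ω then 0 else F (insert e' ω) - F ω)) + (1 - Real.exp (-β * J e)) *
        (J e' * Ex (fun e => 1 - Real.exp (-β * J e)) E (fun ω => if e' ∈ ω then 0
          else F (insert e (insert e' ω)) - F (insert e ω))) := by
      intro e' he'
      rw [e2 e' he']; ring
    rw [Finset.sum_congr rfl e3, Finset.sum_add_distrib, ← Finset.mul_sum, ← Finset.mul_sum]
    ring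
end M1

section M2
open Classical
set_option linter.unusedSectionVars false
variable {U : Type*} [DecidableEq U]

/-- connection in a finite edge set -/
def R (ω : Finset (Sym2 U)) (x y : U) : Prop :=
  Relation.ReflTransGen (fun a b => a ≠ b ∧ s(a, b) ∈ ω) x y

lemma R_mono {ω ω' : Finset (Sym2 U)} (h : ω ⊆ ω') {x y : U} (hR : R ω x y) : R ω' x y :=
  Relation.ReflTransGen.mono (fun _ _ hab => ⟨hab.1, h hab.2⟩) _ _ hR

lemma R_refl (ω : Finset (Sym2 U)) (x : U) : R ω x x := Relation.ReflTransGen.refl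

lemma R_trans {ω : Finset (Sym2 U)} {x y z : U} (h : R ω x y) (h' : R ω y z) : R ω x z :=
  Relation.ReflTransGen.trans h h'

lemma R_edge {ω : Finset (Sym2 U)} {x y : U} (h : s(x, y) ∈ ω) : R ω x y := by
  by_cases hxy : x = y
  · rw [hxy]; exact R_refl _ _
  · exact Relation.ReflTransGen.single ⟨hxy, h⟩

lemma R_symm {ω : Finset (Sym2 U)} {x y : U} (h : R ω x y) : R ω y x := by
  induction h with
  | refl => exact R_refl _ _
  | tail _ hbc ih => exact R_trans (R_edge (by rw [Sym2.eq_swap]; exact hbc.2)) ih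

lemma mem_of_R {ω : Finset (Sym2 U)} {S : Finset U} (hω : ω ⊆ S.sym2) {x y : U} (hx : x ∈ S)
    (h : R ω x y) : y ∈ S := by
  induction h with
  | refl => exact hx
  | tail _ hbc _ => exact (Finset.mk_mem_sym2_iff.1 (hω hbc.2)).2

lemma last_exit {ω : Finset (Sym2 U)} {A : Finset U} {x y : U} (hx : x ∈ A) (hy : y ∉ A)
    (h : R ω x y) : ∃ a ∈ A, ∃ b, b ∉ A ∧ s(a, b) ∈ ω ∧ R (ω.filter fun e => ∀ v ∈ e, v ∉ A) b y := by
  have : (x ∉ A ∧ R (ω.filter fun e => ∀ v ∈ e, v ∉ A) x y) ∨ ∃ a ∈ A, ∃ b, b ∉ A ∧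
      s(a, b) ∈ ω ∧ R (ω.filter fun e => ∀ v ∈ e, v ∉ A) b y := by
    clear hx
    induction h using Relation.ReflTransGen.head_induction_on with
    | refl => exact Or.inl ⟨hy, R_refl _ _⟩
    | head hac _ ih =>
      rename_i a c _
      rcases ih with h | h
      · by_cases ha : a ∈ A
        · exact Or.inr ⟨a, ha, c, h.1, hac.2, h.2⟩
        · refine Or.inl ⟨ha, R_trans (R_edge ?_) h.2⟩
          rw [Finset.mem_filter]
          refine ⟨hac.2, fun v hv => ?_⟩
          rcases Sym2.mem_iff.1 hv with rfl | rfl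
          · exact ha
          · exact h.1
      · exact Or.inr h
  rcases this with h | h
  · exact absurd hx h.1
  · exact h

lemma R_within {ω : Finset (Sym2 U)} {A : Finset U} {x y : U} (hA : ∀ v, R ω x v → v ∈ A)
    (h : R ω x y) : R (ω ∩ A.sym2) x y := by
  induction h with
  | refl => exact R_refl _ _
  | tail hab hbc ih =>
    refine R_trans ih (R_edge (Finset.mem_inter.2 ⟨hbc.2, Finset.mk_mem_sym2_iff.2 ⟨hA _ hab, ?_⟩⟩))
    exact hA _ (R_trans hab (R_edge hbc.2))

/-- two point function in a finite set -/
noncomputable def tau (p : Sym2 U → ℝ) (S : Finset U) (x y : U) : ℝ := Pr p S.sym2 (fun ω => R ω x y)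

lemma tau_symm (p : Sym2 U → ℝ) (S : Finset U) (x y : U) : tau p S x y = tau p S y x := by
  unfold tau; congr 1; ext ω; exact ⟨R_symm, R_symm⟩

lemma Pr_restrict {ι : Type*} [DecidableEq ι] (p : ι → ℝ) {E E' : Finset ι} (h : E' ⊆ E) (A : Finset ι → Prop) :
    Pr p E (fun ω => A (ω ∩ E')) = Pr p E' A :=
  Ex_restrict p h (fun ω => ind (A ω))

lemma Pr_mem {ι : Type*} [DecidableEq ι] (p : ι → ℝ) (e : ι) : Pr p {e} (fun ω => e ∈ ω) = p e := by
  have := Ex_insert p (Finset.notMem_empty e) (fun ω => ind (e ∈ ω))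
  simpa [Pr, Ex_empty, ind] using this

lemma tau_eq_zero (p : Sym2 U → ℝ) {S : Finset U} {x y : U} (hx : x ∈ S) (hy : y ∉ S) :
    tau p S x y = 0 := by
  refine (Ex_congr p (G := fun _ => 0) fun ω hω => ?_).trans (Ex_const p S.sym2 0)
  exact ind_neg fun h => hy (mem_of_R hω hx h)

section SL
variable {p : Sym2 U → ℝ} (h0 : ∀ e, 0 ≤ p e) (h1 : ∀ e, p e ≤ 1)
include h0 h1

lemma tau_nonneg (S : Finset U) (x y : U) : 0 ≤ tau p S x y := Pr_nonneg h0 h1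

lemma tau_le_one (S : Finset U) (x y : U) : tau p S x y ≤ 1 := Pr_le_one h0 h1

lemma tau_mono {S Λ : Finset U} (h : S ⊆ Λ) (x y : U) : tau p S x y ≤ tau p Λ x y := by
  unfold tau
  rw [← Pr_restrict p (Finset.sym2_mono h) (fun ω => R ω x y)]
  exact Pr_mono h0 h1 fun ω _ hR => R_mono Finset.inter_subset_left hR

/-- Simon--Lieb -/
lemma simon_lieb {S Λ : Finset U} (hS : S ⊆ Λ) {x : U} (hx : x ∈ S) (y : U) :
    tau p Λ x y ≤ tau p S x y +
      ∑ a ∈ S, ∑ b ∈ Λ \ S, tau p S x a * p s(a, b) * tau p Λ b y := by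
  have hS2 := Finset.sym2_mono hS
  let D : U × U → Finset (Sym2 U) → Prop := fun ab ω => ∃ F₁ F₂, F₁ ⊆ ω ∧ F₂ ⊆ ω ∧ Disjoint F₁ F₂ ∧
    (R (F₁ ∩ S.sym2) x ab.1 ∧ s(ab.1, ab.2) ∈ F₁) ∧ R F₂ ab.2 y
  have key : tau p Λ x y ≤ Pr p Λ.sym2 (fun ω => R (ω ∩ S.sym2) x y ∨
      ∃ ab ∈ S ×ˢ (Λ \ S), D ab ω) := by
    refine Pr_mono h0 h1 fun ω hω hR => ?_
    by_cases hy : R (ω ∩ S.sym2) x y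
    · exact Or.inl hy
    right
    set A := S.filter (R (ω ∩ S.sym2) x) with hA
    have hxA : x ∈ A := Finset.mem_filter.2 ⟨hx, R_refl _ _⟩
    have hyA : y ∉ A := fun h => hy (Finset.mem_filter.1 h).2
    obtain ⟨a, ha, b, hb, hab, hby⟩ := last_exit hxA hyA hR
    have haS := (Finset.mem_filter.1 ha).1
    have hbL : b ∈ Λ := (Finset.mk_mem_sym2_iff.1 (hω hab)).2
    have hbS : b ∉ S := fun h => hb (Finset.mem_filter.2 ⟨h, R_trans (Finset.mem_filter.1 ha).2
      (R_edge (Finset.mem_inter.2 ⟨hab, Finset.mk_mem_sym2_iff.2 ⟨haS, h⟩⟩))⟩)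
    refine ⟨(a, b), Finset.mem_product.2 ⟨haS, Finset.mem_sdiff.2 ⟨hbL, hbS⟩⟩,
      insert s(a, b) (ω ∩ A.sym2), _, ?_, Finset.filter_subset _ _, ?_, ⟨?_, by simp⟩, hby⟩
    · exact Finset.insert_subset hab Finset.inter_subset_left
    · rw [Finset.disjoint_left]
      intro e he he'
      have he' := (Finset.mem_filter.1 he').2
      rcases Finset.mem_insert.1 he with rfl | he
      · exact he' a (by simp) ha
      · induction e using Sym2.ind with
        | _ u v =>
        exact he' u (by simp) (Finset.mk_mem_sym2_iff.1 (Finset.mem_inter.1 he).2).1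
    · have h2 : R (ω ∩ S.sym2 ∩ A.sym2) x a := R_within (fun v hv =>
        Finset.mem_filter.2 ⟨mem_of_R Finset.inter_subset_right hx hv, hv⟩) (Finset.mem_filter.1 ha).2
      refine R_mono (fun e he => ?_) h2
      simp only [Finset.mem_inter, Finset.mem_insert] at he ⊢
      exact ⟨Or.inr ⟨he.1.1, he.2⟩, he.1.2⟩
  refine key.trans ((Pr_or_le h0 h1 _ _).trans (add_le_add (Pr_restrict p hS2 (fun ω => R ω x y)).le ?_))
  refine (Pr_exists_le h0 h1 _ _).trans ?_
  rw [Finset.sum_product]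
  refine Finset.sum_le_sum fun a ha => Finset.sum_le_sum fun b hb => ?_
  refine (BK h0 h1 Λ.sym2 (fun F => R (F ∩ S.sym2) x a ∧ s(a, b) ∈ F) (fun F => R F b y)
    (fun F F' h hh => ⟨R_mono (Finset.inter_subset_inter_right h) hh.1, h hh.2⟩)
    (fun F F' h hh => R_mono h hh)).trans (mul_le_mul_of_nonneg_right (le_of_eq ?_)
      (tau_nonneg h0 h1 _ _ _))
  have hb' := Finset.mem_sdiff.1 hb
  have hE : ({s(a, b)} : Finset (Sym2 U)) ⊆ Λ.sym2 := by
    simp [hS ha, hb'.1]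
  have hd : Disjoint S.sym2 ({s(a, b)} : Finset (Sym2 U)) := by
    simp [hb'.2]
  have := Ex_indep p hS2 hE hd (fun ω => ind (R ω x a))
    (fun ω => ind (s(a, b) ∈ ω))
  rw [← Pr_mem p s(a, b)]
  refine Eq.trans ?_ this
  unfold Pr
  refine Ex_congr p fun ω _ => ?_
  by_cases q1 : R (ω ∩ S.sym2) x a <;> by_cases q2 : s(a, b) ∈ ω <;> simp [ind, q1, q2]
end SL

/-- union of clusters of `B` -/
noncomputable def KB (Λ B : Finset U) (ω : Finset (Sym2 U)) : Finset U :=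
  Λ.filter fun v => ∃ b ∈ B, R ω b v

lemma KB_iff {Λ B K : Finset U} (hB : B ⊆ Λ) {ω : Finset (Sym2 U)} (hω : ω ⊆ Λ.sym2) :
    KB Λ B (ω ∩ (Λ.sym2 \ (Λ \ K).sym2)) = K ↔ KB Λ B ω = K := by
  set ω' := ω ∩ (Λ.sym2 \ (Λ \ K).sym2)
  have hsub : KB Λ B ω' ⊆ KB Λ B ω := Finset.monotone_filter_right _ fun v _ ⟨b, hb, h⟩ =>
    ⟨b, hb, R_mono Finset.inter_subset_left h⟩
  constructor
  · intro h
    refine Finset.Subset.antisymm (fun v hv => ?_) (h ▸ hsub)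
    obtain ⟨hvL, b, hb, hR⟩ := Finset.mem_filter.1 hv
    by_contra hvK
    have hbK : b ∈ K := by
      rw [← h]; exact Finset.mem_filter.2 ⟨hB hb, b, hb, R_refl _ _⟩
    obtain ⟨a, ha, c, hc, hac, -⟩ := last_exit hbK hvK hR
    apply hc
    rw [← h] at ha ⊢
    obtain ⟨haL, b', hb', hR'⟩ := Finset.mem_filter.1 ha
    have haK := h ▸ ha
    refine Finset.mem_filter.2 ⟨(Finset.mk_mem_sym2_iff.1 (hω hac)).2, b', hb', R_trans hR'
      (R_edge ?_)⟩
    refine Finset.mem_inter.2 ⟨hac, Finset.mem_sdiff.2 ⟨hω hac, fun h' => ?_⟩⟩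
    exact (Finset.mem_sdiff.1 (Finset.mk_mem_sym2_iff.1 h').1).2 haK
  · intro h
    refine Finset.Subset.antisymm (h ▸ hsub) (fun v hv => ?_)
    rw [← h] at hv
    obtain ⟨hvL, b, hb, hR⟩ := Finset.mem_filter.1 hv
    refine Finset.mem_filter.2 ⟨hvL, b, hb, ?_⟩
    have := R_within (A := K) (fun v hv => by
      rw [← h]; exact Finset.mem_filter.2 ⟨mem_of_R hω (hB hb) hv, b, hb, hv⟩) hR
    refine R_mono (fun e he => ?_) this
    obtain ⟨he1, he2⟩ := Finset.mem_inter.1 he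
    refine Finset.mem_inter.2 ⟨he1, Finset.mem_sdiff.2 ⟨hω he1, fun h' => ?_⟩⟩
    induction e using Sym2.ind with
    | _ u w =>
    exact (Finset.mem_sdiff.1 (Finset.mk_mem_sym2_iff.1 h').1).2 (Finset.mk_mem_sym2_iff.1 he2).1

/-- exploration -/
lemma explore (p : Sym2 U → ℝ) {Λ B : Finset U} (hB : B ⊆ Λ)
    (G : Finset U → Finset (Sym2 U) → ℝ) :
    Ex p Λ.sym2 (fun ω => G (KB Λ B ω) (ω ∩ (Λ \ KB Λ B ω).sym2)) =
      Ex p Λ.sym2 (fun ω => Ex p (Λ \ KB Λ B ω).sym2 (G (KB Λ B ω))) := by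
  have hs : ∀ ω (f : Finset U → ℝ), f (KB Λ B ω) =
      ∑ K ∈ Λ.powerset, (if KB Λ B ω = K then 1 else 0) * f K := fun ω f => by
    simp only [ite_mul, one_mul, zero_mul]
    have : KB Λ B ω ∈ Λ.powerset := Finset.mem_powerset.2 (Finset.filter_subset _ _)
    rw [Finset.sum_ite_eq, if_pos this]
  have e1 : ∀ ω, G (KB Λ B ω) (ω ∩ (Λ \ KB Λ B ω).sym2) = _ := fun ω =>
    hs ω (fun K => G K (ω ∩ (Λ \ K).sym2))
  have e2 : ∀ ω, Ex p (Λ \ KB Λ B ω).sym2 (G (KB Λ B ω)) = _ := fun ω =>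
    hs ω (fun K => Ex p (Λ \ K).sym2 (G K))
  simp only [e1, e2]
  rw [Ex_sum, Ex_sum]
  refine Finset.sum_congr rfl fun K hK => ?_
  have hsub : (Λ \ K).sym2 ⊆ Λ.sym2 := Finset.sym2_mono Finset.sdiff_subset
  have hI := Ex_indep p (E := Λ.sym2) (Finset.sdiff_subset (s := Λ.sym2) (t := (Λ \ K).sym2)) hsub
    Finset.sdiff_disjoint (fun ω => if KB Λ B ω = K then 1 else 0) (G K)
  rw [Ex_mul_right]
  refine Eq.trans ?_ (hI.trans ?_)
  · refine Ex_congr p fun ω hω => ?_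
    simp only [KB_iff hB hω]
  · congr 1
    rw [← Ex_restrict p (Finset.sdiff_subset (s := Λ.sym2) (t := (Λ \ K).sym2))]
    refine Ex_congr p fun ω hω => ?_
    simp only [KB_iff hB hω]

/-- the edge probabilities -/
noncomputable def pb (J : Sym2 U → ℝ) (β : ℝ) (e : Sym2 U) : ℝ := 1 - Real.exp (-β * J e)

lemma pb_nonneg {J : Sym2 U → ℝ} (hJ : ∀ e, 0 ≤ J e) {β : ℝ} (hβ : 0 ≤ β) (e) : 0 ≤ pb J β e := by
  unfold pb
  have : Real.exp (-β * J e) ≤ 1 := Real.exp_le_one_iff.2 (by nlinarith [mul_nonneg hβ (hJ e)])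
  linarith

lemma pb_le_one (J : Sym2 U → ℝ) (β : ℝ) (e) : pb J β e ≤ 1 := by
  unfold pb
  linarith [Real.exp_pos (-β * J e)]

lemma pb_le (J : Sym2 U → ℝ) (β : ℝ) (e) : pb J β e ≤ β * J e := by
  unfold pb
  linarith [Real.add_one_le_exp (-β * J e)]

/-- Russo lower bound -/
lemma russo_lower {J : Sym2 U → ℝ} (hJ : ∀ e, 0 ≤ J e) {β : ℝ} (hβ : 0 ≤ β) {Λ B : Finset U}
    (hB : B ⊆ Λ) (x : U) : ∃ f', HasDerivAt (fun b => Pr (pb J b) Λ.sym2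
      (fun ω => ∃ b ∈ B, R ω b x)) f' β ∧
      Ex (pb J β) Λ.sym2 (fun ω => ∑ z ∈ KB Λ B ω, ∑ z' ∈ Λ \ KB Λ B ω, J s(z, z') *
        tau (pb J β) (Λ \ KB Λ B ω) z' x) ≤ f' := by
  refine ⟨_, Ex_hasDerivAt J β Λ.sym2 _, ?_⟩
  change _ ≤ ∑ e ∈ Λ.sym2, J e * Ex (pb J β) Λ.sym2 _
  simp only [← Ex_mul]
  rw [← Ex_sum]
  have := explore (pb J β) hB (fun K η => ∑ z ∈ K, ∑ z' ∈ Λ \ K, J s(z, z') *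
    ind (R η z' x))
  simp only [Ex_sum, Ex_mul] at this
  change _ = Ex (pb J β) Λ.sym2 (fun ω => ∑ z ∈ KB Λ B ω, ∑ z' ∈ Λ \ KB Λ B ω, J s(z, z') *
        tau (pb J β) (Λ \ KB Λ B ω) z' x) at this
  rw [← this]
  refine Ex_mono (pb_nonneg hJ hβ) (pb_le_one J β) fun ω hω => ?_
  set K := KB Λ B ω with hK
  rw [← Finset.sum_product']
  have hinj : Set.InjOn (fun q : U × U => s(q.1, q.2)) (K ×ˢ (Λ \ K) : Finset (U × U)) := by
    rintro ⟨a, b⟩ h ⟨a', b'⟩ h' hh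
    simp only [Finset.coe_product, Set.mem_prod, Finset.mem_coe, Finset.mem_sdiff] at h h'
    rcases Sym2.eq_iff.1 hh with ⟨h1, h2⟩ | ⟨h1, h2⟩
    · simp_all
    · simp only at h1
      exact absurd (h1 ▸ h.1) h'.2.2
  have hKL : K ⊆ Λ := Finset.filter_subset _ _
  have hnn : ∀ e, 0 ≤ J e * (if e ∈ ω then 0 else ind (∃ b ∈ B, R (insert e ω) b x)
      - ind (∃ b ∈ B, R ω b x)) := fun e => by
    refine mul_nonneg (hJ e) ?_
    split_ifs
    · exact le_rfl
    · exact sub_nonneg.2 (ind_mono fun ⟨b, hb, hR⟩ => ⟨b, hb, R_mono (Finset.subset_insert _ _) hR⟩)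
  calc _ ≤ ∑ q ∈ K ×ˢ (Λ \ K), (fun e => J e * (if e ∈ ω then 0 else
        ind (∃ b ∈ B, R (insert e ω) b x)
          - ind (∃ b ∈ B, R ω b x))) s(q.1, q.2) := by
        refine Finset.sum_le_sum ?_
        rintro ⟨z, z'⟩ hq
        obtain ⟨hz, hz'⟩ := Finset.mem_product.1 hq
        dsimp only at hz hz' ⊢
        by_cases hR : R (ω ∩ (Λ \ K).sym2) z' x
        · rw [ind_pos hR]
          have hx : x ∈ Λ \ K := mem_of_R Finset.inter_subset_right hz' hR
          refine mul_le_mul_of_nonneg_left ?_ (hJ _)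
          obtain ⟨hzL, b, hb, hbz⟩ := Finset.mem_filter.1 hz
          have c1 : s(z, z') ∉ ω := fun h => (Finset.mem_sdiff.1 hz').2
            (Finset.mem_filter.2 ⟨(Finset.mem_sdiff.1 hz').1, b, hb, R_trans hbz (R_edge h)⟩)
          have c2 : ∃ b ∈ B, R (insert s(z, z') ω) b x :=
            ⟨b, hb, R_trans (R_mono (Finset.subset_insert _ _) hbz) (R_trans (R_edge (by simp))
              (R_mono (Finset.inter_subset_left.trans (Finset.subset_insert _ _)) hR))⟩
          have c3 : ¬ ∃ b ∈ B, R ω b x := fun ⟨b, hb, h⟩ => (Finset.mem_sdiff.1 hx).2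
            (Finset.mem_filter.2 ⟨(Finset.mem_sdiff.1 hx).1, b, hb, h⟩)
          rw [if_neg c1, ind_pos c2, ind_neg c3, sub_zero]
        · rw [ind_neg hR, mul_zero]; exact hnn _
    _ ≤ _ := by
        refine (Finset.sum_image (f := fun e => J e * (if e ∈ ω then 0 else
          ind (∃ b ∈ B, R (insert e ω) b x) - ind (∃ b ∈ B, R ω b x)))
          (g := fun q : U × U => s(q.1, q.2)) (fun a ha b hb h => hinj ha hb h)).symm.le.trans ?_
        refine Finset.sum_le_sum_of_subset_of_nonneg ?_ fun e _ _ => hnn e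
        intro e he
        obtain ⟨⟨z, z'⟩, hq, rfl⟩ := Finset.mem_image.1 he
        obtain ⟨hz, hz'⟩ := Finset.mem_product.1 hq
        exact Finset.mk_mem_sym2_iff.2 ⟨hKL hz, (Finset.mem_sdiff.1 hz').1⟩
end M2

section M3
open Classical
set_option linter.unusedSectionVars false
variable {U : Type*} [DecidableEq U]

/-- cluster -/
noncomputable def cl (Λ : Finset U) (ω : Finset (Sym2 U)) (x : U) : Finset U := Λ.filter (R ω x)

lemma mem_cl {Λ : Finset U} {ω : Finset (Sym2 U)} {x y : U} : y ∈ cl Λ ω x ↔ y ∈ Λ ∧ R ω x y :=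
  Finset.mem_filter

lemma cl_mono {Λ : Finset U} {ω ω' : Finset (Sym2 U)} (h : ω ⊆ ω') (x : U) :
    cl Λ ω x ⊆ cl Λ ω' x := fun _ hv => mem_cl.2 ⟨(mem_cl.1 hv).1, R_mono h (mem_cl.1 hv).2⟩

lemma cl_eq {Λ : Finset U} {ω : Finset (Sym2 U)} {x y : U} (h : R ω x y) : cl Λ ω x = cl Λ ω y := by
  ext v; rw [mem_cl, mem_cl]
  exact and_congr_right fun _ => ⟨R_trans (R_symm h), R_trans h⟩

lemma R_erase {F : Finset (Sym2 U)} {x y a b : U} (h : R F a b) :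
    R (F.erase s(x, y)) a b ∨ R (F.erase s(x, y)) x b ∨ R (F.erase s(x, y)) y b := by
  induction h with
  | refl => exact Or.inl (R_refl _ _)
  | tail _ hbc ih =>
    rename_i b c _
    by_cases he : s(b, c) = s(x, y)
    · rcases Sym2.eq_iff.1 he with h | h
      · rw [h.2]; exact Or.inr (Or.inr (R_refl _ _))
      · rw [h.2]; exact Or.inr (Or.inl (R_refl _ _))
    · have hE : R (F.erase s(x, y)) b c := R_edge (Finset.mem_erase.2 ⟨he, hbc.2⟩)
      exact ih.imp (R_trans · hE) (Or.imp (R_trans · hE) (R_trans · hE))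

lemma split_step {Λ : Finset U} {n : ℕ} {F : Finset (Sym2 U)} (hF : F ⊆ Λ.sym2)
    (ih : ∀ F' ⊂ F, ∀ x ∈ Λ, n ≤ (cl Λ F' x).card → ∃ F₁ F₂ y, F₁ ⊆ F' ∧ F₂ ⊆ F' ∧
      Disjoint F₁ F₂ ∧ y ∈ Λ ∧ n ≤ (cl Λ F₂ y).card ∧ (cl Λ F₂ y).card < 2 * n ∧
      (cl Λ F' x).card ≤ (cl Λ F₁ x).card + (cl Λ F₂ y).card) {p q : U} (hpq : s(p, q) ∈ F)
    (hR : ¬ R (F.erase s(p, q)) p q) (hn : n ≤ (cl Λ (F.erase s(p, q)) q).card) :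
    ∃ F₁ F₂ y, F₁ ⊆ F ∧ F₂ ⊆ F ∧ Disjoint F₁ F₂ ∧ y ∈ Λ ∧ n ≤ (cl Λ F₂ y).card ∧
      (cl Λ F₂ y).card < 2 * n ∧ s(p, q) ∈ F₁ ∧ (cl Λ (F.erase s(p, q)) p).card +
      (cl Λ (F.erase s(p, q)) q).card ≤ (cl Λ F₁ p).card + (cl Λ F₂ y).card := by
  set F' := F.erase s(p, q) with hF'
  have hpqΛ := Finset.mk_mem_sym2_iff.1 (hF hpq)
  have hF'F : F' ⊆ F := Finset.erase_subset _ _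
  set K₁ := cl Λ F' p
  set K₂ := cl Λ F' q with hK₂
  have hc : ∀ r ∈ Λ, ∀ v, R F' r v → R (F' ∩ (cl Λ F' r).sym2) r v := fun r hr v =>
    R_within fun v hv => mem_cl.2 ⟨mem_of_R (hF'F.trans hF) hr hv, hv⟩
  have hK2 : cl Λ (F' ∩ K₂.sym2) q = K₂ := Finset.Subset.antisymm
    (cl_mono Finset.inter_subset_left _)
    fun v hv => mem_cl.2 ⟨(mem_cl.1 hv).1, hc q hpqΛ.2 v (mem_cl.1 hv).2⟩
  obtain ⟨F₁, F₂, y, h1, h2, h3, h4, h5, h6, h7⟩ := ih (F' ∩ K₂.sym2)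
    (lt_of_le_of_lt Finset.inter_subset_left (Finset.erase_ssubset hpq)) q hpqΛ.2 (by rwa [hK2])
  rw [hK2] at h7
  have hdis : Disjoint K₁ K₂ := Finset.disjoint_left.2 fun v hv hv' =>
    hR (R_trans (mem_cl.1 hv).2 (R_symm (mem_cl.1 hv').2))
  refine ⟨insert s(p, q) (F' ∩ K₁.sym2 ∪ F₁), F₂, y, ?_, (h2.trans Finset.inter_subset_left).trans hF'F,
    ?_, h4, h5, h6, by simp, ?_⟩
  · exact Finset.insert_subset hpq ((Finset.union_subset Finset.inter_subset_left
      (h1.trans Finset.inter_subset_left)).trans hF'F)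
  · rw [Finset.disjoint_left]
    intro e he he2
    have he2' := Finset.mem_inter.1 (h2 he2)
    rcases Finset.mem_insert.1 he with rfl | he
    · simp [hF'] at he2'
    rcases Finset.mem_union.1 he with he | he
    · induction e using Sym2.ind with
      | _ u v =>
      exact Finset.disjoint_left.1 hdis (Finset.mk_mem_sym2_iff.1 (Finset.mem_inter.1 he).2).1
        (Finset.mk_mem_sym2_iff.1 he2'.2).1
    · exact Finset.disjoint_left.1 h3 he he2
  · have : K₁ ∪ cl Λ F₁ q ⊆ cl Λ (insert s(p, q) (F' ∩ K₁.sym2 ∪ F₁)) p := by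
      intro v hv
      rcases Finset.mem_union.1 hv with hv | hv
      · refine mem_cl.2 ⟨(mem_cl.1 hv).1, R_mono ?_ (hc p hpqΛ.1 v (mem_cl.1 hv).2)⟩
        exact Finset.subset_union_left.trans (Finset.subset_insert _ _)
      · refine mem_cl.2 ⟨(mem_cl.1 hv).1, R_trans (R_edge (by simp)) (R_mono ?_ (mem_cl.1 hv).2)⟩
        exact Finset.subset_union_right.trans (Finset.subset_insert _ _)
    have hle := Finset.card_le_card this
    rw [Finset.card_union_of_disjoint (hdis.mono_right
      (cl_mono (h1.trans Finset.inter_subset_left) q))] at hle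
    omega

lemma split (Λ : Finset U) {n : ℕ} (hn : 1 ≤ n) (F : Finset (Sym2 U)) : F ⊆ Λ.sym2 →
    ∀ x ∈ Λ, n ≤ (cl Λ F x).card → ∃ F₁ F₂ y, F₁ ⊆ F ∧ F₂ ⊆ F ∧
      Disjoint F₁ F₂ ∧ y ∈ Λ ∧ n ≤ (cl Λ F₂ y).card ∧ (cl Λ F₂ y).card < 2 * n ∧
      (cl Λ F x).card ≤ (cl Λ F₁ x).card + (cl Λ F₂ y).card := by
  induction F using Finset.strongInduction with
  | _ F ih =>
  intro hF x hx hc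
  replace ih := fun F' (h : F' ⊂ F) => ih F' h (h.1.trans hF)
  by_cases h2 : (cl Λ F x).card < 2 * n
  · exact ⟨∅, F, x, by simp, subset_rfl, by simp, hx, hc, h2, by omega⟩
  have hex : ∃ y, x ≠ y ∧ s(x, y) ∈ F := by
    by_contra hcon
    push Not at hcon
    have : cl Λ F x ⊆ {x} := fun v hv => by
      rcases Relation.ReflTransGen.cases_head (mem_cl.1 hv).2 with h | ⟨c, h, -⟩
      · simp [h]
      · exact absurd h.2 (hcon c h.1)
    have := Finset.card_le_card this
    simp at this; omega
  obtain ⟨y, hxy, hF2⟩ := hex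
  set F' := F.erase s(x, y) with hF'
  have hsub : cl Λ F x ⊆ cl Λ F' x ∪ cl Λ F' y := fun v hv => by
    have hv := mem_cl.1 hv
    rw [Finset.mem_union, mem_cl, mem_cl]
    rcases R_erase (x := x) (y := y) hv.2 with h | h | h
    · exact Or.inl ⟨hv.1, h⟩
    · exact Or.inl ⟨hv.1, h⟩
    · exact Or.inr ⟨hv.1, h⟩
  have hss : F' ⊂ F := Finset.erase_ssubset hF2
  by_cases hR : R F' x y
  · rw [← cl_eq hR, Finset.union_self] at hsub
    have he : cl Λ F' x = cl Λ F x := Finset.Subset.antisymm (cl_mono hss.1 x) hsub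
    obtain ⟨F₁, F₂, y, h1, h2, h⟩ := ih F' hss x hx (by rwa [he])
    rw [he] at h
    exact ⟨F₁, F₂, y, h1.trans hss.1, h2.trans hss.1, h⟩
  have hle := (Finset.card_le_card hsub).trans (Finset.card_union_le _ _)
  by_cases hn2 : n ≤ (cl Λ F' y).card
  · obtain ⟨F₁, F₂, z, a1, a2, a3, a4, a5, a6, -, a7⟩ := split_step hF ih hF2 hR hn2
    exact ⟨F₁, F₂, z, a1, a2, a3, a4, a5, a6, hle.trans a7⟩
  · rw [hF', Sym2.eq_swap] at hn2 hle hR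
    rw [Sym2.eq_swap] at hF2
    obtain ⟨F₁, F₂, z, a1, a2, a3, a4, a5, a6, a8, a7⟩ := split_step hF ih hF2
      (fun h => hR (R_symm h)) (by omega)
    rw [cl_eq (R_edge a8)] at a7
    exact ⟨F₁, F₂, z, a1, a2, a3, a4, a5, a6, by omega⟩

lemma sq_le_aux (w N : ℕ) (h : w ≤ N) :
    (w : ℝ) ^ 2 ≤ 4 * w + 32 * ∑ n ∈ Finset.Icc 1 N, (n : ℝ) * ind (4 * n ≤ w) := by
  have h1 : ∑ n ∈ Finset.range (w / 4 + 1), n ≤ ∑ n ∈ (Finset.Icc 1 N).filter (fun n => 4 * n ≤ w), n := by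
    rw [Finset.sum_range_succ', add_zero, Finset.sum_bij_ne_zero (s := Finset.range (w / 4))
      (t := (Finset.Icc 1 (w / 4))) (g := fun n => n) (fun a _ _ => a + 1)]
    · refine Finset.sum_le_sum_of_subset fun n hn => ?_
      simp only [Finset.mem_Icc, Finset.mem_filter] at hn ⊢
      omega
    · intro a ha _
      simp only [Finset.mem_range, Finset.mem_Icc] at ha ⊢; omega
    · intro a _ _ b _ _ h; omega
    · intro b hb hb0
      simp only [Finset.mem_Icc] at hb
      exact ⟨b - 1, by simp; omega, by omega, by omega⟩
    · intros; rfl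
  have h2 := Finset.sum_range_id_mul_two (w / 4 + 1)
  simp only [add_tsub_cancel_right] at h2
  have h3 : ∑ n ∈ Finset.Icc 1 N, (n : ℝ) * ind (4 * n ≤ w) =
      ((∑ n ∈ (Finset.Icc 1 N).filter (fun n => 4 * n ≤ w), n : ℕ) : ℝ) := by
    rw [Finset.sum_filter]; push_cast
    refine Finset.sum_congr rfl fun n _ => ?_
    unfold ind; split_ifs <;> simp
  rw [h3]
  have h4 : w ^ 2 ≤ 4 * w + 32 * ∑ n ∈ (Finset.Icc 1 N).filter (fun n => 4 * n ≤ w), n := by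
    have h5 : w ≤ 4 * (w / 4) + 3 := by omega
    have h6 : 4 * (w / 4) ≤ w := by omega
    generalize w / 4 = m at *
    nlinarith
  exact_mod_cast h4

lemma sum_ind_le (f : ℕ → ℝ) (w N : ℕ) (B : ℝ) (hB : ∀ n, n ≤ w → f n ≤ B) (hB0 : 0 ≤ B)  :
    ∑ n ∈ Finset.Icc 1 N, f n * ind (n ≤ w) ≤ w * B := by
  calc _ ≤ ∑ n ∈ Finset.Icc 1 N, if n ≤ w then B else 0 := by
        refine Finset.sum_le_sum fun n _ => ?_
        unfold ind; split_ifs with h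
        · simpa using hB n h
        · simp
    _ ≤ _ := by
        rw [← Finset.sum_filter, Finset.sum_const, nsmul_eq_mul]
        refine mul_le_mul_of_nonneg_right ?_ hB0
        have : ((Finset.Icc 1 N).filter (fun n => n ≤ w)).card ≤ (Finset.Icc 1 w).card :=
          Finset.card_le_card fun n => by simp; omega
        rw [Nat.card_Icc, add_tsub_cancel_right] at this
        exact_mod_cast this

section T4
variable {p : Sym2 U → ℝ} (h0 : ∀ e, 0 ≤ p e) (h1 : ∀ e, p e ≤ 1)
include h0 h1

lemma Pr_four (Λ : Finset U) {n : ℕ} (hn : 1 ≤ n) {x : U} (hx : x ∈ Λ) :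
    Pr p Λ.sym2 (fun ω => 4 * n ≤ (cl Λ ω x).card) ≤
      Pr p Λ.sym2 (fun ω => n ≤ (cl Λ ω x).card) *
      Pr p Λ.sym2 (fun ω => ∃ y ∈ Λ, n ≤ (cl Λ ω y).card) := by
  refine le_trans (Pr_mono h0 h1 fun ω hω h => ?_) (BK h0 h1 Λ.sym2 _ _
    (fun a a' h hh => hh.trans (Finset.card_le_card (cl_mono h x)))
    (fun a a' h ⟨y, hy, hh⟩ => ⟨y, hy, hh.trans (Finset.card_le_card (cl_mono h y))⟩))
  obtain ⟨F₁, F₂, y, a1, a2, a3, a4, a5, a6, a7⟩ := split Λ hn ω hω x hx (by omega)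
  exact ⟨F₁, F₂, a1, a2, a3, by omega, y, a4, a5⟩

omit h0 h1 in
lemma card_cl_eq (Λ : Finset U) (ω : Finset (Sym2 U)) (x : U) :
    ((cl Λ ω x).card : ℝ) = ∑ y ∈ Λ, ind (R ω x y) := by
  unfold cl ind
  rw [Finset.card_filter]; push_cast; rfl

omit h0 h1 in
lemma Ex_card (Λ : Finset U) (p : Sym2 U → ℝ) (x : U) :
    Ex p Λ.sym2 (fun ω => ((cl Λ ω x).card : ℝ)) = ∑ y ∈ Λ, tau p Λ x y := by
  simp only [card_cl_eq]; exact Ex_sum _ _ _ _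

lemma Pr_big (Λ : Finset U) {n : ℕ} :
    (n : ℝ) ^ 2 * Pr p Λ.sym2 (fun ω => ∃ y ∈ Λ, n ≤ (cl Λ ω y).card) ≤
      ∑ x ∈ Λ, ∑ y ∈ Λ, tau p Λ x y := by
  simp only [← Ex_card]
  unfold Pr
  rw [← Ex_sum, ← Ex_mul]
  refine Ex_mono h0 h1 fun ω hω => ?_
  by_cases h : ∃ y ∈ Λ, n ≤ (cl Λ ω y).card
  · rw [ind_pos h, mul_one]
    obtain ⟨y, hy, h⟩ := h
    have h : (n : ℝ) ≤ (cl Λ ω y).card := by exact_mod_cast h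
    calc (n : ℝ) ^ 2 ≤ ∑ x ∈ cl Λ ω y, ((cl Λ ω y).card : ℝ) := by
          rw [Finset.sum_const, nsmul_eq_mul]; nlinarith
      _ = ∑ x ∈ cl Λ ω y, ((cl Λ ω x).card : ℝ) :=
          Finset.sum_congr rfl fun x hx => by rw [cl_eq (mem_cl.1 hx).2]
      _ ≤ _ := Finset.sum_le_sum_of_subset_of_nonneg (Finset.filter_subset _ _)
          fun _ _ _ => Nat.cast_nonneg _
  · rw [ind_neg h, mul_zero]
    exact Finset.sum_nonneg fun _ _ => Nat.cast_nonneg _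

lemma E3_bound (Λ : Finset U) (θ : ℕ) (hθ : 1 ≤ θ)
    (hT : 64 * ∑ x ∈ Λ, ∑ y ∈ Λ, tau p Λ x y ≤ (θ : ℝ) ^ 2) :
    Ex p Λ.sym2 (fun ω => ∑ x ∈ Λ, ((cl Λ ω x).card : ℝ) ^ 2) ≤
      (8 + 64 * θ) * ∑ x ∈ Λ, ∑ y ∈ Λ, tau p Λ x y := by
  set T := ∑ x ∈ Λ, ∑ y ∈ Λ, tau p Λ x y with hTd
  set E3 := Ex p Λ.sym2 (fun ω => ∑ x ∈ Λ, ((cl Λ ω x).card : ℝ) ^ 2) with hE3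
  have hTE : Ex p Λ.sym2 (fun ω => ∑ x ∈ Λ, ((cl Λ ω x).card : ℝ)) = T := by
    rw [Ex_sum]; simp only [Ex_card]; rfl
  have hθ' : (1 : ℝ) ≤ θ := by exact_mod_cast hθ
  have s1 : E3 ≤ 4 * T + 32 * ∑ x ∈ Λ, ∑ n ∈ Finset.Icc 1 Λ.card, (n : ℝ) *
      Pr p Λ.sym2 (fun ω => 4 * n ≤ (cl Λ ω x).card) := by
    rw [← hTE]
    simp only [Pr, ← Ex_mul, ← Ex_sum, ← Ex_add]
    refine Ex_mono h0 h1 fun ω hω => ?_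
    rw [Finset.mul_sum, Finset.mul_sum, ← Finset.sum_add_distrib]
    exact Finset.sum_le_sum fun x _ => sq_le_aux _ _ (Finset.card_le_card (Finset.filter_subset _ _))
  have s2 : ∑ x ∈ Λ, ∑ n ∈ Finset.Icc 1 Λ.card, (n : ℝ) *
      Pr p Λ.sym2 (fun ω => 4 * n ≤ (cl Λ ω x).card) ≤
      ∑ x ∈ Λ, ∑ n ∈ Finset.Icc 1 Λ.card, ((if n < θ then (n : ℝ) else 0) + n / 64) *
      Pr p Λ.sym2 (fun ω => n ≤ (cl Λ ω x).card) := by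
    refine Finset.sum_le_sum fun x hx => Finset.sum_le_sum fun n hn => ?_
    have hn1 := (Finset.mem_Icc.1 hn).1
    have a1 := Pr_four h0 h1 Λ hn1 hx
    have a2 := Pr_big h0 h1 Λ (n := n)
    have a3 := Pr_le_one h0 h1 (E := Λ.sym2) (A := fun ω => ∃ y ∈ Λ, n ≤ (cl Λ ω y).card)
    have a4 := Pr_nonneg h0 h1 (E := Λ.sym2) (A := fun ω => n ≤ (cl Λ ω x).card)
    set Q := Pr p Λ.sym2 (fun ω => ∃ y ∈ Λ, n ≤ (cl Λ ω y).card)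
    set q := Pr p Λ.sym2 (fun ω => n ≤ (cl Λ ω x).card)
    have hn1' : (1 : ℝ) ≤ n := by exact_mod_cast hn1
    have a5 : (n : ℝ) * Q ≤ (if n < θ then (n : ℝ) else 0) + n / 64 := by
      split_ifs with h
      · nlinarith
      · have h : (θ : ℝ) ≤ n := by exact_mod_cast not_lt.1 h
        have : Q ≤ 1 / 64 := by
          by_contra hc
          push Not at hc
          have : (θ : ℝ) ^ 2 ≤ (n : ℝ) ^ 2 := by gcongr
          nlinarith [mul_lt_mul_of_pos_left hc (show (0 : ℝ) < (n : ℝ) ^ 2 by positivity)]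
        nlinarith
    calc _ ≤ (n : ℝ) * (q * Q) := mul_le_mul_of_nonneg_left a1 (by linarith)
      _ = ((n : ℝ) * Q) * q := by ring
      _ ≤ _ := mul_le_mul_of_nonneg_right a5 a4
  have s3 : ∑ x ∈ Λ, ∑ n ∈ Finset.Icc 1 Λ.card, ((if n < θ then (n : ℝ) else 0) + n / 64) *
      Pr p Λ.sym2 (fun ω => n ≤ (cl Λ ω x).card) ≤ θ * T + E3 / 64 := by
    rw [← hTE, hE3, div_eq_mul_inv, mul_comm _ (64 : ℝ)⁻¹]
    simp only [Pr, ← Ex_mul, ← Ex_sum, ← Ex_add]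
    refine Ex_mono h0 h1 fun ω hω => ?_
    rw [Finset.mul_sum, Finset.mul_sum, ← Finset.sum_add_distrib]
    refine Finset.sum_le_sum fun x _ => ?_
    refine (sum_ind_le _ _ _ (θ + ((cl Λ ω x).card : ℝ) / 64) (fun n hn => ?_)
      (by positivity)).trans (by ring_nf; exact le_rfl)
    have : (n : ℝ) ≤ (cl Λ ω x).card := by exact_mod_cast hn
    split_ifs with h
    · have : (n : ℝ) ≤ θ := by exact_mod_cast h.le
      linarith
    · linarith
  linarith
end T4
end M3

section M4
open Classical
set_option linter.unusedSectionVars false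
variable {U : Type*} [DecidableEq U]

lemma Pr_hit {ι : Type*} [DecidableEq ι] (p : ι → ℝ) {D X : Finset ι} (h : D ⊆ X) :
    Pr p X (fun ω => ∃ e ∈ D, e ∈ ω) = 1 - ∏ e ∈ D, (1 - p e) := by
  have e1 : Pr p X (fun ω => ∃ e ∈ D, e ∈ ω) = Pr p D (fun ω => ∃ e ∈ D, e ∈ ω) := by
    rw [← Pr_restrict p h]
    congr 1; ext ω; simp only [Finset.mem_inter]
    exact ⟨fun ⟨e, h, h'⟩ => ⟨e, h, h', h⟩, fun ⟨e, h, h', _⟩ => ⟨e, h, h'⟩⟩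
  have e2 : Pr p D (fun ω => ∃ e ∈ D, e ∈ ω) = Ex p D (fun ω => 1 - ind (ω = ∅)) := by
    refine Ex_congr p fun ω hω => ?_
    by_cases hw : ω = ∅
    · rw [ind_pos hw, ind_neg (by simp [hw]), sub_self]
    · obtain ⟨e, he⟩ := Finset.nonempty_iff_ne_empty.2 hw
      rw [ind_neg hw, ind_pos ⟨e, hω he, he⟩, sub_zero]
  rw [e1, e2, Ex_sub, Ex_const]
  congr 1
  unfold Ex
  rw [Finset.sum_eq_single ∅]
  · simp [wt, ind]
  · intro b _ hb; dsimp only; rw [ind_neg hb, mul_zero]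
  · simp

lemma inj_cross {S S' : Finset U} (hd : Disjoint S S') :
    Set.InjOn (fun q : U × U => s(q.1, q.2)) (S ×ˢ S' : Finset (U × U)) := by
  rintro ⟨a, b⟩ h ⟨a', b'⟩ h' hh
  simp only [Finset.coe_product, Set.mem_prod, Finset.mem_coe] at h h'
  rcases Sym2.eq_iff.1 hh with ⟨h1, h2⟩ | ⟨h1, h2⟩
  · simp_all
  · simp only at h1
    exact absurd (h1 ▸ h.1) (Finset.disjoint_right.1 hd h'.2)

section Cr
variable {p : Sym2 U → ℝ} (h0 : ∀ e, 0 ≤ p e) (h1 : ∀ e, p e ≤ 1)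
include h0 h1

lemma cross_xy {S S' Λ : Finset U} (hS : S ⊆ Λ) (hS' : S' ⊆ Λ) (hd : Disjoint S S') {t : ℝ}
    (ht : ∀ a ∈ S, ∀ b ∈ S', 1 - Real.exp (-t) ≤ p s(a, b)) {x y : U} :
    Ex p S.sym2 (fun ω => Ex p S'.sym2 (fun ω' =>
      1 - Real.exp (-(t * ((cl S ω x).card * (cl S' ω' y).card))))) ≤ tau p Λ x y := by
  set X := (S ×ˢ S').image (fun q : U × U => s(q.1, q.2)) with hX
  have hXm : ∀ u v, s(u, v) ∈ X → (u ∈ S ∧ v ∈ S') ∨ (v ∈ S ∧ u ∈ S') := by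
    intro u v h
    obtain ⟨⟨a, b⟩, hq, he⟩ := Finset.mem_image.1 h
    have hq := Finset.mem_product.1 hq
    rcases Sym2.eq_iff.1 he with ⟨rfl, rfl⟩ | ⟨rfl, rfl⟩
    · exact Or.inl hq
    · exact Or.inr hq
  have hd' := Finset.disjoint_left.1 hd
  have d2 : Disjoint S'.sym2 X := Finset.disjoint_left.2 fun e => by
    induction e using Sym2.ind with
    | _ u v =>
    intro he he'
    have he := Finset.mk_mem_sym2_iff.1 he
    rcases hXm u v he' with h | h
    · exact hd' h.1 he.1
    · exact hd' h.1 he.2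
  have d1 : Disjoint S.sym2 (S'.sym2 ∪ X) := Finset.disjoint_left.2 fun e => by
    induction e using Sym2.ind with
    | _ u v =>
    intro he he'
    have he := Finset.mk_mem_sym2_iff.1 he
    rcases Finset.mem_union.1 he' with he' | he'
    · exact hd' he.1 (Finset.mk_mem_sym2_iff.1 he').1
    rcases hXm u v he' with h | h
    · exact hd' he.2 h.2
    · exact hd' he.1 h.2
  have hsub : S.sym2 ∪ (S'.sym2 ∪ X) ⊆ Λ.sym2 := by
    refine Finset.union_subset (Finset.sym2_mono hS) (Finset.union_subset (Finset.sym2_mono hS') ?_)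
    intro e
    induction e using Sym2.ind with
    | _ u v =>
    intro he
    rcases hXm u v he with h | h
    · exact Finset.mk_mem_sym2_iff.2 ⟨hS h.1, hS' h.2⟩
    · exact Finset.mk_mem_sym2_iff.2 ⟨hS' h.2, hS h.1⟩
  have e1 : Pr p (S.sym2 ∪ (S'.sym2 ∪ X)) (fun ω => R ω x y) ≤ tau p Λ x y := by
    rw [← Pr_restrict p hsub]
    exact Pr_mono h0 h1 fun ω _ h => R_mono Finset.inter_subset_left h
  refine le_trans ?_ e1
  unfold Pr
  rw [Ex_union p d1]
  refine Ex_mono h0 h1 fun ω₁ hω₁ => ?_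
  rw [Ex_union p d2]
  refine Ex_mono h0 h1 fun ω₂ hω₂ => ?_
  set D := (cl S ω₁ x ×ˢ cl S' ω₂ y).image (fun q : U × U => s(q.1, q.2)) with hD
  have hDX : D ⊆ X := Finset.image_subset_image (Finset.product_subset_product
    (Finset.filter_subset _ _) (Finset.filter_subset _ _))
  have hcard : D.card = (cl S ω₁ x).card * (cl S' ω₂ y).card := by
    rw [hD, Finset.card_image_of_injOn, Finset.card_product]
    exact inj_cross (hd.mono (Finset.filter_subset _ _) (Finset.filter_subset _ _))
  calc _ ≤ Pr p X (fun ω => ∃ e ∈ D, e ∈ ω) := by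
        rw [Pr_hit p hDX]
        refine sub_le_sub_left ?_ 1
        have : ∏ e ∈ D, (1 - p e) ≤ ∏ e ∈ D, Real.exp (-t) := by
          refine Finset.prod_le_prod (fun e _ => sub_nonneg.2 (h1 e)) fun e he => ?_
          obtain ⟨⟨a, b⟩, hq, rfl⟩ := Finset.mem_image.1 he
          have hq := Finset.mem_product.1 hq
          linarith [ht a (mem_cl.1 hq.1).1 b (mem_cl.1 hq.2).1]
        refine this.trans (le_of_eq ?_)
        rw [Finset.prod_const, ← Real.exp_nat_mul, hcard]
        push_cast
        ring_nf
    _ ≤ _ := by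
        refine Ex_mono h0 h1 fun ω₃ _ => ind_mono fun ⟨e, he, he3⟩ => ?_
        obtain ⟨⟨a, b⟩, hq, rfl⟩ := Finset.mem_image.1 he
        have hq := Finset.mem_product.1 hq
        refine R_trans (R_mono Finset.subset_union_left (mem_cl.1 hq.1).2) (R_trans (R_edge
          (Finset.mem_union_right _ (Finset.mem_union_right _ he3))) ?_)
        exact R_symm (R_mono (Finset.subset_union_left.trans Finset.subset_union_right)
          (mem_cl.1 hq.2).2)

omit h0 h1 in
lemma exp_min {a b : ℝ} (ha : 0 ≤ a) (hb : 0 ≤ b) :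
    1 / 2 * (min 1 a * min 1 b) ≤ 1 - Real.exp (-(a * b)) := by
  have hab := mul_nonneg ha hb
  have i1 : min 1 a * min 1 b ≤ 1 := mul_le_one₀ (min_le_left _ _) (le_min zero_le_one hb) (min_le_left _ _)
  have i2 : min 1 a * min 1 b ≤ a * b := mul_le_mul (min_le_right _ _) (min_le_right _ _)
    (le_min zero_le_one hb) ha
  have i3 : Real.exp (-(a * b)) * (1 + a * b) ≤ 1 := by
    have := Real.add_one_le_exp (a * b)
    rw [Real.exp_neg, inv_mul_le_iff₀ (Real.exp_pos _)]; linarith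
  have i4 := Real.exp_pos (-(a * b))
  by_cases h : a * b ≤ 1
  · nlinarith
  · push Not at h; nlinarith

lemma cross_lower {S : Finset U} {s u : ℝ} (hs : 0 ≤ s) (hsu : s ≤ u) (M : ℝ)
    (hM : Ex p S.sym2 (fun ω => ∑ x ∈ S, ((cl S ω x).card : ℝ) ^ 2) ≤ M) :
    s * (∑ x ∈ S, ∑ y ∈ S, tau p S x y) - s ^ 2 / 4 * M ≤
      ∑ x ∈ S, Ex p S.sym2 (fun ω => min 1 (u * (cl S ω x).card)) := by
  have : s * (∑ x ∈ S, ∑ y ∈ S, tau p S x y) - s ^ 2 / 4 *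
      Ex p S.sym2 (fun ω => ∑ x ∈ S, ((cl S ω x).card : ℝ) ^ 2) ≤
      ∑ x ∈ S, Ex p S.sym2 (fun ω => min 1 (u * (cl S ω x).card)) := by
    simp only [← Ex_card, ← Ex_sum, ← Ex_mul, ← Ex_sub]
    refine Ex_mono h0 h1 fun ω _ => ?_
    rw [Finset.mul_sum, Finset.mul_sum, ← Finset.sum_sub_distrib]
    refine Finset.sum_le_sum fun x _ => ?_
    have hw : (0 : ℝ) ≤ (cl S ω x).card := Nat.cast_nonneg _
    refine le_min ?_ ?_
    · nlinarith [sq_nonneg (1 - s * (cl S ω x).card / 2)]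
    · nlinarith [mul_le_mul_of_nonneg_right hsu hw, sq_nonneg (s * (cl S ω x).card)]
  have := mul_le_mul_of_nonneg_left hM (show 0 ≤ s ^ 2 / 4 by positivity)
  linarith

lemma half_lower {S : Finset U} {u T : ℝ} (hT : ∑ x ∈ S, ∑ y ∈ S, tau p S x y = T) (hT1 : 1 ≤ T)
    (hu : 0 ≤ u) (huT : 1 ≤ u * (584 * √T)) :
    √T / 1168 ≤ ∑ x ∈ S, Ex p S.sym2 (fun ω => min 1 (u * (cl S ω x).card)) := by
  have hq : 1 ≤ √T := Real.one_le_sqrt.2 hT1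
  have hq2 : √T * √T = T := Real.mul_self_sqrt (by linarith)
  have hc := Nat.ceil_lt_add_one (show (0 : ℝ) ≤ 8 * √T by positivity)
  have hc' := Nat.le_ceil (8 * √T)
  set θ := ⌈8 * √T⌉₊
  have hE := E3_bound h0 h1 S θ (by
    have : (0 : ℝ) < θ := by linarith
    exact_mod_cast this) (by rw [hT]; nlinarith)
  rw [hT] at hE
  have hE' : Ex p S.sym2 (fun ω => ∑ x ∈ S, ((cl S ω x).card : ℝ) ^ 2) ≤ 584 * √T * T :=
    hE.trans (mul_le_mul_of_nonneg_right (by linarith) (by linarith))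
  have hpos : 0 < 584 * √T := by positivity
  have := cross_lower h0 h1 (S := S) (s := 1 / (584 * √T)) (u := u) (by positivity)
    (by rwa [div_le_iff₀ hpos]) _ hE'
  rw [hT] at this
  refine le_trans ?_ this
  have e : 1 / (584 * √T) * T - (1 / (584 * √T)) ^ 2 / 4 * (584 * √T * T) = 3 / 4 * (√T / 584) := by
    rw [← hq2, Real.sqrt_mul_self (by positivity)]; field_simp; norm_num
  rw [e]; linarith

lemma cross {S S' Λ : Finset U} (hS : S ⊆ Λ) (hS' : S' ⊆ Λ) (hd : Disjoint S S') {u T : ℝ}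
    (hT : ∑ x ∈ S, ∑ y ∈ S, tau p S x y = T) (hT' : ∑ x ∈ S', ∑ y ∈ S', tau p S' x y = T)
    (hT1 : 1 ≤ T) (hu : 0 ≤ u) (huT : 1 ≤ u * (584 * √T))
    (ht : ∀ a ∈ S, ∀ b ∈ S', 1 - Real.exp (-u ^ 2) ≤ p s(a, b)) :
    T / (2 * 1168 ^ 2) ≤ ∑ x ∈ S, ∑ y ∈ S', tau p Λ x y := by
  have a1 := half_lower h0 h1 hT hT1 hu huT
  have a2 := half_lower h0 h1 hT' hT1 hu huT
  have a3 := mul_le_mul a1 a2 (by positivity) (le_trans (by positivity) a1)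
  rw [div_mul_div_comm, Real.mul_self_sqrt (by linarith), Finset.sum_mul_sum] at a3
  have a4 : 1 / 2 * ∑ x ∈ S, ∑ y ∈ S', Ex p S.sym2 (fun ω => min 1 (u * (cl S ω x).card)) *
      Ex p S'.sym2 (fun ω => min 1 (u * (cl S' ω y).card)) ≤ ∑ x ∈ S, ∑ y ∈ S', tau p Λ x y := by
    simp only [Finset.mul_sum]
    refine Finset.sum_le_sum fun x _ => Finset.sum_le_sum fun y _ => ?_
    refine le_trans ?_ (cross_xy h0 h1 hS hS' hd (by simpa using ht) (x := x) (y := y))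
    rw [← Ex_mul_right, ← Ex_mul]
    refine Ex_mono h0 h1 fun ω _ => ?_
    rw [← Ex_mul, ← Ex_mul]
    refine Ex_mono h0 h1 fun ω' _ => ?_
    have := exp_min (mul_nonneg hu (Nat.cast_nonneg (cl S ω x).card))
      (mul_nonneg hu (Nat.cast_nonneg (cl S' ω' y).card))
    refine this.trans (le_of_eq ?_)
    congr 2; ring
  refine le_trans ?_ a4
  have : T / (2 * 1168 ^ 2) = 1 / 2 * (T / (1168 * 1168)) := by ring
  rw [this]; linarith

/-- list of disjoint connections -/
def DJ : List (U × U) → Finset (Sym2 U) → Prop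
  | [], _ => True
  | q :: l, ω => ∃ a b, a ⊆ ω ∧ b ⊆ ω ∧ Disjoint a b ∧ R a q.1 q.2 ∧ DJ l b

omit h0 h1 in
lemma DJ_mono (l : List (U × U)) {ω ω' : Finset (Sym2 U)} (h : ω ⊆ ω') (hD : DJ l ω) : DJ l ω' := by
  cases l with
  | nil => trivial
  | cons q l =>
    obtain ⟨a, b, ha, hb, hh⟩ := hD
    exact ⟨a, b, ha.trans h, hb.trans h, hh⟩

lemma Pr_DJ (Λ : Finset U) (l : List (U × U)) :
    Pr p Λ.sym2 (DJ l) ≤ (l.map fun q => tau p Λ q.1 q.2).prod := by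
  induction l with
  | nil => simpa using Pr_le_one h0 h1
  | cons q l ih =>
    rw [List.map_cons, List.prod_cons]
    exact (BK h0 h1 Λ.sym2 (fun F => R F q.1 q.2) (DJ l) (fun _ _ h => R_mono h)
      (fun _ _ h => DJ_mono l h)).trans (mul_le_mul_of_nonneg_left ih (tau_nonneg h0 h1 _ _ _))

/-- simple paths -/
inductive SP : U → U → Finset U → Finset (Sym2 U) → Prop
  | nil (x : U) : SP x x {x} ∅
  | cons {x y z : U} {T : Finset U} {F : Finset (Sym2 U)} (h : SP y z T F) (hx : x ∉ T) :
      SP x z (insert x T) (insert s(x, y) F)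

omit h0 h1 in
lemma SP.basic {x y : U} {T : Finset U} {F : Finset (Sym2 U)} (h : SP x y T F) :
    x ∈ T ∧ F ⊆ T.sym2 ∧ R F x y := by
  induction h with
  | nil x => exact ⟨by simp, by simp, R_refl _ _⟩
  | cons h hx ih =>
    refine ⟨by simp, ?_, R_trans (R_edge (by simp)) (R_mono (Finset.subset_insert _ _) ih.2.2)⟩
    refine Finset.insert_subset (Finset.mk_mem_sym2_iff.2 ⟨by simp, by simp [ih.1]⟩) ?_
    exact ih.2.1.trans (Finset.sym2_mono (Finset.subset_insert _ _))

omit h0 h1 in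
lemma SP.split {x y : U} {T : Finset U} {F : Finset (Sym2 U)} (h : SP x y T F) {u : U} (hu : u ∈ T) :
    ∃ T₁ T₂ F₁ F₂, SP x u T₁ F₁ ∧ SP u y T₂ F₂ ∧ Disjoint F₁ F₂ ∧ F₁ ⊆ F ∧ F₂ ⊆ F ∧
      T = T₁ ∪ T₂ := by
  induction h with
  | nil x =>
    rw [Finset.mem_singleton] at hu
    subst hu
    exact ⟨_, _, _, _, SP.nil _, SP.nil _, by simp, by simp, by simp, by simp⟩
  | cons h hx ih =>
    rename_i x y z T F
    by_cases hux : u = x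
    · subst hux
      exact ⟨_, _, _, _, SP.nil _, SP.cons h hx, by simp, by simp, subset_rfl, by simp⟩
    obtain ⟨T₁, T₂, F₁, F₂, a1, a2, a3, a4, a5, a6⟩ := ih ((Finset.mem_insert.1 hu).resolve_left hux)
    have hx1 : x ∉ T₁ := fun h => hx (a6 ▸ Finset.mem_union_left _ h)
    have hx2 : x ∉ T₂ := fun h => hx (a6 ▸ Finset.mem_union_right _ h)
    refine ⟨_, _, _, _, SP.cons a1 hx1, a2, ?_, Finset.insert_subset_insert _ a4,
      a5.trans (Finset.subset_insert _ _), by rw [a6, Finset.insert_union]⟩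
    rw [Finset.disjoint_insert_left]
    exact ⟨fun h => hx2 (Finset.mk_mem_sym2_iff.1 (a2.basic.2.1 h)).1, a3⟩

omit h0 h1 in
lemma SP.exists {ω : Finset (Sym2 U)} {x y : U} (h : R ω x y) : ∃ T F, SP x y T F ∧ F ⊆ ω := by
  induction h using Relation.ReflTransGen.head_induction_on with
  | refl => exact ⟨_, _, SP.nil _, by simp⟩
  | head hac _ ih =>
    rename_i a c _
    obtain ⟨T, F, h, hF⟩ := ih
    by_cases ha : a ∈ T
    · obtain ⟨T₁, T₂, F₁, F₂, a1, a2, a3, a4, a5, a6⟩ := h.split ha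
      exact ⟨_, _, a2, a5.trans hF⟩
    · exact ⟨_, _, h.cons ha, Finset.insert_subset hac.2 hF⟩

omit h0 h1 in
lemma attach {ω : Finset (Sym2 U)} {T : Finset U} {x b : U} (hx : x ∈ T) (h : R ω x b) :
    ∃ u ∈ T, R (ω \ T.sym2) u b := by
  by_cases hb : b ∈ T
  · exact ⟨b, hb, R_refl _ _⟩
  obtain ⟨a, ha, c, hc, hac, hR⟩ := last_exit hx hb h
  refine ⟨a, ha, R_trans (R_edge (Finset.mem_sdiff.2 ⟨hac, fun h =>
    hc (Finset.mk_mem_sym2_iff.1 h).2⟩)) (R_mono (fun e he => ?_) hR)⟩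
  obtain ⟨he1, he2⟩ := Finset.mem_filter.1 he
  refine Finset.mem_sdiff.2 ⟨he1, fun h => ?_⟩
  induction e using Sym2.ind with
  | _ u v => exact he2 u (by simp) (Finset.mk_mem_sym2_iff.1 h).1

omit h0 h1 in
lemma DJ_cons {q : U × U} {l : List (U × U)} {a ω : Finset (Sym2 U)} (ha : a ⊆ ω)
    (hR : R a q.1 q.2) (h : DJ l (ω \ a)) : DJ (q :: l) ω :=
  ⟨a, ω \ a, ha, Finset.sdiff_subset, Finset.disjoint_sdiff, hR, h⟩

omit h0 h1 in
lemma DJ_five {F₁ F₂ F₃ F₄ F₅ ω : Finset (Sym2 U)} {q₁ q₂ q₃ q₄ q₅ : U × U}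
    (s1 : F₁ ⊆ ω) (s2 : F₂ ⊆ ω) (s3 : F₃ ⊆ ω) (s4 : F₄ ⊆ ω) (s5 : F₅ ⊆ ω)
    (r1 : R F₁ q₁.1 q₁.2) (r2 : R F₂ q₂.1 q₂.2) (r3 : R F₃ q₃.1 q₃.2) (r4 : R F₄ q₄.1 q₄.2)
    (r5 : R F₅ q₅.1 q₅.2) (d12 : Disjoint F₁ F₂) (d13 : Disjoint F₁ F₃) (d14 : Disjoint F₁ F₄)
    (d15 : Disjoint F₁ F₅) (d23 : Disjoint F₂ F₃) (d24 : Disjoint F₂ F₄) (d25 : Disjoint F₂ F₅)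
    (d34 : Disjoint F₃ F₄) (d35 : Disjoint F₃ F₅) (d45 : Disjoint F₄ F₅) :
    DJ [q₁, q₂, q₃, q₄, q₅] ω := by
  have key : ∀ {A B C : Finset (Sym2 U)}, A ⊆ B → Disjoint C A → A ⊆ B \ C := fun h h' =>
    Finset.subset_sdiff.2 ⟨h, h'.symm⟩
  refine DJ_cons s1 r1 (DJ_cons (key s2 d12) r2 (DJ_cons (key (key s3 d13) d23) r3
    (DJ_cons (key (key (key s4 d14) d24) d34) r4
    (DJ_cons (key (key (key (key s5 d15) d25) d35) d45) r5 trivial))))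

omit h0 h1 in
lemma tree_event {Λ : Finset U} {ω : Finset (Sym2 U)} (hω : ω ⊆ Λ.sym2) {o z b b' : U} (ho : o ∈ Λ)
    (hz : R ω o z) (hb : R ω o b) (hb' : R ω o b') : ∃ q ∈ Λ ×ˢ Λ,
    (DJ [(o, q.2), (q.2, q.1), (q.1, z), (q.1, b), (q.2, b')] ω ∨
     DJ [(o, q.1), (q.1, q.2), (q.2, z), (q.1, b), (q.2, b')] ω) ∨
     DJ [(o, q.1), (q.1, z), (q.1, q.2), (q.2, b), (q.2, b')] ω := by
  obtain ⟨T, F, hT, hF⟩ := SP.exists hz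
  obtain ⟨u, hu, hRu⟩ := attach hT.basic.1 hb
  obtain ⟨T', F', hT', hF'⟩ := SP.exists hRu
  obtain ⟨v, hv, hRv⟩ := attach (T := T ∪ T') (Finset.mem_union_left _ hT.basic.1) hb'
  obtain ⟨T₁, T₂, F₁, F₂, a1, a2, a3, a4, a5, a6⟩ := hT.split hu
  have hFT := hT.basic.2.1
  have hou : R ω o u := R_mono (a4.trans hF) a1.basic.2.2
  have huΛ : u ∈ Λ := mem_of_R hω ho hou
  have dF' : ∀ {A}, A ⊆ F → Disjoint A F' := fun h => Finset.disjoint_of_subset_left (h.trans hFT)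
    (Finset.disjoint_of_subset_right hF' Finset.disjoint_sdiff)
  have hF'ω : F' ⊆ ω := hF'.trans Finset.sdiff_subset
  have dF'' : ∀ {A}, A ⊆ F ∪ F' → Disjoint A (ω \ (T ∪ T').sym2) := fun h =>
    Finset.disjoint_of_subset_left (h.trans (Finset.union_subset
      (hFT.trans (Finset.sym2_mono Finset.subset_union_left))
      (hT'.basic.2.1.trans (Finset.sym2_mono Finset.subset_union_right)))) Finset.disjoint_sdiff
  have mF : ∀ {A}, A ⊆ F → A ⊆ F ∪ F' := fun h => h.trans Finset.subset_union_left
  have mF' : ∀ {A}, A ⊆ F' → A ⊆ F ∪ F' := fun h => h.trans Finset.subset_union_right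
  have hvΛ : R ω o v → (u, v) ∈ Λ ×ˢ Λ := fun h => Finset.mem_product.2 ⟨huΛ, mem_of_R hω ho h⟩
  rcases Finset.mem_union.1 hv with hv | hv
  · rw [a6] at hv
    rcases Finset.mem_union.1 hv with hv | hv
    · obtain ⟨T₃, T₄, F₃, F₄, b1, b2, b3, b4, b5, b6⟩ := a1.split hv
      refine ⟨(u, v), hvΛ (R_mono ((b4.trans a4).trans hF) b1.basic.2.2), Or.inl (Or.inl ?_)⟩
      exact DJ_five ((b4.trans a4).trans hF) ((b5.trans a4).trans hF) (a5.trans hF) hF'ω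
        Finset.sdiff_subset b1.basic.2.2 b2.basic.2.2 a2.basic.2.2 hT'.basic.2.2 hRv
        b3 (a3.mono_left b4) (dF' (b4.trans a4)) (dF'' (mF (b4.trans a4)))
        (a3.mono_left b5) (dF' (b5.trans a4)) (dF'' (mF (b5.trans a4))) (dF' a5) (dF'' (mF a5))
        (dF'' (mF' subset_rfl))
    · obtain ⟨T₃, T₄, F₃, F₄, b1, b2, b3, b4, b5, b6⟩ := a2.split hv
      refine ⟨(u, v), hvΛ (R_trans hou (R_mono ((b4.trans a5).trans hF) b1.basic.2.2)),
        Or.inl (Or.inr ?_)⟩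
      exact DJ_five (a4.trans hF) ((b4.trans a5).trans hF) ((b5.trans a5).trans hF) hF'ω
        Finset.sdiff_subset a1.basic.2.2 b1.basic.2.2 b2.basic.2.2 hT'.basic.2.2 hRv
        (a3.mono_right b4) (a3.mono_right b5) (dF' a4) (dF'' (mF a4))
        b3 (dF' (b4.trans a5)) (dF'' (mF (b4.trans a5))) (dF' (b5.trans a5))
        (dF'' (mF (b5.trans a5))) (dF'' (mF' subset_rfl))
  · obtain ⟨T₃, T₄, F₃, F₄, b1, b2, b3, b4, b5, b6⟩ := hT'.split hv
    refine ⟨(u, v), hvΛ (R_trans hou (R_mono (b4.trans hF'ω) b1.basic.2.2)), Or.inr ?_⟩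
    exact DJ_five (a4.trans hF) (a5.trans hF) (b4.trans hF'ω) (b5.trans hF'ω)
      Finset.sdiff_subset a1.basic.2.2 a2.basic.2.2 b1.basic.2.2 b2.basic.2.2 hRv
      a3 ((dF' a4).mono_right b4) ((dF' a4).mono_right b5) (dF'' (mF a4))
      ((dF' a5).mono_right b4) ((dF' a5).mono_right b5) (dF'' (mF a5)) b3
      (dF'' (mF' b4)) (dF'' (mF' b5))

/-- four point tree graph bound -/
lemma tree_graph {Λ : Finset U} {o : U} (ho : o ∈ Λ) (z b b' : U) :
    Pr p Λ.sym2 (fun ω => R ω o z ∧ R ω o b ∧ R ω o b') ≤ ∑ u ∈ Λ, ∑ v ∈ Λ,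
      ((tau p Λ o v * tau p Λ v u * tau p Λ u z * tau p Λ u b * tau p Λ v b' +
        tau p Λ o u * tau p Λ u v * tau p Λ v z * tau p Λ u b * tau p Λ v b') +
        tau p Λ o u * tau p Λ u z * tau p Λ u v * tau p Λ v b * tau p Λ v b') := by
  refine (Pr_mono h0 h1 fun ω hω h => tree_event hω ho h.1 h.2.1 h.2.2).trans
    ((Pr_exists_le h0 h1 _ _).trans ?_)
  rw [Finset.sum_product]
  refine Finset.sum_le_sum fun u _ => Finset.sum_le_sum fun v _ => ?_
  refine (Pr_or_le h0 h1 _ _).trans (add_le_add ((Pr_or_le h0 h1 _ _).trans (add_le_add ?_ ?_)) ?_)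
  all_goals
    refine (Pr_DJ h0 h1 Λ _).trans (le_of_eq ?_)
    simp [mul_assoc]
end Cr
end M4

section M5
open Classical
set_option linter.unusedSectionVars false

/-- translate of a finite set -/
noncomputable def sh {d : ℕ} (S : Finset (V d)) (v : V d) : Finset (V d) := S.image (fun x => x + v)

lemma mem_sh {d : ℕ} {S : Finset (V d)} {v x : V d} : x ∈ sh S v ↔ x - v ∈ S := by
  unfold sh; rw [Finset.mem_image]
  constructor
  · rintro ⟨a, ha, rfl⟩; simpa using ha
  · intro h; exact ⟨x - v, h, by simp⟩

lemma sum_sh {d : ℕ} {M : Type*} [AddCommMonoid M] (S : Finset (V d)) (v : V d) (f : V d → M) :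
    ∑ x ∈ sh S v, f x = ∑ x ∈ S, f (x + v) := by
  unfold sh; rw [Finset.sum_image]; intro a _ b _ h; simpa using h

/-- translation invariance on edges -/
def TI {d : ℕ} (p : Sym2 (V d) → ℝ) : Prop := ∀ v x y, p s(x + v, y + v) = p s(x, y)

lemma R_image {d : ℕ} (v : V d) (ω : Finset (Sym2 (V d))) (x y : V d) :
    R (ω.image (Sym2.map (fun z => z + v))) (x + v) (y + v) ↔ R ω x y := by
  have key : ∀ (w : V d) (η : Finset (Sym2 (V d))) (a b : V d), R η a b →
      R (η.image (Sym2.map (fun z => z + w))) (a + w) (b + w) := by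
    intro w η a b h
    induction h with
    | refl => exact R_refl _ _
    | tail _ h ih =>
      refine R_trans ih (R_edge ?_)
      rw [Finset.mem_image]
      refine ⟨_, ?_, Sym2.map_mk _ _ _⟩
      first | exact h | exact h.2 | exact h.1
  constructor
  · intro h
    have := key (-v) _ _ _ h
    rw [Finset.image_image] at this
    have e : (Sym2.map (fun z : V d => z + -v)) ∘ (Sym2.map (fun z => z + v)) = id := by
      rw [← Sym2.map_comp]
      have : ((fun z : V d => z + -v) ∘ fun z => z + v) = id := by ext; simp
      rw [this, Sym2.map_id]
    rw [e, Finset.image_id] at this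
    simpa using this
  · exact key v ω x y

lemma sym2_sh {d : ℕ} (S : Finset (V d)) (v : V d) :
    (sh S v).sym2 = S.sym2.image (Sym2.map (fun z => z + v)) := by
  ext e
  induction e using Sym2.ind with
  | _ a b =>
    rw [Finset.mem_image, Finset.mk_mem_sym2_iff, mem_sh, mem_sh]
    constructor
    · intro h
      exact ⟨s(a - v, b - v), Finset.mk_mem_sym2_iff.2 h, by simp⟩
    · rintro ⟨f, hf, hh⟩
      induction f using Sym2.ind with
      | _ a' b' =>
        rw [Finset.mk_mem_sym2_iff] at hf
        rw [Sym2.map_mk, Sym2.eq_iff] at hh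
        rcases hh with ⟨rfl, rfl⟩ | ⟨rfl, rfl⟩
        · simpa using hf
        · simpa using hf.symm

lemma tau_sh {d : ℕ} {p : Sym2 (V d) → ℝ} (hp : TI p) (S : Finset (V d)) (v x y : V d) :
    tau p (sh S v) (x + v) (y + v) = tau p S x y := by
  unfold tau Pr
  rw [sym2_sh, Ex_image]
  · have : (fun e => p (Sym2.map (fun z => z + v) e)) = p := by
      ext e
      induction e using Sym2.ind with
      | _ a b => rw [Sym2.map_mk]; exact hp v a b
    rw [this]
    refine Ex_congr _ fun ω _ => ?_
    congr 1
    exact propext (R_image v ω x y)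
  · exact Sym2.map.injective (add_left_injective v)

/-- two-point sum in a set -/
noncomputable def E2 {d : ℕ} (p : Sym2 (V d) → ℝ) (S : Finset (V d)) : ℝ := ∑ x ∈ S, ∑ y ∈ S, tau p S x y

lemma E2_sh {d : ℕ} {p : Sym2 (V d) → ℝ} (hp : TI p) (S : Finset (V d)) (v : V d) :
    E2 p (sh S v) = E2 p S := by
  unfold E2; rw [sum_sh]
  refine Finset.sum_congr rfl fun x _ => ?_
  rw [sum_sh]
  exact Finset.sum_congr rfl fun y _ => tau_sh hp S v x y

/-- corner box -/
noncomputable def Q (d m : ℕ) : Finset (V d) := Fintype.piFinset fun _ => Finset.Ico (0 : ℤ) m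

lemma mem_Q {d m : ℕ} {x : V d} : x ∈ Q d m ↔ ∀ i, 0 ≤ x i ∧ x i < m := by
  simp [Q, Fintype.mem_piFinset]

lemma card_Q (d m : ℕ) : (Q d m).card = m ^ d := by
  simp [Q]

lemma normInf_le {d : ℕ} {x : V d} {n : ℕ} : normInf x ≤ n ↔ ∀ i, |x i| ≤ n := by
  unfold normInf
  rw [Finset.sup_le_iff]
  constructor
  · intro h i; have := h i (Finset.mem_univ i); rw [Int.abs_eq_natAbs]; exact_mod_cast this
  · intro h i _; have := h i; rw [Int.abs_eq_natAbs] at this; exact_mod_cast this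

lemma normInf_eq_zero {d : ℕ} {x : V d} : normInf x = 0 ↔ x = 0 := by
  rw [← Nat.le_zero, normInf_le]
  constructor
  · intro h; ext i; have := h i; simpa using this
  · rintro rfl; simp

lemma Q_blocks {d : ℕ} {p : Sym2 (V d) → ℝ} (h0 : ∀ e, 0 ≤ p e) (h1 : ∀ e, p e ≤ 1) (L m : ℕ) (hm : 1 ≤ m) (B : ℝ)
    (hB : ∀ k ∈ Q d L, ∀ k' ∈ Q d L, k ≠ k' → B ≤ ∑ x ∈ sh (Q d m) ((m:ℤ) • k), ∑ y ∈ sh (Q d m) ((m:ℤ) • k'),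
      tau p (Q d (L * m)) x y)
    (hdis : ∀ k k' : V d, k ≠ k' → Disjoint (sh (Q d m) ((m:ℤ) • k)) (sh (Q d m) ((m:ℤ) • k')))
    (hsub : ∀ k ∈ Q d L, sh (Q d m) ((m:ℤ) • k) ⊆ Q d (L * m)) :
    ((L:ℝ) ^ d * ((L:ℝ) ^ d - 1)) * B ≤ E2 p (Q d (L * m)) := by
  have key : ∀ f : V d → ℝ, (∀ x, 0 ≤ f x) → ∑ k ∈ Q d L, ∑ x ∈ sh (Q d m) ((m:ℤ) • k), f x ≤ ∑ x ∈ Q d (L * m), f x := by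
    intro f hf
    rw [← Finset.sum_biUnion]
    · refine Finset.sum_le_sum_of_subset_of_nonneg ?_ fun _ _ _ => hf _
      intro x hx; rw [Finset.mem_biUnion] at hx
      obtain ⟨k, hk, hx⟩ := hx; exact hsub k hk hx
    · intro k _ k' _ h; exact hdis k k' h
  have hn := tau_nonneg h0 h1
  calc ((L:ℝ) ^ d * ((L:ℝ) ^ d - 1)) * B = ∑ k ∈ Q d L, ∑ k' ∈ (Q d L).erase k, B := by
        rw [Finset.sum_congr rfl (fun k hk => by rw [Finset.sum_const, Finset.card_erase_of_mem hk])]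
        rw [Finset.sum_const, card_Q]
        simp only [nsmul_eq_mul]
        by_cases hL : L ^ d = 0
        · have : ((L:ℝ))^d = 0 := by exact_mod_cast hL
          simp [this]
        · rw [Nat.cast_sub (by omega)]; push_cast; ring
    _ ≤ ∑ k ∈ Q d L, ∑ k' ∈ Q d L, ∑ x ∈ sh (Q d m) ((m:ℤ) • k), ∑ y ∈ sh (Q d m) ((m:ℤ) • k'),
      tau p (Q d (L * m)) x y := by
        refine Finset.sum_le_sum fun k hk => ?_
        refine (Finset.sum_le_sum fun k' hk' => ?_).trans (Finset.sum_le_sum_of_subset_of_nonneg (Finset.erase_subset k _)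
          fun _ _ _ => Finset.sum_nonneg fun _ _ => Finset.sum_nonneg fun _ _ => hn _ _ _)
        rw [Finset.mem_erase] at hk'
        exact hB k hk k' hk'.2 (Ne.symm hk'.1)
    _ = ∑ k ∈ Q d L, ∑ x ∈ sh (Q d m) ((m:ℤ) • k), ∑ k' ∈ Q d L, ∑ y ∈ sh (Q d m) ((m:ℤ) • k'),
      tau p (Q d (L * m)) x y := by
        refine Finset.sum_congr rfl fun k _ => Finset.sum_comm
    _ ≤ ∑ k ∈ Q d L, ∑ x ∈ sh (Q d m) ((m:ℤ) • k), ∑ y ∈ Q d (L*m), tau p (Q d (L * m)) x y := by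
        refine Finset.sum_le_sum fun k _ => Finset.sum_le_sum fun x _ => key _ fun y => hn _ _ _
    _ ≤ _ := key _ fun x => Finset.sum_nonneg fun _ _ => hn _ _ _

lemma blocks_dis {d m : ℕ} (k k' : V d) (h : k ≠ k') :
    Disjoint (sh (Q d m) ((m:ℤ) • k)) (sh (Q d m) ((m:ℤ) • k')) := by
  rw [Finset.disjoint_left]
  intro x hx hx'
  rw [mem_sh, mem_Q] at hx hx'
  apply h
  ext i
  have h1 := hx i
  have h2 := hx' i
  simp only [Pi.sub_apply, Pi.smul_apply, smul_eq_mul] at h1 h2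
  by_contra hne
  rcases lt_or_gt_of_ne hne with h3 | h3 <;> nlinarith

lemma blocks_sub {d m L : ℕ} (k : V d) (hk : k ∈ Q d L) :
    sh (Q d m) ((m:ℤ) • k) ⊆ Q d (L * m) := by
  intro x hx
  rw [mem_sh, mem_Q] at hx
  rw [mem_Q] at hk ⊢
  intro i
  have h1 := hx i
  have h2 := hk i
  simp only [Pi.sub_apply, Pi.smul_apply, smul_eq_mul] at h1
  push_cast
  constructor <;> nlinarith

lemma E2_step {d : ℕ} (hd : 1 ≤ d) {α b : ℝ} (hα : 0 < α) (hb : 0 < b) {L : ℕ} (hL : 2 ≤ L)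
    (hL2 : 4 * 1168 ^ 2 ≤ (L:ℝ) ^ ((d:ℝ) - α))
    {p : Sym2 (V d) → ℝ} (h0 : ∀ e, 0 ≤ p e) (h1 : ∀ e, p e ≤ 1) (hp : TI p)
    (hlow : ∀ x y : V d, x ≠ y → 1 - Real.exp (-(b * (normInf (x - y) : ℝ) ^ (-(d : ℝ) - α))) ≤ p s(x, y))
    {m : ℕ} (hm : 1 ≤ m) (hT1 : 1 ≤ E2 p (Q d m))
    (hT : (L:ℝ) ^ ((d:ℝ) + α) / (584 ^ 2 * b) * (m:ℝ) ^ ((d:ℝ) + α) ≤ E2 p (Q d m)) :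
    (L:ℝ) ^ ((d:ℝ) + α) * E2 p (Q d m) ≤ E2 p (Q d (L * m)) := by
  set T := E2 p (Q d m) with hTdef
  have hLp : (0:ℝ) < L := by exact_mod_cast (by omega : 0 < L)
  have hmp : (0:ℝ) < m := by exact_mod_cast (by omega : 0 < m)
  set t := b * ((L:ℝ) * m) ^ (-(d : ℝ) - α) with ht
  have ht0 : 0 ≤ t := by positivity
  have hB := Q_blocks h0 h1 L m hm (T / (2 * 1168 ^ 2)) (fun k hk k' hk' hne => by
    refine cross h0 h1 (blocks_sub k hk) (blocks_sub k' hk') (blocks_dis k k' hne) (u := Real.sqrt t)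
      (E2_sh hp _ _) (E2_sh hp _ _) hT1 (Real.sqrt_nonneg _) ?_ ?_
    · have : 1 ≤ Real.sqrt (t * (584 ^ 2 * T)) := by
        rw [Real.one_le_sqrt]
        have e : ((L:ℝ) * m) ^ (-(d : ℝ) - α) = (((L:ℝ) ^ ((d:ℝ) + α) * (m:ℝ) ^ ((d:ℝ) + α)))⁻¹ := by
          rw [← Real.mul_rpow hLp.le hmp.le, ← Real.rpow_neg (by positivity)]; ring_nf
        rw [ht, e]
        have hq : 0 < (L:ℝ) ^ ((d:ℝ) + α) * (m:ℝ) ^ ((d:ℝ) + α) := by positivity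
        set q := (L:ℝ) ^ ((d:ℝ) + α) * (m:ℝ) ^ ((d:ℝ) + α)
        have hT' : q / (584 ^ 2 * b) ≤ T := by
          refine le_trans (le_of_eq ?_) hT; simp only [q]; ring
        rw [div_le_iff₀ (by positivity)] at hT'
        have : b * q⁻¹ * (584 ^ 2 * T) = (T * (584 ^ 2 * b)) / q := by field_simp
        rw [this, le_div_iff₀ hq]; linarith
      have e3 : Real.sqrt (584 ^ 2 * T) = 584 * Real.sqrt T := by
        rw [Real.sqrt_mul (by positivity), Real.sqrt_sq (by positivity)]
      rw [Real.sqrt_mul ht0, e3] at this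
      exact this
    · intro a ha a' ha'
      rw [Real.sq_sqrt ht0]
      have hne' : a ≠ a' := fun h => Finset.disjoint_left.1 (blocks_dis k k' hne) ha (h ▸ ha')
      refine le_trans ?_ (hlow a a' hne')
      have hN1 : 1 ≤ normInf (a - a') := by
        rw [Nat.one_le_iff_ne_zero, Ne, normInf_eq_zero, sub_eq_zero]; exact hne'
      have hN2 : normInf (a - a') ≤ L * m := by
        rw [normInf_le]; intro i
        have q1 := mem_Q.1 (blocks_sub k hk ha) i
        have q2 := mem_Q.1 (blocks_sub k' hk' ha') i
        simp only [Pi.sub_apply]; rw [abs_le]; constructor <;> linarith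
      have : ((L:ℝ) * m) ^ (-(d : ℝ) - α) ≤ (normInf (a - a') : ℝ) ^ (-(d : ℝ) - α) := by
        apply Real.rpow_le_rpow_of_nonpos
        · exact_mod_cast hN1
        · exact_mod_cast hN2
        · have : (0:ℝ) ≤ d := by positivity
          linarith
      have : t ≤ b * (normInf (a - a') : ℝ) ^ (-(d : ℝ) - α) := mul_le_mul_of_nonneg_left this hb.le
      have := Real.exp_le_exp.2 (neg_le_neg this)
      linarith)
    (fun k k' => blocks_dis k k') (fun k hk => blocks_sub k hk)
  refine le_trans ?_ hB
  have hLd : (2:ℝ) ≤ (L:ℝ) ^ d := by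
    have : 2 ≤ L ^ d := hL.trans (Nat.le_self_pow (by omega) L)
    exact_mod_cast this
  have e1 : (L:ℝ) ^ ((d:ℝ) + α) * (4 * 1168 ^ 2) ≤ (L:ℝ) ^ d * (L:ℝ) ^ d := by
    calc (L:ℝ) ^ ((d:ℝ) + α) * (4 * 1168 ^ 2) ≤ (L:ℝ) ^ ((d:ℝ) + α) * (L:ℝ) ^ ((d:ℝ) - α) := by gcongr
      _ = (L:ℝ) ^ d * (L:ℝ) ^ d := by
        rw [← Real.rpow_add hLp, ← Real.rpow_natCast, ← Real.rpow_add hLp]; congr 1; ring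
  have e2 : (L:ℝ) ^ d * (L:ℝ) ^ d ≤ 2 * ((L:ℝ) ^ d * ((L:ℝ) ^ d - 1)) := by nlinarith
  have hTp : 0 ≤ T := by linarith
  have : (L:ℝ) ^ ((d:ℝ) + α) * (2 * 1168 ^ 2) ≤ ((L:ℝ) ^ d * ((L:ℝ) ^ d - 1)) := by linarith
  rw [mul_div_assoc', le_div_iff₀ (by norm_num)]
  nlinarith

lemma E2_bound {d : ℕ} (hd : 1 ≤ d) {α b : ℝ} (hα : 0 < α) (hαd : α < d) (hb : 0 < b) :
    ∃ A : ℝ, 1 ≤ A ∧ ∀ (p : Sym2 (V d) → ℝ), (∀ e, 0 ≤ p e) → (∀ e, p e ≤ 1) → TI p →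
    (∀ x y : V d, x ≠ y → 1 - Real.exp (-(b * (normInf (x - y) : ℝ) ^ (-(d : ℝ) - α))) ≤ p s(x, y)) →
    ∀ X : ℝ, (∀ m : ℕ, E2 p (Q d m) ≤ (m:ℝ) ^ d * X) →
    ∀ m : ℕ, 1 ≤ m → E2 p (Q d m) ≤ A * (m:ℝ) ^ ((d:ℝ) + α) := by
  obtain ⟨L, hL, hL2⟩ : ∃ L : ℕ, 2 ≤ L ∧ 4 * 1168 ^ 2 ≤ (L:ℝ) ^ ((d:ℝ) - α) := by
    have h := (tendsto_rpow_atTop (sub_pos.2 hαd)).comp (tendsto_natCast_atTop_atTop (R := ℝ))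
    obtain ⟨L, h1, h2⟩ := ((h.eventually_ge_atTop (4 * 1168 ^ 2)).and (Filter.eventually_ge_atTop 2)).exists
    exact ⟨L, h2, h1⟩
  have hLp : (0:ℝ) < L := by exact_mod_cast (by omega : 0 < L)
  refine ⟨(L:ℝ) ^ ((d:ℝ) + α) / (584 ^ 2 * b) + 1, ?_, ?_⟩
  · have : 0 ≤ (L:ℝ) ^ ((d:ℝ) + α) / (584 ^ 2 * b) := by positivity
    linarith
  intro p h0 h1 hp hlow X hX m hm
  by_contra hcon
  push Not at hcon
  set A := (L:ℝ) ^ ((d:ℝ) + α) / (584 ^ 2 * b)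
  have hA : 0 ≤ A := by positivity
  have hmp : (0:ℝ) < m := by exact_mod_cast (by omega : 0 < m)
  have hm1 : ∀ n : ℕ, 1 ≤ n → 1 ≤ (n:ℝ) ^ ((d:ℝ) + α) := fun n hn =>
    Real.one_le_rpow (by exact_mod_cast hn) (by positivity)
  have key : ∀ k : ℕ, 1 ≤ L ^ k * m ∧ ((L:ℝ) ^ ((d:ℝ) + α)) ^ k * E2 p (Q d m) ≤ E2 p (Q d (L ^ k * m)) ∧
     (A + 1) * ((L ^ k * m : ℕ):ℝ) ^ ((d:ℝ) + α) ≤ E2 p (Q d (L ^ k * m)) := by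
    intro k
    induction k with
    | zero => simp only [pow_zero, one_mul]; exact ⟨hm, le_refl _, hcon.le⟩
    | succ k ih =>
      obtain ⟨i1, i2, i3⟩ := ih
      have hM := hm1 _ i1
      have s := E2_step hd hα hb hL hL2 h0 h1 hp hlow i1 (by nlinarith) (by
        refine le_trans ?_ i3; gcongr; simp [A])
      have e : L ^ (k+1) * m = L * (L ^ k * m) := by ring
      rw [e]
      refine ⟨Nat.mul_pos (by omega) i1, ?_, ?_⟩
      · refine le_trans ?_ s
        rw [pow_succ', mul_assoc]
        gcongr
      · refine le_trans ?_ s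
        rw [Nat.cast_mul, Real.mul_rpow hLp.le (by positivity)]
        calc _ = (L:ℝ) ^ ((d:ℝ) + α) * ((A + 1) * ((L ^ k * m : ℕ):ℝ) ^ ((d:ℝ) + α)) := by ring
          _ ≤ _ := by gcongr
  have hE : 1 ≤ E2 p (Q d m) := by nlinarith [hm1 m hm]
  have hLα : 1 < (L:ℝ) ^ α := Real.one_lt_rpow (by exact_mod_cast (by omega : 1 < L)) hα
  obtain ⟨k, hk⟩ := pow_unbounded_of_one_lt ((m:ℝ) ^ d * X) hLα
  have h2 := (key k).2.1.trans (hX _)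
  rw [Real.rpow_add hLp, mul_pow, Real.rpow_natCast] at h2
  push_cast at h2
  have h3 : ((L:ℝ) ^ k * m) ^ d * X = ((L:ℝ) ^ d) ^ k * ((m:ℝ) ^ d * X) := by
    rw [mul_pow, ← pow_mul, ← pow_mul, mul_comm k d]; ring
  rw [h3, mul_assoc] at h2
  have h4 := le_of_mul_le_mul_left h2 (by positivity)
  have : ((L:ℝ) ^ α) ^ k * 1 ≤ ((L:ℝ) ^ α) ^ k * E2 p (Q d m) := by gcongr
  linarith

end M5

section M6
open Classical
set_option linter.unusedSectionVars false
variable {d : ℕ}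

/-- centred box -/
noncomputable def Lm (d n : ℕ) : Finset (V d) := Fintype.piFinset fun _ => Finset.Icc (-(n:ℤ)) n

lemma mem_Lm {n : ℕ} {x : V d} : x ∈ Lm d n ↔ normInf x ≤ n := by
  rw [normInf_le]; simp [Lm, Fintype.mem_piFinset, abs_le]

lemma Lm_mono {n m : ℕ} (h : n ≤ m) : Lm d n ⊆ Lm d m := fun x hx => by
  rw [mem_Lm] at hx ⊢; omega

lemma zero_mem_Lm (n : ℕ) : (0 : V d) ∈ Lm d n := by
  rw [mem_Lm, normInf_eq_zero.2 rfl]; omega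

lemma exists_Lm (S : Finset (V d)) : ∃ n, S ⊆ Lm d n :=
  ⟨S.sup normInf, fun x hx => mem_Lm.2 (Finset.le_sup (f := normInf) hx)⟩

/-- infinite volume two-point function -/
noncomputable def ti (p : Sym2 (V d) → ℝ) (x y : V d) : ℝ≥0∞ := ⨆ n, ENNReal.ofReal (tau p (Lm d n) x y)

lemma ti_symm (p : Sym2 (V d) → ℝ) (x y : V d) : ti p x y = ti p y x := by
  unfold ti; simp_rw [tau_symm p _ x y]

lemma tau_self (p : Sym2 (V d) → ℝ) (S : Finset (V d)) (x : V d) : tau p S x x = 1 := by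
  unfold tau Pr
  rw [Ex_congr (G := fun _ => 1) p (fun ω _ => ind_pos (R_refl ω x)), Ex_const]

lemma ti_self (p : Sym2 (V d) → ℝ) (x : V d) : ti p x x = 1 := by
  unfold ti; simp [tau_self]

section
variable {p : Sym2 (V d) → ℝ} (h0 : ∀ e, 0 ≤ p e) (h1 : ∀ e, p e ≤ 1)
include h0 h1

lemma tau_le_ti (S : Finset (V d)) (x y : V d) : ENNReal.ofReal (tau p S x y) ≤ ti p x y := by
  obtain ⟨n, hn⟩ := exists_Lm S
  exact (ENNReal.ofReal_le_ofReal (tau_mono h0 h1 hn x y)).trans (le_iSup (fun n => ENNReal.ofReal (tau p (Lm d n) x y)) n)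

lemma ti_le_one (x y : V d) : ti p x y ≤ 1 := by
  unfold ti
  refine iSup_le fun n => ?_
  rw [← ENNReal.ofReal_one]; exact ENNReal.ofReal_le_ofReal (tau_le_one h0 h1 _ _ _)

lemma ti_ne_top (x y : V d) : ti p x y ≠ ⊤ := ((ti_le_one h0 h1 x y).trans_lt ENNReal.one_lt_top).ne

lemma ti_mono_n (x y : V d) : Monotone fun n => ENNReal.ofReal (tau p (Lm d n) x y) :=
  fun _ _ h => ENNReal.ofReal_le_ofReal (tau_mono h0 h1 (Lm_mono h) x y)

lemma ti_add (hp : TI p) (v x y : V d) : ti p (x + v) (y + v) = ti p x y := by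
  have key : ∀ v x y : V d, ti p x y ≤ ti p (x + v) (y + v) := by
    intro v x y
    refine iSup_le fun n => ?_
    rw [← tau_sh hp (Lm d n) v x y]
    exact tau_le_ti h0 h1 _ _ _
  refine le_antisymm ?_ (key v x y)
  have := key (-v) (x + v) (y + v)
  simpa using this

lemma ti_eq (hp : TI p) (x y : V d) : ti p x y = ti p 0 (y - x) := by
  have := ti_add h0 h1 hp (-x) x y
  rw [← this]; simp [sub_eq_add_neg]

lemma tsum_ti_le {M : ℝ} (h : ∀ n, ∑ x ∈ Lm d n, tau p (Lm d n) 0 x ≤ M) : ∑' x, ti p 0 x ≤ ENNReal.ofReal M := by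
  rw [ENNReal.tsum_eq_iSup_sum]
  refine iSup_le fun F => ?_
  unfold ti
  rw [ENNReal.finsetSum_iSup_of_monotone fun x => ti_mono_n h0 h1 0 x]
  refine iSup_le fun n => ?_
  obtain ⟨m, hm⟩ := exists_Lm F
  rw [← ENNReal.ofReal_sum_of_nonneg fun _ _ => tau_nonneg h0 h1 _ _ _]
  refine ENNReal.ofReal_le_ofReal ((h (max n m)).trans' ?_)
  calc ∑ x ∈ F, tau p (Lm d n) 0 x ≤ ∑ x ∈ F, tau p (Lm d (max n m)) 0 x :=
        Finset.sum_le_sum fun x _ => tau_mono h0 h1 (Lm_mono (le_max_left _ _)) _ _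
    _ ≤ _ := Finset.sum_le_sum_of_subset_of_nonneg (hm.trans (Lm_mono (le_max_right _ _)))
        fun _ _ _ => tau_nonneg h0 h1 _ _ _

end

/-- kernel on unordered pairs -/
noncomputable def Js (J : V d → V d → ℝ) : Sym2 (V d) → ℝ :=
  Sym2.lift ⟨fun x y => (J x y + J y x) / 2, fun x y => by dsimp only; rw [add_comm]⟩

section
variable {J : V d → V d → ℝ} {α c C : ℝ} (hJ : KernelHyp d J α c C)
include hJ

lemma Js_mk (x y : V d) : Js J s(x, y) = J x y := by
  simp only [Js, Sym2.lift_mk]; rw [hJ.symm y x]; ring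

lemma Js_nonneg (e : Sym2 (V d)) : 0 ≤ Js J e := by
  induction e using Sym2.ind with
  | _ a b => rw [Js_mk hJ]; exact hJ.nonneg a b

lemma TI_pb (β : ℝ) : TI (pb (Js J) β) := by
  intro v x y; unfold pb; rw [Js_mk hJ, Js_mk hJ, hJ.transInv]

lemma tau_mono_beta {β₁ β₂ : ℝ} (h0 : 0 ≤ β₁) (h : β₁ ≤ β₂) (S : Finset (V d)) {x : V d} (hx : x ∈ S) (y : V d) :
    tau (pb (Js J) β₁) S x y ≤ tau (pb (Js J) β₂) S x y := by
  have e : ∀ b, tau (pb (Js J) b) S x y = Pr (pb (Js J) b) S.sym2 (fun ω => ∃ b ∈ ({x} : Finset (V d)), R ω b y) := by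
    intro b; unfold tau; simp
  have hr : ∀ b, 0 ≤ b → ∃ f', HasDerivAt (fun b => tau (pb (Js J) b) S x y) f' b ∧ 0 ≤ f' := by
    intro b hb
    obtain ⟨f', h1, h2⟩ := russo_lower (Js_nonneg hJ) hb (Finset.singleton_subset_iff.2 hx) y
    refine ⟨f', ?_, h2.trans' ?_⟩
    · simp_rw [e]; exact h1
    · refine Ex_nonneg (pb_nonneg (Js_nonneg hJ) hb) (pb_le_one _ _) fun ω _ => ?_
      refine Finset.sum_nonneg fun _ _ => Finset.sum_nonneg fun _ _ => mul_nonneg (Js_nonneg hJ _) ?_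
      exact tau_nonneg (pb_nonneg (Js_nonneg hJ) hb) (pb_le_one _ _) _ _ _
  have hm : MonotoneOn (fun b => tau (pb (Js J) b) S x y) (Set.Ici 0) := by
    refine monotoneOn_of_deriv_nonneg (convex_Ici 0) ?_ ?_ ?_
    · intro b hb; obtain ⟨f', h1, _⟩ := hr b hb; exact h1.continuousAt.continuousWithinAt
    · intro b hb; rw [interior_Ici] at hb
      obtain ⟨f', h1, _⟩ := hr b (le_of_lt hb); exact h1.differentiableAt.differentiableWithinAt
    · intro b hb; rw [interior_Ici] at hb
      obtain ⟨f', h1, h2⟩ := hr b (le_of_lt hb); rw [h1.deriv]; exact h2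
  exact hm h0 (h0.trans h) h

end

section
variable {J : V d → V d → ℝ} {P : ℝ → Measure (Config d)} (hP : IsLRP J P)

/-- open edges within a finite set -/
noncomputable def op (E : Finset (Sym2 (V d))) (ω : Config d) : Finset (Sym2 (V d)) := E.filter (fun e => ω e = true)

lemma mem_op {E : Finset (Sym2 (V d))} {ω : Config d} {e} : e ∈ op E ω ↔ e ∈ E ∧ ω e = true := Finset.mem_filter

lemma op_eq {E F : Finset (Sym2 (V d))} (hF : F ⊆ E) (ω : Config d) :
    op E ω = F ↔ ∀ e ∈ E, ω e = decide (e ∈ F) := by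
  constructor
  · rintro rfl e he
    by_cases h : ω e = true
    · rw [h, decide_eq_true (mem_op.2 ⟨he, h⟩)]
    · rw [decide_eq_false (fun h' => h (mem_op.1 h').2)]; simpa using h
  · intro h; ext e; rw [mem_op]
    constructor
    · rintro ⟨h1, h2⟩; rw [h e h1] at h2; simpa using h2
    · intro he; refine ⟨hF he, ?_⟩; rw [h e (hF he)]; simpa using he

lemma op_set (E : Finset (Sym2 (V d))) (A : Finset (Sym2 (V d)) → Prop) :
    {ω : Config d | A (op E ω)} = ⋃ F ∈ E.powerset.filter A, {ω | ∀ e ∈ E, ω e = decide (e ∈ F)} := by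
  ext ω
  simp only [Set.mem_setOf_eq, Set.mem_iUnion, Finset.mem_filter, Finset.mem_powerset, exists_prop]
  constructor
  · intro h; exact ⟨op E ω, ⟨Finset.filter_subset _ _, h⟩, (op_eq (Finset.filter_subset _ _) ω).1 rfl⟩
  · rintro ⟨F, ⟨h1, h2⟩, h3⟩; rw [(op_eq h1 ω).2 h3]; exact h2

lemma meas_cyl (E : Finset (Sym2 (V d))) (f : Sym2 (V d) → Bool) :
    MeasurableSet {ω : Config d | ∀ e ∈ E, ω e = f e} := by
  have : {ω : Config d | ∀ e ∈ E, ω e = f e} = ⋂ e ∈ E, (fun ω : Config d => ω e) ⁻¹' {f e} := by ext; simp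
  rw [this]
  exact Finset.measurableSet_biInter _ fun e _ => measurable_pi_apply e (measurableSet_singleton _)

lemma meas_op (E : Finset (Sym2 (V d))) (A : Finset (Sym2 (V d)) → Prop) :
    MeasurableSet {ω : Config d | A (op E ω)} := by
  rw [op_set]
  exact Finset.measurableSet_biUnion _ fun F _ => meas_cyl E _

include hP in
lemma P_op {α c C : ℝ} (hJ : KernelHyp d J α c C) {β : ℝ} (hβ : 0 ≤ β) (E : Finset (Sym2 (V d))) (A : Finset (Sym2 (V d)) → Prop) :
    P β {ω | A (op E ω)} = ENNReal.ofReal (Pr (pb (Js J) β) E A) := by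
  have h0 := pb_nonneg (Js_nonneg hJ) hβ
  have h1 := pb_le_one (Js J) β
  rw [op_set, measure_biUnion_finset]
  · unfold Pr Ex
    rw [ENNReal.ofReal_sum_of_nonneg fun _ _ => mul_nonneg (wt_nonneg h0 h1 _ _) (ind_nonneg _), Finset.sum_filter]
    refine Finset.sum_congr rfl fun F hF => ?_
    rw [Finset.mem_powerset] at hF
    by_cases hA : A F
    · rw [if_pos hA, ind_pos hA, mul_one, hP]
      have e1 : ∀ e ∈ E, (if decide (e ∈ F) = true then edgeProb J β e else 1 - edgeProb J β e)
          = ENNReal.ofReal (if e ∈ F then pb (Js J) β e else 1 - pb (Js J) β e) := by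
        intro e _
        have : edgeProb J β e = ENNReal.ofReal (pb (Js J) β e) := rfl
        by_cases he : e ∈ F
        · simp [he, this]
        · simp only [he, decide_false, Bool.false_eq_true, if_false, this]
          rw [← ENNReal.ofReal_one, ← ENNReal.ofReal_sub _ (h0 e)]
      rw [Finset.prod_congr rfl e1, ← ENNReal.ofReal_prod_of_nonneg]
      · congr 1
        unfold wt
        rw [← Finset.prod_sdiff hF, mul_comm]
        congr 1
        · exact Finset.prod_congr rfl fun e he => if_pos he
        · exact Finset.prod_congr rfl fun e he => if_neg (Finset.mem_sdiff.1 he).2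
      · intro e _; split_ifs
        · exact h0 e
        · linarith [h1 e]
    · rw [if_neg hA, ind_neg hA, mul_zero, ENNReal.ofReal_zero]
  · intro F hF F' hF' hne
    rw [Function.onFun, Set.disjoint_left]
    intro ω h h'
    simp only [Finset.coe_filter, Finset.mem_powerset, Set.mem_setOf_eq] at hF hF' h h'
    exact hne (((op_eq hF.1 ω).2 h).symm.trans ((op_eq hF'.1 ω).2 h'))
  · intro F _; exact meas_cyl E _

lemma op_mono {E E' : Finset (Sym2 (V d))} (h : E ⊆ E') (ω : Config d) : op E ω ⊆ op E' ω :=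
  Finset.filter_subset_filter _ h

lemma conn_of_R {E : Finset (Sym2 (V d))} {ω : Config d} {x y : V d} (h : R (op E ω) x y) : conn ω x y :=
  Relation.ReflTransGen.mono (fun _ _ hab => ⟨hab.1, (mem_op.1 hab.2).2⟩) _ _ h

lemma conn_iff (ω : Config d) (x y : V d) : conn ω x y ↔ ∃ n, R (op (Lm d n).sym2 ω) x y := by
  constructor
  · intro h
    induction h with
    | refl => exact ⟨0, R_refl _ _⟩
    | @tail b c _ hbc ih =>
      obtain ⟨n, hn⟩ := ih
      obtain ⟨m, hm⟩ := exists_Lm ({b, c} : Finset (V d))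
      refine ⟨max n m, R_trans (R_mono (op_mono (Finset.sym2_mono (Lm_mono (le_max_left _ _))) ω) hn) (R_edge ?_)⟩
      refine mem_op.2 ⟨?_, hbc.2⟩
      rw [Finset.mk_mem_sym2_iff]
      exact ⟨Lm_mono (le_max_right _ _) (hm (by simp)), Lm_mono (le_max_right _ _) (hm (by simp))⟩
  · rintro ⟨n, h⟩; exact conn_of_R h

include hP in
lemma twoPoint_eq {α c C : ℝ} (hJ : KernelHyp d J α c C) {β : ℝ} (hβ : 0 ≤ β) (x y : V d) :
    twoPoint P β x y = ti (pb (Js J) β) x y := by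
  unfold twoPoint
  have : {ω : Config d | conn ω x y} = ⋃ n, {ω | R (op (Lm d n).sym2 ω) x y} := by
    ext ω; simp [conn_iff]
  rw [this, Monotone.measure_iUnion]
  · unfold ti
    congr 1; ext n
    exact P_op hP hJ hβ _ (fun ω => R ω x y)
  · intro n m h ω hω
    exact R_mono (op_mono (Finset.sym2_mono (Lm_mono h)) ω) hω

include hP in
lemma P_inf_pos {α c C : ℝ} (hJ : KernelHyp d J α c C) {β : ℝ} (hβ : 0 ≤ β) {δ : ℝ} (hδ : 0 < δ)
    (h : ∀ n, ∃ m, n ≤ m ∧ δ ≤ Pr (pb (Js J) β) (Lm d m).sym2 (fun ω => ∃ b ∈ Lm d m \ Lm d n, R ω b 0)) :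
    0 < P β {ω | ∃ x, (cluster ω x).Infinite} := by
  set D : ℕ → Set (Config d) := fun n => ⋃ m, {ω | ∃ b ∈ Lm d m \ Lm d n, R (op (Lm d m).sym2 ω) b 0} with hD
  have hDm : ∀ n, MeasurableSet (D n) := fun n => MeasurableSet.iUnion fun m =>
    meas_op _ (fun ω => ∃ b ∈ Lm d m \ Lm d n, R ω b 0)
  have hanti : Antitone D := by
    intro n n' hn ω hω
    simp only [hD, Set.mem_iUnion, Set.mem_setOf_eq] at hω ⊢
    obtain ⟨m, b, hb, hR⟩ := hω
    refine ⟨m, b, ?_, hR⟩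
    rw [Finset.mem_sdiff] at hb ⊢
    exact ⟨hb.1, fun h' => hb.2 (Lm_mono hn h')⟩
  have huniv : P β Set.univ = 1 := by
    have := hP β ∅ (fun _ => true)
    simpa using this
  have hge : ∀ n, ENNReal.ofReal δ ≤ P β (D n) := by
    intro n
    obtain ⟨m, _, hm⟩ := h n
    refine (ENNReal.ofReal_le_ofReal hm).trans ?_
    rw [← P_op hP hJ hβ]
    exact measure_mono (Set.subset_iUnion (fun m => {ω | ∃ b ∈ Lm d m \ Lm d n, R (op (Lm d m).sym2 ω) b 0}) m)
  have ht := tendsto_measure_iInter_atTop (μ := P β) (fun n => (hDm n).nullMeasurableSet) hanti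
    ⟨0, ((measure_mono (Set.subset_univ _)).trans_lt (by rw [huniv]; exact ENNReal.one_lt_top)).ne⟩
  have h3 : ENNReal.ofReal δ ≤ P β (⋂ n, D n) := ge_of_tendsto' ht hge
  refine (ENNReal.ofReal_pos.2 hδ).trans_le (h3.trans (measure_mono ?_))
  intro ω hω
  refine ⟨0, fun hfin => ?_⟩
  obtain ⟨n, hn⟩ := exists_Lm hfin.toFinset
  have := Set.mem_iInter.1 hω n
  simp only [hD, Set.mem_iUnion, Set.mem_setOf_eq] at this
  obtain ⟨m, b, hb, hR⟩ := this
  refine (Finset.mem_sdiff.1 hb).2 (hn ?_)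
  rw [Set.Finite.mem_toFinset]
  exact conn_of_R (R_symm hR)

include hP in
lemma chi_neg {β : ℝ} {α c C : ℝ} (hJ : KernelHyp d J α c C) (hβ : β < 0) : chi P β = 1 := by
  have huniv : P β Set.univ = 1 := by
    have := hP β ∅ (fun _ => true)
    simpa using this
  have he : ∀ e, P β {ω | ω e = true} = 0 := by
    intro e
    have := hP β {e} (fun _ => true)
    simp only [Finset.mem_singleton, forall_eq, if_true, Finset.prod_singleton] at this
    rw [this]
    refine ENNReal.ofReal_eq_zero.2 ?_
    have h1 : 0 ≤ -β * Js J e := mul_nonneg (by linarith) (Js_nonneg hJ e)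
    have := Real.one_le_exp h1
    exact sub_nonpos.2 this
  have hz : P β (⋃ e, {ω | ω e = true}) = 0 := measure_iUnion_null he
  unfold chi
  rw [tsum_eq_single 0]
  · unfold twoPoint
    rw [← huniv]; congr 1; ext ω; simp [conn, Relation.ReflTransGen.refl]
  · intro x hx
    refine measure_mono_null ?_ hz
    intro ω hω
    rcases Relation.ReflTransGen.cases_head hω with h | ⟨y, h, _⟩
    · exact absurd h.symm hx
    · exact Set.mem_iUnion.2 ⟨_, h.2⟩

end

end M6

section M7
open Classical
set_option linter.unusedSectionVars false
variable {d : ℕ} {J : V d → V d → ℝ} {α c C : ℝ} (hJ : KernelHyp d J α c C)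

/-- the boundary functional -/
noncomputable def phi (J : V d → V d → ℝ) (β : ℝ) (m : ℕ) (S : Finset (V d)) : ℝ :=
  ∑ x ∈ S, tau (pb (Js J) β) S 0 x * ∑ y ∈ Lm d m \ S, Js J s(x, y)

include hJ

lemma phi_fin {β κ : ℝ} (hβ : 0 ≤ β) (hκ : β * κ ≤ 1 / 2) {S : Finset (V d)} (hS : 0 ∈ S)
    (h : ∀ m, phi J β m S ≤ κ) (n : ℕ) :
    ∑ x ∈ Lm d n, tau (pb (Js J) β) (Lm d n) 0 x ≤ 2 * S.card := by
  have h0 := pb_nonneg (Js_nonneg hJ) hβ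
  have h1 := pb_le_one (Js J) β
  set p := pb (Js J) β with hp
  have hn := tau_nonneg h0 h1
  set g : V d → ℝ := fun x => ∑ y ∈ Lm d n, tau p (Lm d n) x y with hg
  have hg0 : ∀ x, 0 ≤ g x := fun x => Finset.sum_nonneg fun _ _ => hn _ _ _
  obtain ⟨x, hx, hmax⟩ := Finset.exists_max_image (Lm d n) g ⟨0, zero_mem_Lm n⟩
  refine (hmax 0 (zero_mem_Lm n)).trans ?_
  suffices hs : g x ≤ S.card + 1 / 2 * g x by linarith
  set S' := sh S x ∩ Lm d n with hS'
  have hxS : x ∈ S' := by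
    rw [hS', Finset.mem_inter, mem_sh]; exact ⟨by simpa using hS, hx⟩
  have hsub : S' ⊆ Lm d n := Finset.inter_subset_right
  have hsub2 : S' ⊆ sh S x := Finset.inter_subset_left
  calc g x ≤ ∑ y ∈ Lm d n, (tau p S' x y + ∑ a ∈ S', ∑ b ∈ Lm d n \ S', tau p S' x a * p s(a, b) * tau p (Lm d n) b y) :=
        Finset.sum_le_sum fun y _ => simon_lieb h0 h1 hsub hxS y
    _ = ∑ y ∈ Lm d n, tau p S' x y + ∑ a ∈ S', ∑ b ∈ Lm d n \ S', tau p S' x a * p s(a, b) * g b := by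
        rw [Finset.sum_add_distrib]; congr 1
        rw [Finset.sum_comm]; refine Finset.sum_congr rfl fun a _ => ?_
        rw [Finset.sum_comm]; refine Finset.sum_congr rfl fun b _ => ?_
        rw [Finset.mul_sum]
    _ ≤ S.card + (β * phi J β (n + n) S) * g x := by
        refine add_le_add ?_ ?_
        · calc ∑ y ∈ Lm d n, tau p S' x y = ∑ y ∈ S', tau p S' x y := by
                symm; refine Finset.sum_subset hsub fun y _ hy => tau_eq_zero p hxS hy
            _ ≤ ∑ y ∈ S', 1 := Finset.sum_le_sum fun _ _ => tau_le_one h0 h1 _ _ _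
            _ ≤ S.card := by
              rw [Finset.sum_const, nsmul_one]
              have := (Finset.card_le_card hsub2).trans Finset.card_image_le
              exact_mod_cast this
        · calc ∑ a ∈ S', ∑ b ∈ Lm d n \ S', tau p S' x a * p s(a, b) * g b
              ≤ ∑ a ∈ S', ∑ b ∈ Lm d n \ S', tau p (sh S x) x a * (β * Js J s(a, b)) * g x := by
                refine Finset.sum_le_sum fun a _ => Finset.sum_le_sum fun b hb => ?_
                have := hmax b (Finset.mem_sdiff.1 hb).1
                refine mul_le_mul (mul_le_mul (tau_mono h0 h1 hsub2 _ _) (pb_le _ _ _) (h0 _) (hn _ _ _)) this (hg0 _) ?_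
                exact mul_nonneg (hn _ _ _) (mul_nonneg hβ (Js_nonneg hJ _))
            _ ≤ ∑ a ∈ sh S x, ∑ b ∈ sh (Lm d (n + n) \ S) x, tau p (sh S x) x a * (β * Js J s(a, b)) * g x := by
                have hnn : ∀ a b, 0 ≤ tau p (sh S x) x a * (β * Js J s(a, b)) * g x := fun a b =>
                  mul_nonneg (mul_nonneg (hn _ _ _) (mul_nonneg hβ (Js_nonneg hJ _))) (hg0 _)
                refine (Finset.sum_le_sum fun a _ => ?_).trans (Finset.sum_le_sum_of_subset_of_nonneg hsub2
                  fun a _ _ => Finset.sum_nonneg fun b _ => hnn a b)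
                refine Finset.sum_le_sum_of_subset_of_nonneg ?_ fun b _ _ => hnn a b
                intro b hb
                rw [Finset.mem_sdiff] at hb
                rw [mem_sh, Finset.mem_sdiff, ← mem_sh (S := S)]
                refine ⟨?_, fun h' => hb.2 (Finset.mem_inter.2 ⟨h', hb.1⟩)⟩
                have q1 := normInf_le.1 (mem_Lm.1 hb.1)
                have q2 := normInf_le.1 (mem_Lm.1 hx)
                rw [mem_Lm, normInf_le]; intro i
                have := q1 i; have := q2 i
                simp only [Pi.sub_apply]; push_cast
                exact (abs_sub _ _).trans (by linarith)
            _ = _ := by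
                generalize g x = gx
                rw [sum_sh, phi, Finset.mul_sum, Finset.sum_mul]
                refine Finset.sum_congr rfl fun a _ => ?_
                rw [sum_sh]
                have e1 : tau p (sh S x) x (a + x) = tau p S 0 a := by
                  have := tau_sh (TI_pb hJ β) S x 0 a
                  rwa [zero_add] at this
                rw [e1, Finset.mul_sum, Finset.mul_sum, Finset.sum_mul]
                refine Finset.sum_congr rfl fun b _ => ?_
                rw [Js_mk hJ, Js_mk hJ, hJ.transInv]; ring
    _ ≤ _ := by
        have := h (n + n)
        have : β * phi J β (n + n) S ≤ 1 / 2 := (mul_le_mul_of_nonneg_left this hβ).trans hκ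
        have := mul_le_mul_of_nonneg_right this (hg0 x)
        linarith

lemma phi_mono_m {β : ℝ} (hβ : 0 ≤ β) {m m' : ℕ} (h : m ≤ m') (S : Finset (V d)) : phi J β m S ≤ phi J β m' S := by
  refine Finset.sum_le_sum fun x _ => mul_le_mul_of_nonneg_left ?_
    (tau_nonneg (pb_nonneg (Js_nonneg hJ) hβ) (pb_le_one _ _) _ _ _)
  exact Finset.sum_le_sum_of_subset_of_nonneg (Finset.sdiff_subset_sdiff (Lm_mono h) (le_refl _))
    fun _ _ _ => Js_nonneg hJ _

lemma phi_mono_b {β β' : ℝ} (hβ : 0 ≤ β) (h : β ≤ β') (m : ℕ) {S : Finset (V d)} (hS : 0 ∈ S) : phi J β m S ≤ phi J β' m S := by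
  refine Finset.sum_le_sum fun x _ => mul_le_mul_of_nonneg_right (tau_mono_beta hJ hβ h S hS x) ?_
  exact Finset.sum_nonneg fun _ _ => Js_nonneg hJ _

lemma phi_grow {β β₂ κ : ℝ} (hβ : 0 ≤ β) (hβ₂ : β < β₂) (hκ : 0 < κ) {n m : ℕ} 
    (h : ∀ S ⊆ Lm d n, 0 ∈ S → κ ≤ phi J β m S) :
    1 - Real.exp (-(κ * (β₂ - β))) ≤ Pr (pb (Js J) β₂) (Lm d m).sym2 (fun ω => ∃ b ∈ Lm d m \ Lm d n, R ω b 0) := by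
  set f : ℝ → ℝ := fun b => Pr (pb (Js J) b) (Lm d m).sym2 (fun ω => ∃ b ∈ Lm d m \ Lm d n, R ω b 0) with hf
  have hder : ∀ b, β ≤ b → ∃ f', HasDerivAt f f' b ∧ κ * (1 - f b) ≤ f' := by
    intro b hb
    have hb0 : 0 ≤ b := hβ.trans hb
    have h0 := pb_nonneg (Js_nonneg hJ) hb0
    have h1 := pb_le_one (Js J) b
    obtain ⟨f', hf1, hf2⟩ := russo_lower (Js_nonneg hJ) hb0 (Finset.sdiff_subset (s := Lm d m) (t := Lm d n)) 0
    refine ⟨f', hf1, hf2.trans' ?_⟩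
    have e : κ * (1 - f b) = Ex (pb (Js J) b) (Lm d m).sym2 (fun ω => κ * (1 - ind (∃ b ∈ Lm d m \ Lm d n, R ω b 0))) := by
      rw [Ex_mul, Ex_sub, Ex_const]; rfl
    rw [e]
    refine Ex_mono h0 h1 fun ω hω => ?_
    by_cases hA : ∃ b ∈ Lm d m \ Lm d n, R ω b 0
    · rw [ind_pos hA, sub_self, mul_zero]
      exact Finset.sum_nonneg fun _ _ => Finset.sum_nonneg fun _ _ => mul_nonneg (Js_nonneg hJ _) (tau_nonneg h0 h1 _ _ _)
    · rw [ind_neg hA, sub_zero, mul_one]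
      set K := KB (Lm d m) (Lm d m \ Lm d n) ω with hK
      have hKs : K ⊆ Lm d m := Finset.filter_subset _ _
      have hS0 : (0 : V d) ∈ Lm d m \ K := by
        rw [Finset.mem_sdiff]; refine ⟨zero_mem_Lm m, fun h' => hA ?_⟩
        exact (Finset.mem_filter.1 h').2
      have hSn : Lm d m \ K ⊆ Lm d n := by
        intro x hx
        rw [Finset.mem_sdiff] at hx
        by_contra hxn
        exact hx.2 (Finset.mem_filter.2 ⟨hx.1, x, Finset.mem_sdiff.2 ⟨hx.1, hxn⟩, R_refl _ _⟩)
      refine ((h _ hSn hS0).trans (phi_mono_b hJ hβ hb m hS0)).trans (le_of_eq ?_)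
      unfold phi
      rw [Finset.sdiff_sdiff_eq_self hKs, Finset.sum_comm]
      refine Finset.sum_congr rfl fun z' _ => ?_
      rw [Finset.mul_sum]
      refine Finset.sum_congr rfl fun z _ => ?_
      rw [tau_symm, mul_comm, Sym2.eq_swap]
  have hg : AntitoneOn (fun b => (1 - f b) * Real.exp (κ * b)) (Set.Ici β) := by
    have hd : ∀ b, β ≤ b → ∃ g', HasDerivAt (fun b => (1 - f b) * Real.exp (κ * b)) g' b ∧ g' ≤ 0 := by
      intro b hb
      obtain ⟨f', h1, h2⟩ := hder b hb
      have e1 : HasDerivAt (fun b => Real.exp (κ * b)) (Real.exp (κ * b) * (κ * 1)) b :=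
        ((hasDerivAt_id b).const_mul κ).exp
      refine ⟨_, (h1.const_sub 1).mul e1, ?_⟩
      have := Real.exp_pos (κ * b)
      nlinarith
    refine antitoneOn_of_deriv_nonpos (convex_Ici β) ?_ ?_ ?_
    · intro b hb; obtain ⟨f', h1, _⟩ := hd b hb; exact h1.continuousAt.continuousWithinAt
    · intro b hb; rw [interior_Ici] at hb
      obtain ⟨f', h1, _⟩ := hd b (le_of_lt hb); exact h1.differentiableAt.differentiableWithinAt
    · intro b hb; rw [interior_Ici] at hb
      obtain ⟨f', h1, h2⟩ := hd b (le_of_lt hb); rw [h1.deriv]; exact h2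
  have h3 := hg (Set.mem_Ici.2 le_rfl) (Set.mem_Ici.2 hβ₂.le) hβ₂.le
  have hf0 : 0 ≤ f β := Pr_nonneg (pb_nonneg (Js_nonneg hJ) hβ) (pb_le_one _ _)
  simp only at h3
  have h4 : (1 - f β₂) * Real.exp (κ * β₂) ≤ Real.exp (κ * β) := by
    refine h3.trans ?_
    have := Real.exp_pos (κ * β)
    nlinarith
  have h5 : 1 - f β₂ ≤ Real.exp (-(κ * (β₂ - β))) := by
    have : Real.exp (-(κ * (β₂ - β))) = Real.exp (κ * β) / Real.exp (κ * β₂) := by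
      rw [← Real.exp_sub]; congr 1; ring
    rw [this, le_div_iff₀ (Real.exp_pos _)]; exact h4
  linarith

lemma chi_fin {P : ℝ → Measure (Config d)} (hP : IsLRP J P) {β : ℝ} (hβ : 0 ≤ β) (hc : β < betaC P) :
    ∑' x, ti (pb (Js J) β) 0 x < ⊤ := by
  set κ := 1 / (2 * betaC P) with hκ
  have hbc : 0 < betaC P := hβ.trans_lt hc
  have hκ0 : 0 < κ := by positivity
  by_cases hS : ∃ S : Finset (V d), 0 ∈ S ∧ ∀ m, phi J β m S ≤ κ
  · obtain ⟨S, hS, h⟩ := hS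
    refine (tsum_ti_le (pb_nonneg (Js_nonneg hJ) hβ) (pb_le_one _ _) (phi_fin hJ hβ ?_ hS h)).trans_lt ENNReal.ofReal_lt_top
    rw [hκ, mul_one_div, div_le_div_iff₀ (by positivity) (by norm_num)]; linarith
  · exfalso
    push Not at hS
    have h2 : betaC P ≤ (β + betaC P) / 2 := by
      refine csInf_le ⟨0, fun b hb => hb.1⟩ ⟨by linarith, ?_⟩
      refine P_inf_pos hP hJ (by linarith) (δ := 1 - Real.exp (-(κ * ((β + betaC P) / 2 - β)))) ?_ ?_
      · rw [sub_pos, Real.exp_lt_one_iff]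
        have : 0 < κ * ((β + betaC P) / 2 - β) := mul_pos hκ0 (by linarith)
        linarith
      · intro n
        choose! M hM using hS
        set m := max n ((Lm d n).powerset.sup M)
        refine ⟨m, le_max_left _ _, phi_grow hJ hβ (by linarith) hκ0 fun S hS h0 => ?_⟩
        refine (hM S h0).le.trans (phi_mono_m hJ hβ ?_ S)
        exact le_max_of_le_right (Finset.le_sup (Finset.mem_powerset.2 hS))
    linarith

end M7

section M8
open Classical
set_option linter.unusedSectionVars false
variable {d : ℕ}

/-- regularised norm -/
noncomputable def N (x : V d) : ℝ := max 1 (normInf x : ℝ)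

lemma one_le_N (x : V d) : 1 ≤ N x := le_max_left _ _
lemma N_pos (x : V d) : 0 < N x := one_pos.trans_le (one_le_N x)

lemma normInf_neg (x : V d) : normInf (-x) = normInf x := by simp [normInf]

lemma normInf_add (x y : V d) : normInf (x + y) ≤ normInf x + normInf y := by
  rw [normInf_le]; intro i
  have h1 := normInf_le.1 (le_refl (normInf x)) i
  have h2 := normInf_le.1 (le_refl (normInf y)) i
  simp only [Pi.add_apply]; push_cast
  exact (abs_add_le _ _).trans (by linarith)

lemma N_neg (x : V d) : N (-x) = N x := by unfold N; rw [normInf_neg]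

lemma N_add (x y : V d) : N (x + y) ≤ N x + N y := by
  have h : (normInf (x + y) : ℝ) ≤ normInf x + normInf y := by exact_mod_cast normInf_add x y
  have h1 : (normInf x : ℝ) ≤ N x := le_max_right _ _
  have h2 : (normInf y : ℝ) ≤ N y := le_max_right _ _
  exact max_le (by linarith [one_le_N x, one_le_N y]) (by linarith)

lemma N_sub (x y : V d) : N x ≤ N y + N (x - y) := by
  have := N_add y (x - y); rwa [add_sub_cancel] at this

lemma normInf_le_N (x : V d) : (normInf x : ℝ) ≤ N x := le_max_right _ _

lemma N_le_iff {x : V d} {R : ℝ} (hR : 1 ≤ R) : N x ≤ R ↔ x ∈ Lm d ⌊R⌋₊ := by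
  rw [mem_Lm, Nat.le_floor_iff (by linarith)]
  unfold N; rw [max_le_iff]; tauto

lemma card_Lm (n : ℕ) : (Lm d n).card = (2 * n + 1) ^ d := by
  simp only [Lm, Fintype.card_piFinset, Int.card_Icc, Finset.prod_const, Finset.card_univ, Fintype.card_fin]
  congr 1; omega

/-- ball sums -/
noncomputable def bs (f : V d → ℝ≥0∞) (R : ℝ) : ℝ≥0∞ := ∑' x, if N x ≤ R then f x else 0

lemma bs_eq (f : V d → ℝ≥0∞) {R : ℝ} (hR : 1 ≤ R) : bs f R = ∑ x ∈ Lm d ⌊R⌋₊, f x := by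
  unfold bs
  rw [tsum_eq_sum (s := Lm d ⌊R⌋₊)]
  · exact Finset.sum_congr rfl fun x hx => if_pos ((N_le_iff hR).2 hx)
  · intro x hx; exact if_neg fun h => hx ((N_le_iff hR).1 h)

lemma bs_small (f : V d → ℝ≥0∞) {R : ℝ} (hR : R < 1) : bs f R = 0 := by
  unfold bs
  rw [ENNReal.tsum_eq_zero]; intro x
  exact if_neg fun h => by linarith [one_le_N x]

/-- ball growth bound -/
def BG (f : V d → ℝ≥0∞) (A : ℝ≥0∞) (a : ℝ) : Prop := ∀ R : ℝ, 0 < R → bs f R ≤ A * ENNReal.ofReal (R ^ a)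

lemma BG_of {f : V d → ℝ≥0∞} {A : ℝ≥0∞} {a : ℝ} (ha : 0 ≤ a)
    (h : ∀ n : ℕ, 1 ≤ n → ∑ x ∈ Lm d n, f x ≤ A * ENNReal.ofReal ((n:ℝ) ^ a)) : BG f A a := by
  intro R hR
  by_cases h1 : R < 1
  · rw [bs_small f h1]; exact zero_le
  · push Not at h1
    rw [bs_eq f h1]
    refine (h _ (Nat.le_floor (by simpa using h1))).trans ?_
    gcongr
    exact Nat.floor_le hR.le

lemma BG_one : BG (d := d) (fun _ => 1) (ENNReal.ofReal (3 ^ d)) (d:ℝ) := by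
  refine BG_of (by positivity) fun n hn => ?_
  rw [Finset.sum_const, card_Lm, nsmul_one, Real.rpow_natCast, ← ENNReal.ofReal_mul (by positivity), ← mul_pow,
    ← ENNReal.ofReal_natCast]
  refine ENNReal.ofReal_le_ofReal ?_
  push_cast
  have : (1:ℝ) ≤ n := by exact_mod_cast hn
  gcongr; linarith

lemma geom_fin {q : ℝ} (K : ℝ) (hq0 : 0 ≤ q) (hq : q < 1) : ∑' k : ℕ, ENNReal.ofReal (K * q ^ k) ≠ ⊤ := by
  by_cases hK : 0 ≤ K
  · rw [← ENNReal.ofReal_tsum_of_nonneg (fun k => by positivity)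
      ((summable_geometric_of_lt_one hq0 hq).mul_left K)]
    exact ENNReal.ofReal_ne_top
  · have : ∀ k, ENNReal.ofReal (K * q ^ k) = 0 := fun k => ENNReal.ofReal_eq_zero.2 (by
      have := pow_nonneg hq0 k; push Not at hK; nlinarith)
    simp [this]

lemma dyad {t : ℝ} (ht : 1 < t) : ∃ k : ℕ, (2:ℝ) ^ k < t ∧ t ≤ 2 ^ (k + 1) := by
  have hex : ∃ n : ℕ, t ≤ (2:ℝ) ^ n := by
    obtain ⟨n, hn⟩ := pow_unbounded_of_one_lt t (one_lt_two); exact ⟨n, hn.le⟩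
  have hf := Nat.find_spec hex
  have h0 : Nat.find hex ≠ 0 := fun h => by rw [h] at hf; simp at hf; linarith
  obtain ⟨k, hk⟩ := Nat.exists_eq_succ_of_ne_zero h0
  refine ⟨k, ?_, ?_⟩
  · have := Nat.find_min hex (m := k) (by omega); push Not at this; exact this
  · rw [hk] at hf; exact hf

lemma tail_sum {a s : ℝ} (h : a < s) (hs : 0 ≤ s) : ∃ C : ℝ≥0∞, C ≠ ⊤ ∧ ∀ (f : V d → ℝ≥0∞) (A : ℝ≥0∞), BG f A a →
    ∀ R : ℝ, 0 < R → ∑' x, (if N x ≤ R then 0 else f x * ENNReal.ofReal (N x ^ (-s))) ≤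
      C * A * ENNReal.ofReal (R ^ (a - s)) := by
  refine ⟨_, geom_fin ((2:ℝ) ^ a) (q := (2:ℝ) ^ (a - s)) (by positivity)
    (Real.rpow_lt_one_of_one_lt_of_neg one_lt_two (by linarith)), fun f A hf R hR => ?_⟩
  calc ∑' x, (if N x ≤ R then 0 else f x * ENNReal.ofReal (N x ^ (-s)))
      ≤ ∑' x, ∑' k : ℕ, (if N x ≤ 2 ^ (k + 1) * R then f x else 0) * ENNReal.ofReal ((2 ^ k * R) ^ (-s)) := by
        refine ENNReal.tsum_le_tsum fun x => ?_
        split_ifs with hx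
        · exact zero_le
        · push Not at hx
          obtain ⟨k, hk1, hk2⟩ := dyad ((one_lt_div hR).2 hx)
          rw [lt_div_iff₀ hR] at hk1
          rw [div_le_iff₀ hR] at hk2
          refine le_trans ?_ (ENNReal.le_tsum k)
          rw [if_pos hk2]
          refine mul_le_mul_right (ENNReal.ofReal_le_ofReal ?_) _
          exact Real.rpow_le_rpow_of_nonpos (by positivity) hk1.le (by linarith)
    _ = ∑' k : ℕ, bs f (2 ^ (k + 1) * R) * ENNReal.ofReal ((2 ^ k * R) ^ (-s)) := by
        rw [ENNReal.tsum_comm]; simp_rw [ENNReal.tsum_mul_right]; rfl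
    _ ≤ ∑' k : ℕ, ENNReal.ofReal ((2:ℝ) ^ a * ((2:ℝ) ^ (a - s)) ^ k) * (A * ENNReal.ofReal (R ^ (a - s))) := by
        refine ENNReal.tsum_le_tsum fun k => ?_
        refine (mul_le_mul_left (hf _ (by positivity)) _).trans (le_of_eq ?_)
        have e : ((2:ℝ) ^ (k + 1) * R) ^ a * (2 ^ k * R) ^ (-s) = ((2:ℝ) ^ a * ((2:ℝ) ^ (a - s)) ^ k) * R ^ (a - s) := by
          rw [Real.mul_rpow (by positivity) hR.le, Real.mul_rpow (by positivity) hR.le, pow_succ,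
            Real.mul_rpow (by positivity) (by norm_num), ← Real.rpow_natCast, ← Real.rpow_natCast,
            ← Real.rpow_mul (by norm_num), ← Real.rpow_mul (by norm_num), ← Real.rpow_mul (by norm_num),
            show R ^ (a - s) = R ^ a * R ^ (-s) by rw [← Real.rpow_add hR]; rfl,
            show (a - s) * (k:ℝ) = k * a + k * (-s) by ring, Real.rpow_add (by norm_num)]
          ring
        rw [mul_assoc, ← ENNReal.ofReal_mul (by positivity), e, ENNReal.ofReal_mul (by positivity)]
        ring
    _ = _ := by rw [ENNReal.tsum_mul_right, mul_assoc]

lemma head_sum {a s : ℝ} (h : s < a) (hs : 0 ≤ s) : ∃ C : ℝ≥0∞, C ≠ ⊤ ∧ ∀ (f : V d → ℝ≥0∞) (A : ℝ≥0∞), BG f A a →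
    ∀ R : ℝ, 0 < R → ∑' x, (if N x ≤ R then f x * ENNReal.ofReal (N x ^ (-s)) else 0) ≤
      C * A * ENNReal.ofReal (R ^ (a - s)) := by
  refine ⟨_, geom_fin ((2:ℝ) ^ s) (q := (2:ℝ) ^ (s - a)) (by positivity)
    (Real.rpow_lt_one_of_one_lt_of_neg one_lt_two (by linarith)), fun f A hf R hR => ?_⟩
  calc ∑' x, (if N x ≤ R then f x * ENNReal.ofReal (N x ^ (-s)) else 0)
      ≤ ∑' x, ∑' k : ℕ, (if N x ≤ R / 2 ^ k then f x else 0) * ENNReal.ofReal ((R / 2 ^ (k + 1)) ^ (-s)) := by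
        refine ENNReal.tsum_le_tsum fun x => ?_
        split_ifs with hx
        · have hN := N_pos x
          obtain ⟨k, hk1, hk2⟩ : ∃ k : ℕ, N x ≤ R / 2 ^ k ∧ R / 2 ^ (k + 1) ≤ N x := by
            rcases hx.eq_or_lt with h | h
            · refine ⟨0, by simp [h], ?_⟩
              rw [h]; simp; linarith
            · obtain ⟨k, hk1, hk2⟩ := dyad ((one_lt_div hN).2 h)
              rw [lt_div_iff₀ hN] at hk1
              rw [div_le_iff₀ hN] at hk2
              exact ⟨k, by rw [le_div_iff₀ (by positivity)]; linarith, by rw [div_le_iff₀ (by positivity)]; linarith⟩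
          refine le_trans ?_ (ENNReal.le_tsum k)
          rw [if_pos hk1]
          refine mul_le_mul_right (ENNReal.ofReal_le_ofReal ?_) _
          exact Real.rpow_le_rpow_of_nonpos (by positivity) hk2 (by linarith)
        · exact zero_le
    _ = ∑' k : ℕ, bs f (R / 2 ^ k) * ENNReal.ofReal ((R / 2 ^ (k + 1)) ^ (-s)) := by
        rw [ENNReal.tsum_comm]; simp_rw [ENNReal.tsum_mul_right]; rfl
    _ ≤ ∑' k : ℕ, ENNReal.ofReal ((2:ℝ) ^ s * ((2:ℝ) ^ (s - a)) ^ k) * (A * ENNReal.ofReal (R ^ (a - s))) := by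
        refine ENNReal.tsum_le_tsum fun k => ?_
        refine (mul_le_mul_left (hf _ (by positivity)) _).trans (le_of_eq ?_)
        have e : (R / 2 ^ k) ^ a * (R / 2 ^ (k + 1)) ^ (-s) = ((2:ℝ) ^ s * ((2:ℝ) ^ (s - a)) ^ k) * R ^ (a - s) := by
          rw [div_eq_mul_inv, div_eq_mul_inv, Real.mul_rpow hR.le (by positivity), Real.mul_rpow hR.le (by positivity), pow_succ, mul_inv,
            Real.mul_rpow (by positivity) (by norm_num), ← Real.rpow_natCast, ← Real.rpow_natCast,
            ← Real.rpow_neg (by norm_num), ← Real.rpow_neg_one 2, ← Real.rpow_mul (by norm_num),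
            ← Real.rpow_mul (by norm_num), ← Real.rpow_mul (by norm_num), ← Real.rpow_mul (by norm_num),
            show R ^ (a - s) = R ^ a * R ^ (-s) by rw [← Real.rpow_add hR]; rfl,
            show (s - a) * (k:ℝ) = -k * a + -k * (-s) by ring, Real.rpow_add (by norm_num)]
          ring_nf
        rw [mul_assoc, ← ENNReal.ofReal_mul (by positivity), e, ENNReal.ofReal_mul (by positivity)]
        ring
    _ = _ := by rw [ENNReal.tsum_mul_right, mul_assoc]

lemma pick {K η : ℝ≥0∞} (hK : K ≠ ⊤) (hη : η ≠ 0) {s : ℝ} (hs : 0 < s) :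
    ∃ M : ℕ, 1 ≤ M ∧ K * ENNReal.ofReal ((M:ℝ) ^ (-s)) ≤ η := by
  have h1 : Filter.Tendsto (fun M : ℕ => (M:ℝ) ^ (-s)) Filter.atTop (nhds 0) :=
    (tendsto_rpow_neg_atTop hs).comp (tendsto_natCast_atTop_atTop (R := ℝ))
  have h2 := ENNReal.Tendsto.const_mul (ENNReal.tendsto_ofReal h1) (Or.inr hK)
  rw [ENNReal.ofReal_zero, mul_zero] at h2
  obtain ⟨M, hM1, hM2⟩ := ((h2.eventually (ge_mem_nhds (pos_iff_ne_zero.2 hη))).and (Filter.eventually_ge_atTop 1)).exists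
  exact ⟨M, hM2, hM1⟩

end M8

section M9
open Classical
set_option linter.unusedSectionVars false
variable {d : ℕ}

/-- averaged jump kernel -/
noncomputable def kr (α : ℝ) (r : ℕ) (e : V d) : ℝ≥0∞ := ENNReal.ofReal (N e ^ (-((d:ℝ) + α)) * min 1 (N e / r))

/-- averaged Simon–Lieb inequality -/
def SL (T : V d → ℝ≥0∞) (α : ℝ) (A : ℝ≥0∞) : Prop := ∀ r : ℕ, 1 ≤ r → ∃ G : V d → ℝ≥0∞,
  (∀ x, 2 * r < normInf x → G x = 0) ∧ ∑' x, G x ≤ A * ENNReal.ofReal ((r:ℝ) ^ α) ∧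
  ∀ x, T x ≤ G x + A * ∑' a, G a * ∑' e, kr α r e * T (x - (a + e))

lemma short_sum {α : ℝ} (hd : 1 ≤ d) (h0 : 0 < α) (h1 : α < 1) : ∃ C : ℝ≥0∞, C ≠ ⊤ ∧ ∀ r : ℕ, 1 ≤ r → ∀ ρ : ℝ, 0 < ρ →
    bs (kr (d := d) α r) ρ ≤ C * ENNReal.ofReal (ρ ^ (1 - α) / r) := by
  have hd' : (1:ℝ) ≤ d := by exact_mod_cast hd
  obtain ⟨C, hC, h⟩ := head_sum (d := d) (a := d) (s := d + α - 1) (by linarith) (by linarith)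
  refine ⟨C * ENNReal.ofReal (3 ^ d), ENNReal.mul_ne_top hC ENNReal.ofReal_ne_top, fun r hr ρ hρ => ?_⟩
  have hr' : (0:ℝ) < r := by exact_mod_cast hr
  calc bs (kr (d := d) α r) ρ ≤ ∑' x : V d, (if N x ≤ ρ then 1 * ENNReal.ofReal (N x ^ (-((d:ℝ) + α - 1))) else 0) * ENNReal.ofReal (1 / r) := by
        refine ENNReal.tsum_le_tsum fun x => ?_
        split_ifs
        · rw [one_mul, ← ENNReal.ofReal_mul (Real.rpow_nonneg (N_pos x).le _)]
          refine ENNReal.ofReal_le_ofReal ?_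
          have : N x ^ (-((d:ℝ) + α - 1)) = N x ^ (-((d:ℝ) + α)) * N x := by
            rw [← Real.rpow_add_one (N_pos x).ne']; congr 1; ring
          rw [this, mul_assoc]
          refine mul_le_mul_of_nonneg_left ((min_le_right _ _).trans (le_of_eq ?_)) (Real.rpow_nonneg (N_pos x).le _)
          ring
        · simp
    _ ≤ _ := by
        rw [ENNReal.tsum_mul_right]
        refine (mul_le_mul_left (h _ _ BG_one ρ hρ) _).trans (le_of_eq ?_)
        rw [mul_assoc, ← ENNReal.ofReal_mul (by positivity)]
        congr 2
        rw [mul_one_div]; congr 2; ring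

lemma long_sum {α : ℝ} (hd : 1 ≤ d) (h0 : 0 < α) : ∃ C : ℝ≥0∞, C ≠ ⊤ ∧ ∀ (f : V d → ℝ≥0∞) (b : ℝ≥0∞), BG f b α → 
    ∀ r : ℕ, ∀ ρ : ℝ, 0 < ρ → ∑' e, (if N e ≤ ρ then 0 else kr α r e * f e) ≤ C * b * ENNReal.ofReal (ρ ^ (-(d:ℝ))) := by
  have hd' : (1:ℝ) ≤ d := by exact_mod_cast hd
  obtain ⟨C, hC, h⟩ := tail_sum (d := d) (a := α) (s := d + α) (by linarith) (by linarith)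
  refine ⟨C, hC, fun f b hf r ρ hρ => ?_⟩
  have := h f b hf ρ hρ
  rw [show α - (d + α) = -(d:ℝ) by ring] at this
  refine this.trans' (ENNReal.tsum_le_tsum fun x => ?_)
  split_ifs
  · exact le_rfl
  · rw [mul_comm]
    refine mul_le_mul_right (ENNReal.ofReal_le_ofReal ?_) _
    exact mul_le_of_le_one_right (Real.rpow_nonneg (N_pos x).le _) (min_le_left _ _)

lemma jump_split (k G F : V d → ℝ≥0∞) (ρ : ℝ) (Fs Fl : ℝ≥0∞)
    (hs : ∀ a, G a ≠ 0 → ∀ e, N e ≤ ρ → F (a + e) ≤ Fs)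
    (hl : ∀ a, ∑' e, (if N e ≤ ρ then 0 else k e * F (a + e)) ≤ Fl) :
    ∑' a, G a * ∑' e, k e * F (a + e) ≤ (∑' a, G a) * (bs k ρ * Fs + Fl) := by
  rw [← ENNReal.tsum_mul_right]
  refine ENNReal.tsum_le_tsum fun a => ?_
  by_cases hG : G a = 0
  · simp [hG]
  refine mul_le_mul_right ?_ _
  calc ∑' e, k e * F (a + e) = ∑' e, ((if N e ≤ ρ then k e * F (a + e) else 0) + (if N e ≤ ρ then 0 else k e * F (a + e))) := by
        refine tsum_congr fun e => ?_
        split_ifs <;> simp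
    _ ≤ _ := by
        rw [ENNReal.tsum_add]
        refine add_le_add ?_ (hl a)
        unfold bs
        rw [← ENNReal.tsum_mul_right]
        refine ENNReal.tsum_le_tsum fun e => ?_
        split_ifs with h
        · exact mul_le_mul_right (hs a hG e h) _
        · simp

lemma tsum_add_left (T : V d → ℝ≥0∞) (v : V d) : ∑' x, T (v + x) = ∑' x, T x :=
  (Equiv.addLeft v).tsum_eq T

lemma half_absorb {b K : ℝ≥0∞} (hb : b ≠ ⊤) (h : b ≤ K + b / 2) : b ≤ 2 * K := by
  have h2 : b / 2 ≤ K := by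
    have : b / 2 + b / 2 ≤ K + b / 2 := by rwa [ENNReal.add_halves]
    exact (ENNReal.add_le_add_iff_right (ENNReal.div_lt_top hb (by simp)).ne).1 this
  calc b = b / 2 + b / 2 := (ENNReal.add_halves b).symm
    _ ≤ K + K := add_le_add h2 h2
    _ = 2 * K := by ring

lemma quarters (b : ℝ≥0∞) : 1 / 4 * b + 1 / 4 * b = b / 2 := by
  rw [← add_mul, ENNReal.div_add_div_same]
  have : (1 + 1 : ℝ≥0∞) / 4 = 2⁻¹ := by
    rw [one_add_one_eq_two, show (4:ℝ≥0∞) = 2 * 2 by norm_num, ENNReal.div_eq_inv_mul, ENNReal.mul_inv (by simp) (by simp),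
      mul_assoc, ENNReal.inv_mul_cancel (by simp) (by simp), mul_one]
  rw [this, mul_comm]; rfl

lemma ball_bound {α : ℝ} (hd : 1 ≤ d) (h0 : 0 < α) (h1 : α < 1) {A : ℝ≥0∞} (hA : A ≠ ⊤) :
    ∃ B : ℝ≥0∞, B ≠ ⊤ ∧ ∀ T : V d → ℝ≥0∞, (∀ x, T (-x) = T x) → ∑' x, T x < ⊤ → SL T α A →
      ∀ v, BG (fun x => T (v + x)) B α := by
  have hd' : (1:ℝ) ≤ d := by exact_mod_cast hd
  obtain ⟨C1, hC1, hshort⟩ := short_sum (d := d) hd h0 h1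
  obtain ⟨C2, hC2, hlong⟩ := long_sum (d := d) hd h0
  obtain ⟨M, hM1, hM⟩ := pick (K := A * A * C1) (η := 1 / 4) (s := 1 - α)
    (ENNReal.mul_ne_top (ENNReal.mul_ne_top hA hA) hC1) (by simp) (by linarith)
  obtain ⟨L, hL1, hL⟩ := pick (K := A * A * C2 * ENNReal.ofReal ((M:ℝ) ^ d * 3 ^ d)) (η := 1 / 4) (s := d - α)
    (ENNReal.mul_ne_top (ENNReal.mul_ne_top (ENNReal.mul_ne_top hA hA) hC2) ENNReal.ofReal_ne_top) (by simp) (by linarith)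
  have hMp : (0:ℝ) < M := by exact_mod_cast hM1
  have hLp : (0:ℝ) < L := by exact_mod_cast hL1
  refine ⟨2 * (A * ENNReal.ofReal ((L:ℝ) ^ α)), ENNReal.mul_ne_top (by simp) (ENNReal.mul_ne_top hA ENNReal.ofReal_ne_top),
    fun T hsym hX hSL => ?_⟩
  set b : ℝ≥0∞ := ⨆ (n : ℕ) (v : V d), (∑ x ∈ Lm d (n + 1), T (v + x)) * ENNReal.ofReal (((n + 1 : ℕ) : ℝ) ^ (-α)) with hb
  have hbX : b ≤ ∑' x, T x := by
    refine iSup_le fun n => iSup_le fun v => ?_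
    calc _ ≤ (∑' x, T (v + x)) * 1 := by
          refine mul_le_mul' (ENNReal.sum_le_tsum _) ?_
          rw [← ENNReal.ofReal_one]
          refine ENNReal.ofReal_le_ofReal (Real.rpow_le_one_of_one_le_of_nonpos ?_ (by linarith))
          push_cast; have : (0:ℝ) ≤ n := by positivity
          linarith
      _ = _ := by rw [mul_one, tsum_add_left]
  have hbtop : b ≠ ⊤ := (hbX.trans_lt hX).ne
  have hbn : ∀ n : ℕ, 1 ≤ n → ∀ v, ∑ x ∈ Lm d n, T (v + x) ≤ b * ENNReal.ofReal ((n:ℝ) ^ α) := by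
    intro n hn v
    obtain ⟨m, rfl⟩ : ∃ m, n = m + 1 := ⟨n - 1, by omega⟩
    have hnp : (0:ℝ) < ((m + 1 : ℕ):ℝ) := by exact_mod_cast hn
    calc ∑ x ∈ Lm d (m + 1), T (v + x) = (∑ x ∈ Lm d (m + 1), T (v + x)) * ENNReal.ofReal (((m + 1 : ℕ) : ℝ) ^ (-α)) * ENNReal.ofReal (((m+1:ℕ):ℝ) ^ α) := by
          rw [mul_assoc, ← ENNReal.ofReal_mul (by positivity), ← Real.rpow_add hnp]; simp
      _ ≤ _ := mul_le_mul_left (le_iSup₂ (f := fun (n : ℕ) (v : V d) => (∑ x ∈ Lm d (n + 1), T (v + x)) * ENNReal.ofReal (((n + 1 : ℕ) : ℝ) ^ (-α))) m v) _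
  have hBG : ∀ v, BG (fun x => T (v + x)) b α := fun v => BG_of h0.le fun n hn => hbn n hn v
  have hkey : b ≤ A * ENNReal.ofReal ((L:ℝ) ^ α) + b / 2 := by
    refine iSup_le fun m => iSup_le fun v => ?_
    have hn : 1 ≤ m + 1 := by omega
    generalize m + 1 = n at hn
    have hnp : (0:ℝ) < n := by exact_mod_cast hn
    have hn1 : (1:ℝ) ≤ n := by exact_mod_cast hn
    suffices hs : ∑ x ∈ Lm d n, T (v + x) ≤ (A * ENNReal.ofReal ((L:ℝ) ^ α) + b / 2) * ENNReal.ofReal ((n:ℝ) ^ α) by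
      refine (mul_le_mul_left hs _).trans (le_of_eq ?_)
      rw [mul_assoc, ← ENNReal.ofReal_mul (by positivity), ← Real.rpow_add hnp]; simp
    obtain ⟨G, _, hG2, hG3⟩ := hSL (L * n) (Nat.mul_pos hL1 hn)
    set r := L * n with hr
    have hrp : (0:ℝ) < r := by rw [hr]; push_cast; positivity
    set ρ := (r:ℝ) / M with hρ
    have hρp : 0 < ρ := by positivity
    calc ∑ x ∈ Lm d n, T (v + x) ≤ ∑ x ∈ Lm d n, (G (v + x) + A * ∑' a, G a * ∑' e, kr α r e * T (v + x - (a + e))) :=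
          Finset.sum_le_sum fun x _ => hG3 _
      _ = ∑ x ∈ Lm d n, G (v + x) + A * ∑' a, G a * ∑' e, kr α r e * ∑ x ∈ Lm d n, T (v + x - (a + e)) := by
          rw [Finset.sum_add_distrib, ← Finset.mul_sum]
          congr 2
          rw [← Summable.tsum_finsetSum fun _ _ => ENNReal.summable]
          refine tsum_congr fun a => ?_
          rw [← Finset.mul_sum, ← Summable.tsum_finsetSum fun _ _ => ENNReal.summable]
          congr 1
          refine tsum_congr fun e => ?_
          rw [Finset.mul_sum]
      _ ≤ A * ENNReal.ofReal ((r:ℝ) ^ α) + A * ((A * ENNReal.ofReal ((r:ℝ) ^ α)) * ((C1 * ENNReal.ofReal (ρ ^ (1 - α) / r)) * (b * ENNReal.ofReal ((n:ℝ) ^ α))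
            + ENNReal.ofReal ((3 * n) ^ d) * (C2 * b * ENNReal.ofReal (ρ ^ (-(d:ℝ)))))) := by
          refine add_le_add ?_ (mul_le_mul_right ?_ _)
          · refine hG2.trans' ?_
            rw [← tsum_add_left G v]; exact ENNReal.sum_le_tsum _
          · refine (jump_split (kr α r) G (fun y => ∑ x ∈ Lm d n, T (v + x - y)) ρ (b * ENNReal.ofReal ((n:ℝ) ^ α))
              (ENNReal.ofReal ((3 * n) ^ d) * (C2 * b * ENNReal.ofReal (ρ ^ (-(d:ℝ))))) ?_ ?_).trans ?_
            · intro a _ e _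
              refine (hbn n hn (v - (a + e))).trans' (le_of_eq ?_)
              refine Finset.sum_congr rfl fun x _ => ?_
              congr 1; abel
            · intro a
              calc _ = ∑' e, ∑ x ∈ Lm d n, (if N e ≤ ρ then 0 else kr α r e * T ((a - (v + x)) + e)) := by
                    refine tsum_congr fun e => ?_
                    split_ifs
                    · simp
                    · rw [Finset.mul_sum]
                      refine Finset.sum_congr rfl fun x _ => ?_
                      rw [← hsym]; congr 2; abel
                _ = ∑ x ∈ Lm d n, ∑' e, (if N e ≤ ρ then 0 else kr α r e * T ((a - (v + x)) + e)) :=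
                    Summable.tsum_finsetSum fun _ _ => ENNReal.summable
                _ ≤ ∑ x ∈ Lm d n, (C2 * b * ENNReal.ofReal (ρ ^ (-(d:ℝ)))) :=
                    Finset.sum_le_sum fun x _ => hlong _ b (hBG _) r ρ hρp
                _ ≤ _ := by
                    rw [Finset.sum_const, nsmul_eq_mul, card_Lm, ← ENNReal.ofReal_natCast]
                    refine mul_le_mul_left (ENNReal.ofReal_le_ofReal ?_) _
                    push_cast; gcongr; linarith
            · exact mul_le_mul' hG2 (add_le_add (mul_le_mul_left (hshort r (Nat.mul_pos hL1 hn) ρ hρp) _) le_rfl)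
      _ = A * ENNReal.ofReal ((L:ℝ) ^ α) * ENNReal.ofReal ((n:ℝ) ^ α) + 
          ((A * A * C1 * ENNReal.ofReal ((M:ℝ) ^ (-(1 - α)))) * b + (A * A * C2 * ENNReal.ofReal ((M:ℝ) ^ d * 3 ^ d) * ENNReal.ofReal ((L:ℝ) ^ (-(d - α)))) * b) * ENNReal.ofReal ((n:ℝ) ^ α) := by
          have e1 : ENNReal.ofReal ((r:ℝ) ^ α) = ENNReal.ofReal ((L:ℝ) ^ α) * ENNReal.ofReal ((n:ℝ) ^ α) := by
            rw [← ENNReal.ofReal_mul (by positivity), hr]; push_cast; rw [Real.mul_rpow hLp.le hnp.le]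
          have e2 : ENNReal.ofReal ((r:ℝ) ^ α) * ENNReal.ofReal (ρ ^ (1 - α) / r) = ENNReal.ofReal ((M:ℝ) ^ (-(1 - α))) := by
            rw [← ENNReal.ofReal_mul (by positivity), hρ, Real.div_rpow hrp.le hMp.le, Real.rpow_neg hMp.le]
            congr 1
            have : (r:ℝ) ^ α * (r:ℝ) ^ (1 - α) = r := by rw [← Real.rpow_add hrp]; simp
            field_simp
            linarith
          have e3 : ENNReal.ofReal ((r:ℝ) ^ α) * ENNReal.ofReal ((3 * n) ^ d) * ENNReal.ofReal (ρ ^ (-(d:ℝ))) =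
              ENNReal.ofReal ((M:ℝ) ^ d * 3 ^ d) * ENNReal.ofReal ((L:ℝ) ^ (-(d - α))) * ENNReal.ofReal ((n:ℝ) ^ α) := by
            rw [← ENNReal.ofReal_mul (by positivity), ← ENNReal.ofReal_mul (by positivity), ← ENNReal.ofReal_mul (by positivity),
              ← ENNReal.ofReal_mul (by positivity)]
            congr 1
            rw [hρ, Real.rpow_neg (by positivity), Real.rpow_natCast, hr, show -((d:ℝ) - α) = α - d by ring, Real.rpow_sub hLp, Real.rpow_natCast]
            push_cast
            rw [Real.mul_rpow hLp.le hnp.le, div_pow, mul_pow, mul_pow]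
            field_simp
          rw [mul_add, mul_add]
          have f1 : A * (A * ENNReal.ofReal ((r:ℝ) ^ α) * (C1 * ENNReal.ofReal (ρ ^ (1 - α) / r) * (b * ENNReal.ofReal ((n:ℝ) ^ α))))
            = A * A * C1 * (ENNReal.ofReal ((r:ℝ) ^ α) * ENNReal.ofReal (ρ ^ (1 - α) / r)) * b * ENNReal.ofReal ((n:ℝ) ^ α) := by ring
          have f2 : A * (A * ENNReal.ofReal ((r:ℝ) ^ α) * (ENNReal.ofReal ((3 * n) ^ d) * (C2 * b * ENNReal.ofReal (ρ ^ (-(d:ℝ))))))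
            = A * A * C2 * (ENNReal.ofReal ((r:ℝ) ^ α) * ENNReal.ofReal ((3 * n) ^ d) * ENNReal.ofReal (ρ ^ (-(d:ℝ)))) * b := by ring
          rw [f1, f2, e2, e3, e1]; ring
      _ ≤ A * ENNReal.ofReal ((L:ℝ) ^ α) * ENNReal.ofReal ((n:ℝ) ^ α) + (1 / 4 * b + 1 / 4 * b) * ENNReal.ofReal ((n:ℝ) ^ α) := by
          gcongr
      _ = _ := by rw [quarters]; ring
  have hfin := half_absorb hbtop hkey
  intro v R hR
  exact (hBG v R hR).trans (mul_le_mul_left hfin _)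

end M9

section M10
open Classical
set_option linter.unusedSectionVars false
variable {d : ℕ}

lemma pointwise {α : ℝ} (hd : 1 ≤ d) (h0 : 0 < α) (h1 : α < 1) {A : ℝ≥0∞} (hA : A ≠ ⊤) :
    ∃ D : ℝ≥0∞, D ≠ ⊤ ∧ ∀ T : V d → ℝ≥0∞, (∀ x, T x ≤ 1) → (∀ x, T (-x) = T x) → ∑' x, T x < ⊤ → SL T α A →
      ∀ x, T x ≤ D * ENNReal.ofReal (N x ^ (-((d:ℝ) - α))) := by
  have hd' : (1:ℝ) ≤ d := by exact_mod_cast hd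
  obtain ⟨B, hB, hball⟩ := ball_bound (d := d) hd h0 h1 hA
  obtain ⟨C1, hC1, hshort⟩ := short_sum (d := d) hd h0 h1
  obtain ⟨C2, hC2, hlong⟩ := long_sum (d := d) hd h0
  have hs : 0 < (d:ℝ) - α := by linarith
  obtain ⟨M, hM1, hM⟩ := pick (K := A * A * C1) (η := ENNReal.ofReal (2 ^ (-((d:ℝ) - α)) / 2)) (s := 1 - α)
    (ENNReal.mul_ne_top (ENNReal.mul_ne_top hA hA) hC1) (by simp; positivity) (by linarith)
  have hMp : (0:ℝ) < M := by exact_mod_cast hM1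
  set K := A * A * C2 * B * ENNReal.ofReal ((M:ℝ) ^ d * 8 ^ ((d:ℝ) - α)) with hK
  have hKtop : K ≠ ⊤ := ENNReal.mul_ne_top (ENNReal.mul_ne_top (ENNReal.mul_ne_top (ENNReal.mul_ne_top hA hA) hC2) hB) ENNReal.ofReal_ne_top
  set D0 := 2 * K + ENNReal.ofReal (4 ^ ((d:ℝ) - α)) with hD0
  have hD0top : D0 ≠ ⊤ := ENNReal.add_ne_top.2 ⟨ENNReal.mul_ne_top (by simp) hKtop, ENNReal.ofReal_ne_top⟩
  refine ⟨D0 * ENNReal.ofReal (2 ^ ((d:ℝ) - α)), ENNReal.mul_ne_top hD0top ENNReal.ofReal_ne_top, fun T hT1 hsym hX hSL => ?_⟩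
  have hBG := hball T hsym hX hSL
  have claim : ∀ k : ℕ, ∀ x : V d, 2 ^ k ≤ normInf x → T x ≤ D0 * ENNReal.ofReal (((2:ℝ) ^ k) ^ (-((d:ℝ) - α))) := by
    intro k
    induction k with
    | zero =>
      intro x _
      refine (hT1 x).trans ?_
      rw [pow_zero, Real.one_rpow, ENNReal.ofReal_one, mul_one, hD0]
      refine le_add_left ?_
      rw [← ENNReal.ofReal_one]
      exact ENNReal.ofReal_le_ofReal (Real.one_le_rpow (by norm_num) hs.le)
    | succ k ih =>
      intro x hx
      by_cases hk : k < 2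
      · refine (hT1 x).trans ?_
        refine (mul_le_mul_left (le_add_left le_rfl : ENNReal.ofReal (4 ^ ((d:ℝ) - α)) ≤ D0) _).trans' ?_
        rw [← ENNReal.ofReal_mul (by positivity), ← ENNReal.ofReal_one]
        refine ENNReal.ofReal_le_ofReal ?_
        have h4 : ((2:ℝ) ^ (k+1)) ≤ 4 := by
          interval_cases k <;> norm_num
        rw [Real.rpow_neg (by positivity), ← div_eq_mul_inv, one_le_div (by positivity)]
        exact Real.rpow_le_rpow (by positivity) h4 hs.le
      · obtain ⟨j, rfl⟩ : ∃ j, k = j + 2 := ⟨k - 2, by omega⟩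
        set r := 2 ^ j with hr
        have hr1 : 1 ≤ r := Nat.one_le_two_pow
        have hrp : (0:ℝ) < r := by exact_mod_cast hr1
        have hxr : 8 * r ≤ normInf x := by rw [hr]; rw [pow_add, pow_add] at hx; omega
        obtain ⟨G, hG1, hG2, hG3⟩ := hSL r hr1
        set ρ := (r:ℝ) / M with hρ
        have hρp : 0 < ρ := by positivity
        have hρr : ρ ≤ r := div_le_self hrp.le (by exact_mod_cast hM1)
        set Y := ENNReal.ofReal (((2:ℝ) ^ (j + 2 + 1)) ^ (-((d:ℝ) - α))) with hY
        have hG0 : G x = 0 := hG1 x (by omega)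
        have e8 : ((2:ℝ) ^ (j + 2 + 1)) = 8 * r := by rw [hr]; push_cast; ring
        have e4 : ((2:ℝ) ^ (j + 2)) = (8 * r) / 2 := by rw [hr]; push_cast; ring
        calc T x ≤ G x + A * ∑' a, G a * ∑' e, kr α r e * T (x - (a + e)) := hG3 x
          _ ≤ 0 + A * ((A * ENNReal.ofReal ((r:ℝ) ^ α)) * ((C1 * ENNReal.ofReal (ρ ^ (1 - α) / r)) * (D0 * ENNReal.ofReal (((2:ℝ) ^ (j+2)) ^ (-((d:ℝ) - α))))
                + C2 * B * ENNReal.ofReal (ρ ^ (-(d:ℝ))))) := by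
              rw [hG0]
              refine add_le_add le_rfl (mul_le_mul_right ?_ _)
              refine (jump_split (kr α r) G (fun y => T (x - y)) ρ (D0 * ENNReal.ofReal (((2:ℝ) ^ (j+2)) ^ (-((d:ℝ) - α))))
                (C2 * B * ENNReal.ofReal (ρ ^ (-(d:ℝ)))) ?_ ?_).trans ?_
              · intro a ha e he
                refine ih _ ?_
                have h2a : normInf a ≤ 2 * r := by
                  by_contra h; exact ha (hG1 a (by omega))
                have h2e : normInf e ≤ r := by
                  have := (normInf_le_N e).trans (he.trans hρr)
                  exact_mod_cast this
                have h3 : normInf x ≤ normInf (x - (a + e)) + (normInf a + normInf e) := by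
                  have := normInf_add (x - (a+e)) (a + e)
                  have h' := normInf_add a e
                  rw [sub_add_cancel] at this
                  omega
                have : 2 ^ (j + 2) = 4 * r := by rw [hr]; ring
                omega
              · intro a
                refine (hlong _ B (hBG (a - x)) r ρ hρp).trans' (le_of_eq ?_)
                refine tsum_congr fun e => ?_
                split_ifs
                · rfl
                · rw [← hsym]; congr 2; abel
              · exact mul_le_mul' hG2 (add_le_add (mul_le_mul_left (hshort r hr1 ρ hρp) _) le_rfl)
          _ = (A * A * C1 * ENNReal.ofReal ((M:ℝ) ^ (-(1 - α)))) * (D0 * ENNReal.ofReal (((2:ℝ) ^ (j+2)) ^ (-((d:ℝ) - α)))) + K * Y := by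
              have e2 : ENNReal.ofReal ((r:ℝ) ^ α) * ENNReal.ofReal (ρ ^ (1 - α) / r) = ENNReal.ofReal ((M:ℝ) ^ (-(1 - α))) := by
                rw [← ENNReal.ofReal_mul (by positivity), hρ, Real.div_rpow hrp.le hMp.le, Real.rpow_neg hMp.le]
                congr 1
                have : (r:ℝ) ^ α * (r:ℝ) ^ (1 - α) = r := by rw [← Real.rpow_add hrp]; simp
                field_simp
                linarith
              have e3 : ENNReal.ofReal ((r:ℝ) ^ α) * ENNReal.ofReal (ρ ^ (-(d:ℝ))) =
                  ENNReal.ofReal ((M:ℝ) ^ d * 8 ^ ((d:ℝ) - α)) * Y := by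
                rw [← ENNReal.ofReal_mul (by positivity), hY, ← ENNReal.ofReal_mul (by positivity)]
                congr 1
                rw [e8, hρ, Real.rpow_neg (by positivity), Real.rpow_natCast, Real.mul_rpow (by norm_num) hrp.le,
                  Real.rpow_neg (by norm_num : (0:ℝ) ≤ 8), Real.rpow_neg hrp.le, Real.rpow_sub hrp, Real.rpow_natCast, div_pow]
                have := (Real.rpow_pos_of_pos (by norm_num : (0:ℝ) < 8) ((d:ℝ) - α)).ne'
                field_simp
              have f1 : A * (A * ENNReal.ofReal ((r:ℝ) ^ α) * (C1 * ENNReal.ofReal (ρ ^ (1 - α) / r) * (D0 * ENNReal.ofReal (((2:ℝ) ^ (j+2)) ^ (-((d:ℝ) - α))))))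
                = A * A * C1 * (ENNReal.ofReal ((r:ℝ) ^ α) * ENNReal.ofReal (ρ ^ (1 - α) / r)) * (D0 * ENNReal.ofReal (((2:ℝ) ^ (j+2)) ^ (-((d:ℝ) - α)))) := by ring
              have f2 : A * (A * ENNReal.ofReal ((r:ℝ) ^ α) * (C2 * B * ENNReal.ofReal (ρ ^ (-(d:ℝ)))))
                = A * A * C2 * B * (ENNReal.ofReal ((r:ℝ) ^ α) * ENNReal.ofReal (ρ ^ (-(d:ℝ)))) := by ring
              rw [zero_add, mul_add, mul_add, f1, f2, e2, e3, hK]; ring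
          _ ≤ ENNReal.ofReal (2 ^ (-((d:ℝ) - α)) / 2) * (D0 * ENNReal.ofReal (((2:ℝ) ^ (j+2)) ^ (-((d:ℝ) - α)))) + K * Y :=
              add_le_add (mul_le_mul_left hM _) le_rfl
          _ = (ENNReal.ofReal (1/2) * D0 + K) * Y := by
              have e5 : ENNReal.ofReal (2 ^ (-((d:ℝ) - α)) / 2) * ENNReal.ofReal (((2:ℝ) ^ (j+2)) ^ (-((d:ℝ) - α))) = ENNReal.ofReal (1/2) * Y := by
                rw [← ENNReal.ofReal_mul (by positivity), hY, ← ENNReal.ofReal_mul (by positivity)]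
                congr 1
                rw [show (2:ℝ) ^ (j + 2 + 1) = 2 * 2 ^ (j+2) by ring, Real.mul_rpow (by norm_num) (by positivity)]
                ring
              calc _ = (ENNReal.ofReal (2 ^ (-((d:ℝ) - α)) / 2) * ENNReal.ofReal (((2:ℝ) ^ (j+2)) ^ (-((d:ℝ) - α)))) * D0 + K * Y := by ring
                _ = _ := by rw [e5]; ring
          _ ≤ _ := by
              refine mul_le_mul_left ?_ _
              have hKD : K ≤ ENNReal.ofReal (1/2) * D0 := by
                rw [hD0, mul_add, ← mul_assoc]
                refine le_add_right (le_of_eq ?_)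
                have : ENNReal.ofReal (1/2) * 2 = 1 := by
                  rw [show (2:ℝ≥0∞) = ENNReal.ofReal 2 by simp, ← ENNReal.ofReal_mul (by norm_num)]; norm_num
                rw [this, one_mul]
              calc _ ≤ ENNReal.ofReal (1/2) * D0 + ENNReal.ofReal (1/2) * D0 := add_le_add le_rfl hKD
                _ = D0 := by
                  rw [← add_mul, ← ENNReal.ofReal_add (by norm_num) (by norm_num)]; norm_num
  intro x
  have hx2 : N x ≤ 2 * 2 ^ (Nat.log 2 (normInf x)) := by
    unfold N
    refine max_le ?_ ?_
    · have : (1:ℝ) ≤ 2 ^ (Nat.log 2 (normInf x)) := one_le_pow₀ (by norm_num)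
      linarith
    · have := (Nat.lt_pow_succ_log_self (b := 2) (by norm_num) (normInf x)).le
      have h' : ((normInf x : ℕ) : ℝ) ≤ 2 ^ ((Nat.log 2 (normInf x)) + 1) := by exact_mod_cast this
      rw [pow_succ] at h'; linarith
  have hmain : T x ≤ D0 * ENNReal.ofReal (((2:ℝ) ^ (Nat.log 2 (normInf x))) ^ (-((d:ℝ) - α))) := by
    by_cases hx0 : normInf x = 0
    · rw [hx0, Nat.log_zero_right]
      refine (hT1 x).trans ?_
      rw [pow_zero, Real.one_rpow, ENNReal.ofReal_one, mul_one, hD0]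
      refine le_add_left ?_
      rw [← ENNReal.ofReal_one]
      exact ENNReal.ofReal_le_ofReal (Real.one_le_rpow (by norm_num) hs.le)
    · exact claim _ x (Nat.pow_log_le_self 2 hx0)
  refine hmain.trans ?_
  rw [mul_assoc, ← ENNReal.ofReal_mul (by positivity)]
  refine mul_le_mul_right (ENNReal.ofReal_le_ofReal ?_) _
  have hNp := N_pos x
  rw [Real.rpow_neg (by positivity), Real.rpow_neg hNp.le, ← div_eq_mul_inv, inv_eq_one_div, div_le_div_iff₀ (by positivity) (by positivity), one_mul]
  rw [← Real.mul_rpow (by positivity) (by positivity)]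
  exact Real.rpow_le_rpow hNp.le hx2 hs.le

end M10

section M11
open Classical
set_option linter.unusedSectionVars false
variable {d : ℕ}

lemma Lm_eq_sh (n : ℕ) : Lm d n = sh (Q d (2 * n + 1)) (fun _ => -(n:ℤ)) := by
  ext x
  rw [mem_sh, mem_Q, mem_Lm, normInf_le]
  refine forall_congr' fun i => ?_
  simp only [Pi.sub_apply]; rw [abs_le]; push_cast
  constructor <;> intro h <;> constructor <;> linarith [h.1, h.2]

lemma sum_tau_le {p : Sym2 (V d) → ℝ} (h0 : ∀ e, 0 ≤ p e) (h1 : ∀ e, p e ≤ 1) (hp : TI p) (hX : ∑' x, ti p 0 x ≠ ⊤)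
    (S : Finset (V d)) (x : V d) (S' : Finset (V d)) : ∑ y ∈ S', tau p S x y ≤ (∑' x, ti p 0 x).toReal := by
  rw [← ENNReal.ofReal_le_iff_le_toReal hX, ENNReal.ofReal_sum_of_nonneg fun y _ => tau_nonneg h0 h1 S x y]
  calc _ ≤ ∑ y ∈ S', ti p 0 (y - x) := Finset.sum_le_sum fun y _ => by
        rw [← ti_eq h0 h1 hp]; exact tau_le_ti h0 h1 S x y
    _ ≤ ∑' y, ti p 0 (y - x) := ENNReal.sum_le_tsum _
    _ = _ := (Equiv.subRight x).tsum_eq (ti p 0)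

lemma box_bound {α b : ℝ} (hd : 1 ≤ d) (hα : 0 < α) (hαd : α < d) (hb : 0 < b) :
    ∃ A : ℝ, 0 < A ∧ ∀ p : Sym2 (V d) → ℝ, (∀ e, 0 ≤ p e) → (∀ e, p e ≤ 1) → TI p →
    (∀ x y : V d, x ≠ y → 1 - Real.exp (-(b * (normInf (x - y) : ℝ) ^ (-(d : ℝ) - α))) ≤ p s(x, y)) →
    ∑' x, ti p 0 x ≠ ⊤ → ∀ s : ℕ, 1 ≤ s → ∑ y ∈ Lm d s, tau p (Lm d s) 0 y ≤ A * (s:ℝ) ^ α := by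
  obtain ⟨A, hA, hE⟩ := E2_bound hd hα hαd hb
  refine ⟨A * 5 ^ ((d:ℝ) + α), by positivity, fun p h0 h1 hp hlow hX s hs => ?_⟩
  have hsp : (0:ℝ) < s := by exact_mod_cast hs
  have hs1 : (1:ℝ) ≤ s := by exact_mod_cast hs
  have hEm := hE p h0 h1 hp hlow (∑' x, ti p 0 x).toReal (fun m => ?_) (2 * (2 * s) + 1) (by omega)
  · have h3 : ((s:ℝ) ^ d) * ∑ y ∈ Lm d s, tau p (Lm d s) 0 y ≤ E2 p (Lm d (2 * s)) := by
      have hnn : 0 ≤ ∑ y ∈ Lm d s, tau p (Lm d s) 0 y := Finset.sum_nonneg fun y _ => tau_nonneg h0 h1 _ _ _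
      calc _ ≤ ((Lm d s).card : ℝ) * ∑ y ∈ Lm d s, tau p (Lm d s) 0 y := by
            refine mul_le_mul_of_nonneg_right ?_ hnn
            rw [card_Lm]; push_cast
            exact pow_le_pow_left₀ hsp.le (by linarith) _
        _ = ∑ x ∈ Lm d s, ∑ y ∈ Lm d s, tau p (Lm d s) 0 y := by rw [Finset.sum_const, nsmul_eq_mul]
        _ ≤ ∑ x ∈ Lm d s, ∑ y ∈ Lm d (2 * s), tau p (Lm d (2 * s)) x y := by
            refine Finset.sum_le_sum fun x hx => ?_
            have hsub : sh (Lm d s) x ⊆ Lm d (2 * s) := fun z hz => by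
              rw [mem_sh, mem_Lm] at hz; rw [mem_Lm] at hx ⊢
              have := normInf_add (z - x) x
              rw [sub_add_cancel] at this; omega
            calc _ = ∑ y ∈ Lm d s, tau p (sh (Lm d s) x) x (y + x) := by
                  refine Finset.sum_congr rfl fun y _ => ?_
                  rw [← tau_sh hp (Lm d s) x 0 y, zero_add]
              _ = ∑ y ∈ sh (Lm d s) x, tau p (sh (Lm d s) x) x y := (sum_sh _ _ _).symm
              _ ≤ ∑ y ∈ sh (Lm d s) x, tau p (Lm d (2 * s)) x y := Finset.sum_le_sum fun y _ => tau_mono h0 h1 hsub x y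
              _ ≤ _ := Finset.sum_le_sum_of_subset_of_nonneg hsub fun y _ _ => tau_nonneg h0 h1 _ _ _
        _ ≤ _ := Finset.sum_le_sum_of_subset_of_nonneg (Lm_mono (by omega)) fun x _ _ =>
            Finset.sum_nonneg fun y _ => tau_nonneg h0 h1 _ _ _
    rw [Lm_eq_sh (2 * s), E2_sh hp] at h3
    have h4 := h3.trans hEm
    have h5 : ((2 * (2 * s) + 1 : ℕ) : ℝ) ^ ((d:ℝ) + α) ≤ 5 ^ ((d:ℝ) + α) * ((s:ℝ) ^ d * (s:ℝ) ^ α) := by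
      rw [← Real.rpow_natCast, ← Real.rpow_add hsp, ← Real.mul_rpow (by norm_num) hsp.le]
      refine Real.rpow_le_rpow (by positivity) ?_ (by positivity)
      push_cast; linarith
    have h6 : ((s:ℝ) ^ d) * ∑ y ∈ Lm d s, tau p (Lm d s) 0 y ≤ (s:ℝ) ^ d * (A * 5 ^ ((d:ℝ) + α) * (s:ℝ) ^ α) := by
      refine h4.trans ((mul_le_mul_of_nonneg_left h5 (by linarith)).trans (le_of_eq (by ring)))
    exact le_of_mul_le_mul_left h6 (by positivity)
  · calc E2 p (Q d m) ≤ ∑ x ∈ Q d m, (∑' x, ti p 0 x).toReal := Finset.sum_le_sum fun x _ => sum_tau_le h0 h1 hp hX _ _ _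
      _ = _ := by rw [Finset.sum_const, nsmul_eq_mul, card_Q]; push_cast; rfl

lemma SL_one {p : Sym2 (V d) → ℝ} (h0 : ∀ e, 0 ≤ p e) (h1 : ∀ e, p e ≤ 1) (hp : TI p) (s : ℕ) (x : V d) :
    ti p 0 x ≤ ENNReal.ofReal (tau p (Lm d s) 0 x) + ∑' a, ∑' b, (if normInf a ≤ s ∧ s < normInf b then
      ENNReal.ofReal (tau p (Lm d s) 0 a) * ENNReal.ofReal (p s(a, b)) * ti p 0 (x - b) else 0) := by
  have key : ∀ n, s ≤ n → ENNReal.ofReal (tau p (Lm d n) 0 x) ≤ ENNReal.ofReal (tau p (Lm d s) 0 x) + ∑' a, ∑' b, (if normInf a ≤ s ∧ s < normInf b then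
      ENNReal.ofReal (tau p (Lm d s) 0 a) * ENNReal.ofReal (p s(a, b)) * ti p 0 (x - b) else 0) := by
    intro n hn
    refine (ENNReal.ofReal_le_ofReal (simon_lieb h0 h1 (Lm_mono hn) (zero_mem_Lm s) x)).trans ?_
    refine ENNReal.ofReal_add_le.trans (add_le_add le_rfl ?_)
    rw [ENNReal.ofReal_sum_of_nonneg fun a _ => Finset.sum_nonneg fun b _ => mul_nonneg (mul_nonneg (tau_nonneg h0 h1 _ _ _) (h0 _)) (tau_nonneg h0 h1 _ _ _)]
    refine (ENNReal.sum_le_tsum (Lm d s)).trans' (Finset.sum_le_sum fun a ha => ?_)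
    rw [ENNReal.ofReal_sum_of_nonneg fun b _ => mul_nonneg (mul_nonneg (tau_nonneg h0 h1 _ _ _) (h0 _)) (tau_nonneg h0 h1 _ _ _)]
    refine (ENNReal.sum_le_tsum (Lm d n \ Lm d s)).trans' (Finset.sum_le_sum fun b hb => ?_)
    rw [mem_Lm] at ha
    rw [Finset.mem_sdiff, mem_Lm, mem_Lm] at hb
    rw [if_pos ⟨ha, by omega⟩, ENNReal.ofReal_mul (mul_nonneg (tau_nonneg h0 h1 _ _ _) (h0 _)), ENNReal.ofReal_mul (tau_nonneg h0 h1 _ _ _)]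
    refine mul_le_mul_right ?_ _
    rw [← ti_eq h0 h1 hp]; exact tau_le_ti h0 h1 _ _ _
  conv_lhs => unfold ti
  refine iSup_le fun n => ?_
  exact (ti_mono_n h0 h1 0 x (le_max_left n s)).trans (key _ (le_max_right n s))

lemma count_le (r : ℕ) (a e : V d) :
    (((Finset.Ioc r (2 * r)).filter (fun s => normInf a ≤ s ∧ s < normInf (a + e))).card : ℝ) ≤ min (r:ℝ) (N e) := by
  refine le_min ?_ ?_
  · have := Finset.card_filter_le (Finset.Ioc r (2 * r)) (fun s => normInf a ≤ s ∧ s < normInf (a + e))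
    rw [Nat.card_Ioc] at this
    exact_mod_cast this.trans (by omega)
  · refine (normInf_le_N e).trans' ?_
    have : ((Finset.Ioc r (2 * r)).filter (fun s => normInf a ≤ s ∧ s < normInf (a + e))) ⊆ Finset.Ico (normInf a) (normInf (a + e)) := by
      intro s hs; rw [Finset.mem_filter] at hs; rw [Finset.mem_Ico]; exact hs.2
    have h2 := Finset.card_le_card this
    rw [Nat.card_Ico] at h2
    have := normInf_add a e
    exact_mod_cast h2.trans (by omega)

lemma SL_of {p : Sym2 (V d) → ℝ} (h0 : ∀ e, 0 ≤ p e) (h1 : ∀ e, p e ≤ 1) (hp : TI p) {α K A1 : ℝ} (hα : 0 < α) (hK : 0 ≤ K) (hA1 : 0 < A1)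
    (hup : ∀ x y : V d, x ≠ y → p s(x, y) ≤ K * (normInf (x - y) : ℝ) ^ (-(d : ℝ) - α))
    (hbox : ∀ s : ℕ, 1 ≤ s → ∑ y ∈ Lm d s, tau p (Lm d s) 0 y ≤ A1 * (s:ℝ) ^ α) :
    SL (ti p 0) α (ENNReal.ofReal (A1 * 2 ^ α + K)) := by
  intro r hr
  have hrp : (0:ℝ) < r := by exact_mod_cast hr
  set G : V d → ℝ≥0∞ := fun a => ENNReal.ofReal (tau p (Lm d (2 * r)) 0 a) with hG
  have hGz : ∀ x, 2 * r < normInf x → G x = 0 := fun x hx => by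
    simp only [hG]; rw [tau_eq_zero p (zero_mem_Lm _) (by rw [mem_Lm]; omega), ENNReal.ofReal_zero]
  refine ⟨G, hGz, ?_, fun x => ?_⟩
  · rw [tsum_eq_sum (s := Lm d (2 * r)) fun x hx => hGz x (by rw [mem_Lm] at hx; omega), hG,
      ← ENNReal.ofReal_sum_of_nonneg fun y _ => tau_nonneg h0 h1 _ _ _, ← ENNReal.ofReal_mul (by positivity)]
    refine ENNReal.ofReal_le_ofReal ((hbox _ (by omega)).trans ?_)
    push_cast
    rw [Real.mul_rpow (by norm_num) hrp.le, ← mul_assoc]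
    exact mul_le_mul_of_nonneg_right (by linarith) (by positivity)
  · have step : ∀ s ∈ Finset.Ioc r (2 * r), ti p 0 x ≤ G x + ∑' a, G a * ∑' e, (if normInf a ≤ s ∧ s < normInf (a + e) then
        ENNReal.ofReal (K * N e ^ (-((d:ℝ) + α))) * ti p 0 (x - (a + e)) else 0) := by
      intro s hs
      rw [Finset.mem_Ioc] at hs
      have hsG : ∀ a, ENNReal.ofReal (tau p (Lm d s) 0 a) ≤ G a := fun a =>
        ENNReal.ofReal_le_ofReal (tau_mono h0 h1 (Lm_mono hs.2) _ _)
      refine (SL_one h0 h1 hp s x).trans (add_le_add (hsG x) (ENNReal.tsum_le_tsum fun a => ?_))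
      rw [← tsum_add_left _ a, ← ENNReal.tsum_mul_left]
      refine ENNReal.tsum_le_tsum fun e => ?_
      beta_reduce
      by_cases h : normInf a ≤ s ∧ s < normInf (a + e)
      · simp only [if_pos h]
        rw [mul_assoc]
        refine mul_le_mul' (hsG a) (mul_le_mul_left (ENNReal.ofReal_le_ofReal ?_) _)
        have he : e ≠ 0 := by rintro rfl; rw [add_zero] at h; omega
        have hne : a ≠ a + e := by simpa using he
        refine (hup a (a + e) hne).trans (le_of_eq ?_)
        have hN : N e = normInf e := by
          unfold N; rw [max_eq_right]
          have : 1 ≤ normInf e := by rw [Nat.one_le_iff_ne_zero, Ne, normInf_eq_zero]; exact he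
          exact_mod_cast this
        rw [hN, show a - (a + e) = -e by abel, normInf_neg, show -(d:ℝ) - α = -((d:ℝ) + α) by ring]
      · simp only [if_neg h]; simp
    have hsum := Finset.sum_le_sum step
    rw [Finset.sum_const, Nat.card_Ioc, Finset.sum_add_distrib, Finset.sum_const, Nat.card_Ioc,
      show 2 * r - r = r by omega, nsmul_eq_mul, nsmul_eq_mul] at hsum
    have hr0 : (r:ℝ≥0∞) ≠ 0 := by exact_mod_cast (by omega : r ≠ 0)
    have hrt : (r:ℝ≥0∞) ≠ ⊤ := ENNReal.natCast_ne_top r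
    rw [← ENNReal.mul_le_mul_iff_right hr0 hrt]
    refine hsum.trans ?_
    rw [mul_add]
    refine add_le_add le_rfl ?_
    rw [← Summable.tsum_finsetSum fun _ _ => ENNReal.summable, ← mul_assoc, ← ENNReal.tsum_mul_left]
    refine ENNReal.tsum_le_tsum fun a => ?_
    rw [← Finset.mul_sum, mul_left_comm]
    refine mul_le_mul_right ?_ _
    rw [← Summable.tsum_finsetSum fun _ _ => ENNReal.summable, ← ENNReal.tsum_mul_left]
    refine ENNReal.tsum_le_tsum fun e => ?_
    rw [← Finset.sum_filter, Finset.sum_const, nsmul_eq_mul, ← mul_assoc, ← mul_assoc]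
    refine mul_le_mul_left ?_ _
    unfold kr
    rw [← ENNReal.ofReal_natCast, ← ENNReal.ofReal_natCast (n := r), ← ENNReal.ofReal_mul (by positivity), ← ENNReal.ofReal_mul (by positivity), ← ENNReal.ofReal_mul (by positivity)]
    refine ENNReal.ofReal_le_ofReal ?_
    have hNe : 0 ≤ N e ^ (-((d:ℝ) + α)) := Real.rpow_nonneg (N_pos e).le _
    have hm : (r:ℝ) * min 1 (N e / r) = min (r:ℝ) (N e) := by
      rw [mul_min_of_nonneg _ _ hrp.le, mul_one, mul_div_cancel₀ _ hrp.ne']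
    have hmin : 0 ≤ min (r:ℝ) (N e) := le_min hrp.le (N_pos e).le
    calc _ ≤ min (r:ℝ) (N e) * (K * N e ^ (-((d:ℝ) + α))) := mul_le_mul_of_nonneg_right (count_le r a e) (mul_nonneg hK hNe)
      _ = (K * N e ^ (-((d:ℝ) + α))) * ((r:ℝ) * min 1 (N e / r)) := by rw [hm]; ring
      _ ≤ ((A1 * 2 ^ α + K) * N e ^ (-((d:ℝ) + α))) * ((r:ℝ) * min 1 (N e / r)) := by
          rw [hm]
          refine mul_le_mul_of_nonneg_right (mul_le_mul_of_nonneg_right ?_ hNe) hmin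
          have : 0 ≤ A1 * 2 ^ α := by positivity
          linarith
      _ = _ := by ring

lemma SL_perc {J : V d → V d → ℝ} {α c C : ℝ} (hJ : KernelHyp d J α c C) {P : ℝ → Measure (Config d)} (hP : IsLRP J P)
    (hbc : 0 < betaC P) : ∃ A : ℝ≥0∞, A ≠ ⊤ ∧ ∀ β, betaC P / 2 ≤ β → β < betaC P → SL (ti (pb (Js J) β) 0) α A := by
  have hC : 0 < C := hJ.c_pos.trans_le hJ.c_le_C
  obtain ⟨A1, hA1, hbox⟩ := box_bound (d := d) (α := α) (b := betaC P / 2 * c) hJ.d_pos hJ.alpha_pos hJ.alpha_lt_d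
    (mul_pos (by linarith) hJ.c_pos)
  refine ⟨ENNReal.ofReal (A1 * 2 ^ α + betaC P * C), ENNReal.ofReal_ne_top, fun β hβ1 hβ2 => ?_⟩
  have hβ : 0 ≤ β := by linarith
  have h0 := pb_nonneg (Js_nonneg hJ) hβ
  have h1 := pb_le_one (Js J) β
  refine SL_of h0 h1 (TI_pb hJ β) hJ.alpha_pos (by positivity) hA1 (fun x y hxy => ?_)
    (hbox _ h0 h1 (TI_pb hJ β) (fun x y hxy => ?_) (chi_fin hJ hP hβ hβ2).ne)
  · refine (pb_le (Js J) β _).trans ?_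
    rw [Js_mk hJ, mul_assoc]
    exact mul_le_mul hβ2.le (hJ.upper x y hxy) (hJ.nonneg x y) hbc.le
  · unfold pb
    rw [Js_mk hJ]
    have : betaC P / 2 * c * (normInf (x - y) : ℝ) ^ (-(d : ℝ) - α) ≤ β * J x y := by
      rw [mul_assoc]
      exact mul_le_mul hβ1 (hJ.lower x y hxy) (mul_nonneg hJ.c_pos.le (Real.rpow_nonneg (by positivity) _)) hβ
    have h2 := Real.exp_le_exp.2 (neg_le_neg this)
    rw [neg_mul]
    linarith

end M11

section M12
open Classical
set_option linter.unusedSectionVars false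
variable {d : ℕ}

noncomputable def t2 (T : V d → ℝ≥0∞) (v : V d) : ℝ≥0∞ := ∑' x, T x * T (v - x)
noncomputable def t3 (T : V d → ℝ≥0∞) (w : V d) : ℝ≥0∞ := ∑' u, T u * t2 T (w + u)

lemma t2_sum (T : V d → ℝ≥0∞) : ∑' v, t2 T v = (∑' x, T x) * ∑' x, T x := by
  unfold t2
  rw [ENNReal.tsum_comm, ← ENNReal.tsum_mul_right]
  refine tsum_congr fun x => ?_
  rw [ENNReal.tsum_mul_left]; congr 1
  exact (Equiv.subRight x).tsum_eq T

lemma tsum_subLeft (T : V d → ℝ≥0∞) (v : V d) : ∑' x, T (v - x) = ∑' x, T x := (Equiv.subLeft v).tsum_eq T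

lemma t2_bound {α : ℝ} (h2 : 2 * α < d) (h0 : 0 < α) {B D : ℝ≥0∞} (hB : B ≠ ⊤) (hD : D ≠ ⊤) :
    ∃ C : ℝ≥0∞, C ≠ ⊤ ∧ ∀ T : V d → ℝ≥0∞, BG T B α → (∀ x, T x ≤ D * ENNReal.ofReal (N x ^ (-((d:ℝ) - α)))) →
      ∀ v, t2 T v ≤ C * ENNReal.ofReal (N v ^ (-((d:ℝ) - 2 * α))) := by
  obtain ⟨C0, hC0, htail⟩ := tail_sum (d := d) (a := α) (s := d - α) (by linarith) (by linarith)
  refine ⟨2 * (D * (B + C0 * B)) * ENNReal.ofReal (2 ^ ((d:ℝ) - 2 * α)),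
    ENNReal.mul_ne_top (ENNReal.mul_ne_top (by simp) (ENNReal.mul_ne_top hD (ENNReal.add_ne_top.2 ⟨hB, ENNReal.mul_ne_top hC0 hB⟩))) ENNReal.ofReal_ne_top,
    fun T hBG hpt v => ?_⟩
  set ρ := N v / 2 with hρ
  have hNv := N_pos v
  have hρp : 0 < ρ := by positivity
  set f : V d → ℝ≥0∞ := fun x => (if N x ≤ ρ then T x else 0) * (D * ENNReal.ofReal (ρ ^ (-((d:ℝ) - α))))
    + D * (if N x ≤ ρ then 0 else T x * ENNReal.ofReal (N x ^ (-((d:ℝ) - α)))) with hf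
  have hmono : ∀ y, ρ ≤ N y → T y ≤ D * ENNReal.ofReal (ρ ^ (-((d:ℝ) - α))) := fun y hy =>
    (hpt y).trans (mul_le_mul_right (ENNReal.ofReal_le_ofReal
      (Real.rpow_le_rpow_of_nonpos hρp hy (by linarith))) _)
  have hsq : ∀ y, ¬ N y ≤ ρ → T y * T y ≤ f y := fun y hy => by
    simp only [hf, if_neg hy, zero_mul, zero_add]
    calc T y * T y ≤ T y * (D * ENNReal.ofReal (N y ^ (-((d:ℝ) - α)))) := mul_le_mul_right (hpt y) _
      _ = _ := by ring
  have hfar : ∀ x, N x ≤ ρ → ρ ≤ N (v - x) := fun x hx => by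
    have := N_sub v x; simp only [hρ] at hx ⊢; linarith
  have hle : ∀ x, T x * T (v - x) ≤ f x + f (v - x) := by
    intro x
    by_cases h : N x ≤ ρ
    · refine le_add_right ?_
      simp only [hf, if_pos h, mul_zero, add_zero]
      exact mul_le_mul_right (hmono _ (hfar x h)) _
    by_cases h' : N (v - x) ≤ ρ
    · refine le_add_left ?_
      simp only [hf, if_pos h', mul_zero, add_zero]
      rw [mul_comm]
      exact mul_le_mul_right (hmono _ (not_le.1 h).le) _
    rcases le_total (T x) (T (v - x)) with hc | hc
    · exact le_add_left ((mul_le_mul_left hc _).trans (hsq _ h'))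
    · exact le_add_right ((mul_le_mul_right hc _).trans (hsq _ h))
  have hfs : ∑' x, f x ≤ D * (B + C0 * B) * ENNReal.ofReal (ρ ^ (-((d:ℝ) - 2 * α))) := by
    simp only [hf]
    rw [ENNReal.tsum_add, ENNReal.tsum_mul_right, ENNReal.tsum_mul_left]
    have e : ENNReal.ofReal (ρ ^ α) * ENNReal.ofReal (ρ ^ (-((d:ℝ) - α))) = ENNReal.ofReal (ρ ^ (-((d:ℝ) - 2 * α))) := by
      rw [← ENNReal.ofReal_mul (by positivity), ← Real.rpow_add hρp]; congr 2; ring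
    have e2 : α - (d - α) = -((d:ℝ) - 2 * α) := by ring
    calc _ ≤ B * ENNReal.ofReal (ρ ^ α) * (D * ENNReal.ofReal (ρ ^ (-((d:ℝ) - α)))) + D * (C0 * B * ENNReal.ofReal (ρ ^ (-((d:ℝ) - 2 * α)))) := by
          refine add_le_add (mul_le_mul_left (hBG ρ hρp) _) (mul_le_mul_right ?_ _)
          rw [← e2]; exact htail T B hBG ρ hρp
      _ = D * B * (ENNReal.ofReal (ρ ^ α) * ENNReal.ofReal (ρ ^ (-((d:ℝ) - α)))) + D * (C0 * B * ENNReal.ofReal (ρ ^ (-((d:ℝ) - 2 * α)))) := by ring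
      _ = _ := by rw [e]; ring
  calc t2 T v ≤ ∑' x, (f x + f (v - x)) := ENNReal.tsum_le_tsum hle
    _ = 2 * ∑' x, f x := by rw [ENNReal.tsum_add, tsum_subLeft]; ring
    _ ≤ 2 * (D * (B + C0 * B) * ENNReal.ofReal (ρ ^ (-((d:ℝ) - 2 * α)))) := mul_le_mul_right hfs _
    _ = _ := by
        rw [mul_assoc (2 * _), ← ENNReal.ofReal_mul (by positivity), ← mul_assoc]
        congr 2
        rw [hρ, Real.div_rpow hNv.le (by norm_num), Real.rpow_neg (by norm_num : (0:ℝ) ≤ 2)]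
        field_simp

lemma t3_bound {α : ℝ} (h2 : 2 * α < d) (h3 : d < 3 * α) {B D : ℝ≥0∞} (hB : B ≠ ⊤) (hD : D ≠ ⊤) :
    ∃ C : ℝ≥0∞, C ≠ ⊤ ∧ ∀ T : V d → ℝ≥0∞, (∀ v, BG (fun x => T (v + x)) B α) → (∀ x, T x ≤ D * ENNReal.ofReal (N x ^ (-((d:ℝ) - α)))) →
      ∀ R : ℝ, 0 < R → ∑' x, T x ≤ ENNReal.ofReal (R ^ α) → (∀ w, t3 T w ≤ C * ENNReal.ofReal (R ^ (3 * α - d))) ∧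
        ∑' w, t2 T w * t2 T w * t2 T w ≤ C * ENNReal.ofReal (R ^ (6 * α - 2 * d)) := by
  have hdp : (0:ℝ) ≤ d := by positivity
  have h0 : 0 < α := by linarith
  obtain ⟨C2, hC2, ht2⟩ := t2_bound (d := d) h2 h0 hB hD
  obtain ⟨C3, hC3, hh⟩ := head_sum (d := d) (a := α) (s := d - 2 * α) (by linarith) (by linarith)
  obtain ⟨C4, hC4, hh4⟩ := head_sum (d := d) (a := d) (s := 3 * d - 6 * α) (by linarith) (by linarith)
  set K1 := C2 * (C3 * B + 1)
  set K2 := C2 * C2 * C2 * (C4 * ENNReal.ofReal (3 ^ d)) + C2 * C2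
  have hK1 : K1 ≠ ⊤ := ENNReal.mul_ne_top hC2 (ENNReal.add_ne_top.2 ⟨ENNReal.mul_ne_top hC3 hB, by simp⟩)
  have hK2 : K2 ≠ ⊤ := ENNReal.add_ne_top.2 ⟨ENNReal.mul_ne_top (ENNReal.mul_ne_top (ENNReal.mul_ne_top hC2 hC2) hC2) (ENNReal.mul_ne_top hC4 ENNReal.ofReal_ne_top),
    ENNReal.mul_ne_top hC2 hC2⟩
  refine ⟨K1 + K2, ENNReal.add_ne_top.2 ⟨hK1, hK2⟩, fun T hBG hpt R hR hX => ?_⟩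
  have hT2 := ht2 T (by simpa using hBG 0) hpt
  have hT2R : ∀ x, ¬ N x ≤ R → t2 T x ≤ C2 * ENNReal.ofReal (R ^ (-((d:ℝ) - 2 * α))) := fun x hx =>
    (hT2 x).trans (mul_le_mul_right (ENNReal.ofReal_le_ofReal (Real.rpow_le_rpow_of_nonpos hR (not_le.1 hx).le (by linarith))) _)
  constructor
  · intro w
    have e : t3 T w = ∑' x, T (-w + x) * t2 T x := by
      unfold t3
      rw [← tsum_add_left (fun x => T x * t2 T (w + x)) (-w)]
      refine tsum_congr fun x => ?_
      congr 2; abel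
    rw [e]
    calc _ ≤ ∑' x, (C2 * (if N x ≤ R then T (-w + x) * ENNReal.ofReal (N x ^ (-((d:ℝ) - 2 * α))) else 0) + T (-w + x) * (C2 * ENNReal.ofReal (R ^ (-((d:ℝ) - 2 * α))))) := by
          refine ENNReal.tsum_le_tsum fun x => ?_
          by_cases h : N x ≤ R
          · refine le_add_right ?_
            rw [if_pos h]
            refine (mul_le_mul_right (hT2 x) _).trans (le_of_eq (by ring))
          · exact le_add_left (mul_le_mul_right (hT2R x h) _)
      _ ≤ C2 * (C3 * B * ENNReal.ofReal (R ^ (3 * α - d))) + ENNReal.ofReal (R ^ α) * (C2 * ENNReal.ofReal (R ^ (-((d:ℝ) - 2 * α)))) := by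
          rw [ENNReal.tsum_add, ENNReal.tsum_mul_left, ENNReal.tsum_mul_right, tsum_add_left]
          refine add_le_add (mul_le_mul_right ?_ _) (mul_le_mul_left hX _)
          have := hh _ B (hBG (-w)) R hR
          rwa [show α - (d - 2 * α) = 3 * α - d by ring] at this
      _ = K1 * ENNReal.ofReal (R ^ (3 * α - d)) := by
          have : ENNReal.ofReal (R ^ α) * ENNReal.ofReal (R ^ (-((d:ℝ) - 2 * α))) = ENNReal.ofReal (R ^ (3 * α - d)) := by
            rw [← ENNReal.ofReal_mul (by positivity), ← Real.rpow_add hR]; congr 2; ring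
          rw [mul_left_comm (ENNReal.ofReal (R ^ α)), this]; simp only [K1]; ring
      _ ≤ _ := mul_le_mul_left (le_add_right le_rfl) _
  · calc _ ≤ ∑' x, (C2 * C2 * C2 * (if N x ≤ R then 1 * ENNReal.ofReal (N x ^ (-(3 * (d:ℝ) - 6 * α))) else 0)
            + (C2 * C2 * ENNReal.ofReal (R ^ (-2 * ((d:ℝ) - 2 * α)))) * t2 T x) := by
          refine ENNReal.tsum_le_tsum fun x => ?_
          by_cases h : N x ≤ R
          · refine le_add_right ?_
            rw [if_pos h]
            refine (mul_le_mul' (mul_le_mul' (hT2 x) (hT2 x)) (hT2 x)).trans (le_of_eq ?_)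
            have : ENNReal.ofReal (N x ^ (-(3 * (d:ℝ) - 6 * α))) = ENNReal.ofReal (N x ^ (-((d:ℝ) - 2 * α))) * ENNReal.ofReal (N x ^ (-((d:ℝ) - 2 * α))) * ENNReal.ofReal (N x ^ (-((d:ℝ) - 2 * α))) := by
              have hN := N_pos x
              rw [← ENNReal.ofReal_mul (by positivity), ← ENNReal.ofReal_mul (by positivity), ← Real.rpow_add hN, ← Real.rpow_add hN]; congr 2; ring
            rw [this]; ring
          · refine le_add_left (mul_le_mul_left ((mul_le_mul' (hT2R x h) (hT2R x h)).trans (le_of_eq ?_)) _)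
            have : ENNReal.ofReal (R ^ (-2 * ((d:ℝ) - 2 * α))) = ENNReal.ofReal (R ^ (-((d:ℝ) - 2 * α))) * ENNReal.ofReal (R ^ (-((d:ℝ) - 2 * α))) := by
              rw [← ENNReal.ofReal_mul (by positivity), ← Real.rpow_add hR]; congr 2; ring
            rw [this]; ring
      _ ≤ C2 * C2 * C2 * (C4 * ENNReal.ofReal (3 ^ d) * ENNReal.ofReal (R ^ (6 * α - 2 * d))) + (C2 * C2 * ENNReal.ofReal (R ^ (-2 * ((d:ℝ) - 2 * α)))) * (ENNReal.ofReal (R ^ α) * ENNReal.ofReal (R ^ α)) := by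
          rw [ENNReal.tsum_add, ENNReal.tsum_mul_left, ENNReal.tsum_mul_left, t2_sum]
          refine add_le_add (mul_le_mul_right ?_ _) (mul_le_mul_right (mul_le_mul' hX hX) _)
          have := hh4 _ _ BG_one R hR
          rwa [show (d:ℝ) - (3 * d - 6 * α) = 6 * α - 2 * d by ring] at this
      _ = K2 * ENNReal.ofReal (R ^ (6 * α - 2 * d)) := by
          have : ENNReal.ofReal (R ^ (-2 * ((d:ℝ) - 2 * α))) * (ENNReal.ofReal (R ^ α) * ENNReal.ofReal (R ^ α)) = ENNReal.ofReal (R ^ (6 * α - 2 * d)) := by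
            rw [← ENNReal.ofReal_mul (by positivity), ← ENNReal.ofReal_mul (by positivity), ← Real.rpow_add hR, ← Real.rpow_add hR]; congr 2; ring
          rw [mul_assoc (C2 * C2) (ENNReal.ofReal _), this]; simp only [K2]; ring
      _ ≤ _ := mul_le_mul_left (le_add_left le_rfl) _

lemma swap4 (F : V d → V d → V d → V d → ℝ≥0∞) :
    ∑' b, ∑' b', ∑' u, ∑' v, F b b' u v = ∑' u, ∑' v, ∑' b, ∑' b', F b b' u v := by
  calc _ = ∑' b, ∑' u, ∑' b', ∑' v, F b b' u v := tsum_congr fun b => ENNReal.tsum_comm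
    _ = ∑' b, ∑' u, ∑' v, ∑' b', F b b' u v := tsum_congr fun b => tsum_congr fun u => ENNReal.tsum_comm
    _ = ∑' u, ∑' b, ∑' v, ∑' b', F b b' u v := ENNReal.tsum_comm
    _ = _ := tsum_congr fun u => ENNReal.tsum_comm

lemma t2_conv (T : V d → ℝ≥0∞) (u z : V d) : ∑' b, T (b - u) * T (z - b) = t2 T (z - u) := by
  rw [← tsum_add_left _ u]; unfold t2
  refine tsum_congr fun x => ?_
  congr 2 <;> abel

lemma prod_sum (c : ℝ≥0∞) (f g : V d → ℝ≥0∞) : ∑' b, ∑' b', c * f b * g b' = c * (∑' b, f b) * ∑' b', g b' := by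
  simp_rw [ENNReal.tsum_mul_left, ENNReal.tsum_mul_right, ENNReal.tsum_mul_left]

noncomputable def Dg1 (T : V d → ℝ≥0∞) : ℝ≥0∞ := ∑' z, ∑' b, ∑' b', ∑' u, ∑' v,
  T v * T (u - v) * T (z - u) * T (b - u) * T (b' - v) * T (z - b) * T (z - b')
noncomputable def Dg3 (T : V d → ℝ≥0∞) : ℝ≥0∞ := ∑' z, ∑' b, ∑' b', ∑' u, ∑' v,
  T u * T (z - u) * T (v - u) * T (b - v) * T (b' - v) * T (z - b) * T (z - b')

lemma Dg1_eq (T : V d → ℝ≥0∞) : Dg1 T = (∑' x, T x) * ∑' w, T w * t2 T w * t3 T w := by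
  calc Dg1 T = ∑' z, ∑' u, ∑' v, (T v * T (u - v) * T (z - u)) * t2 T (z - u) * t2 T (z - v) := by
        unfold Dg1
        refine tsum_congr fun z => ?_
        rw [swap4]
        refine tsum_congr fun u => tsum_congr fun v => ?_
        rw [← t2_conv T u z, ← t2_conv T v z, ← prod_sum]
        refine tsum_congr fun b => tsum_congr fun b' => ?_
        ring
    _ = ∑' v, ∑' u, ∑' z, (T v * T (u - v) * T (z - u)) * t2 T (z - u) * t2 T (z - v) := by
        rw [ENNReal.tsum_comm]
        calc _ = ∑' u, ∑' v, ∑' z, (T v * T (u - v) * T (z - u)) * t2 T (z - u) * t2 T (z - v) := tsum_congr fun u => ENNReal.tsum_comm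
          _ = _ := ENNReal.tsum_comm
    _ = ∑' v, T v * ∑' u, ∑' w, T u * (T w * t2 T w * t2 T (w + u)) := by
        refine tsum_congr fun v => ?_
        rw [← tsum_add_left _ v, ← ENNReal.tsum_mul_left]
        refine tsum_congr fun u => ?_
        rw [← tsum_add_left _ (v + u), ← ENNReal.tsum_mul_left]
        refine tsum_congr fun w => ?_
        rw [show v + u - v = u by abel, show v + u + w - (v + u) = w by abel, show v + u + w - v = w + u by abel]
        ring
    _ = _ := by
        rw [ENNReal.tsum_mul_right, ENNReal.tsum_comm]
        congr 1
        refine tsum_congr fun w => ?_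
        unfold t3
        rw [← ENNReal.tsum_mul_left]
        refine tsum_congr fun u => ?_
        ring

lemma Dg3_eq (T : V d → ℝ≥0∞) (hsym : ∀ x, T (-x) = T x) : Dg3 T = (∑' x, T x) * ∑' w, t2 T w * t2 T w * t2 T w := by
  calc Dg3 T = ∑' z, ∑' u, ∑' v, (T u * T (z - u) * T (v - u)) * t2 T (z - v) * t2 T (z - v) := by
        unfold Dg3
        refine tsum_congr fun z => ?_
        rw [swap4]
        refine tsum_congr fun u => tsum_congr fun v => ?_
        rw [← t2_conv T v z, ← prod_sum]
        refine tsum_congr fun b => tsum_congr fun b' => ?_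
        ring
    _ = ∑' u, ∑' v, ∑' z, (T u * T (z - u) * T (v - u)) * t2 T (z - v) * t2 T (z - v) := by
        rw [ENNReal.tsum_comm]
        exact tsum_congr fun u => ENNReal.tsum_comm
    _ = ∑' u, T u * ∑' v, ∑' w, T v * T (v + w) * (t2 T w * t2 T w) := by
        refine tsum_congr fun u => ?_
        rw [← tsum_add_left _ u, ← ENNReal.tsum_mul_left]
        refine tsum_congr fun v => ?_
        rw [← tsum_add_left _ (u + v), ← ENNReal.tsum_mul_left]
        refine tsum_congr fun w => ?_
        rw [show u + v - u = v by abel, show u + v + w - (u + v) = w by abel, show u + v + w - u = v + w by abel]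
        ring
    _ = _ := by
        rw [ENNReal.tsum_mul_right, ENNReal.tsum_comm]
        congr 1
        refine tsum_congr fun w => ?_
        rw [ENNReal.tsum_mul_right, mul_assoc (t2 T w), mul_comm, mul_comm (t2 T w) (t2 T w * t2 T w)]
        congr 1
        unfold t2
        rw [← (Equiv.neg (V d)).tsum_eq]
        refine tsum_congr fun x => ?_
        simp only [Equiv.neg_apply]
        rw [hsym]; congr 2; abel

lemma diag_bound {α : ℝ} (h2 : 2 * α < d) (h3 : d < 3 * α) {B D : ℝ≥0∞} (hB : B ≠ ⊤) (hD : D ≠ ⊤) :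
    ∃ C : ℝ≥0∞, C ≠ ⊤ ∧ ∀ T : V d → ℝ≥0∞, (∀ x, T (-x) = T x) → (∀ v, BG (fun x => T (v + x)) B α) →
      (∀ x, T x ≤ D * ENNReal.ofReal (N x ^ (-((d:ℝ) - α)))) →
      ∀ R : ℝ, 0 < R → ∑' x, T x ≤ ENNReal.ofReal (R ^ α) → Dg1 T + Dg1 T + Dg3 T ≤ C * ENNReal.ofReal (R ^ (7 * α - 2 * d)) := by
  obtain ⟨C, hC, h⟩ := t3_bound (d := d) h2 h3 hB hD
  refine ⟨C * C + C * C + C, by simp [hC, ENNReal.mul_ne_top], fun T hsym hBG hpt R hR hX => ?_⟩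
  obtain ⟨ht3, hc⟩ := h T hBG hpt R hR hX
  have e1 : ENNReal.ofReal (R ^ (6 * α - 2 * d)) = ENNReal.ofReal (R ^ (3 * α - d)) * ENNReal.ofReal (R ^ (3 * α - d)) := by
    rw [← ENNReal.ofReal_mul (by positivity), ← Real.rpow_add hR]; congr 2; ring
  have e2 : ENNReal.ofReal (R ^ α) * ENNReal.ofReal (R ^ (6 * α - 2 * d)) = ENNReal.ofReal (R ^ (7 * α - 2 * d)) := by
    rw [← ENNReal.ofReal_mul (by positivity), ← Real.rpow_add hR]; congr 2; ring
  have hw : ∑' w, T w * t2 T w * t3 T w ≤ C * C * ENNReal.ofReal (R ^ (6 * α - 2 * d)) := by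
    calc _ ≤ ∑' w, T w * t2 T w * (C * ENNReal.ofReal (R ^ (3 * α - d))) := ENNReal.tsum_le_tsum fun w => mul_le_mul_right (ht3 w) _
      _ = t3 T 0 * (C * ENNReal.ofReal (R ^ (3 * α - d))) := by
          rw [ENNReal.tsum_mul_right]; unfold t3; simp
      _ ≤ (C * ENNReal.ofReal (R ^ (3 * α - d))) * (C * ENNReal.ofReal (R ^ (3 * α - d))) := mul_le_mul_left (ht3 0) _
      _ = _ := by rw [e1]; ring
  have hD1 : Dg1 T ≤ C * C * ENNReal.ofReal (R ^ (7 * α - 2 * d)) := by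
    rw [Dg1_eq]
    refine (mul_le_mul' hX hw).trans (le_of_eq ?_)
    rw [← e2]; ring
  have hD3 : Dg3 T ≤ C * ENNReal.ofReal (R ^ (7 * α - 2 * d)) := by
    rw [Dg3_eq T hsym]
    refine (mul_le_mul' hX hc).trans (le_of_eq ?_)
    rw [← e2]; ring
  refine (add_le_add (add_le_add hD1 hD1) hD3).trans (le_of_eq ?_)
  ring

end M12

section M13
open Classical
set_option linter.unusedSectionVars false
variable {d : ℕ}

lemma ofReal_sum_le {κ : Type*} (s : Finset κ) (f : κ → ℝ) (g : κ → ℝ≥0∞) (h : ∀ x, ENNReal.ofReal (f x) ≤ g x) :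
    ENNReal.ofReal (∑ x ∈ s, f x) ≤ ∑' x, g x := by
  refine (Finset.le_sum_of_subadditive ENNReal.ofReal (by simp) (fun a b => ENNReal.ofReal_add_le) s f).trans ?_
  exact (Finset.sum_le_sum fun x _ => h x).trans (ENNReal.sum_le_tsum s)

lemma Dg1_swap (T : V d → ℝ≥0∞) : ∑' z, ∑' b, ∑' b', ∑' u, ∑' v,
    T u * T (v - u) * T (z - v) * T (b - u) * T (b' - v) * T (z - b) * T (z - b') = Dg1 T := by
  unfold Dg1
  refine tsum_congr fun z => ?_
  rw [ENNReal.tsum_comm]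
  refine tsum_congr fun b => tsum_congr fun b' => ?_
  rw [ENNReal.tsum_comm]
  refine tsum_congr fun u => tsum_congr fun v => ?_
  ring

lemma diag_real {p : Sym2 (V d) → ℝ} (h0 : ∀ e, 0 ≤ p e) (h1 : ∀ e, p e ≤ 1) (hp : TI p) {Λ : Finset (V d)} (ho : (0 : V d) ∈ Λ) :
    ENNReal.ofReal (∑ z ∈ Λ, ∑ b ∈ Λ, ∑ b' ∈ Λ, Pr p Λ.sym2 (fun ω => R ω 0 z ∧ R ω 0 b ∧ R ω 0 b') * tau p Λ b z * tau p Λ b' z) ≤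
      Dg1 (ti p 0) + Dg1 (ti p 0) + Dg3 (ti p 0) := by
  set T := ti p 0 with hT
  have ht : ∀ x y, ENNReal.ofReal (tau p Λ x y) ≤ T (y - x) := fun x y => by
    rw [hT, ← ti_eq h0 h1 hp]; exact tau_le_ti h0 h1 _ _ _
  have hn := tau_nonneg h0 h1 Λ
  have m5 : ∀ a b c e f : V d × V d, ENNReal.ofReal (tau p Λ a.1 a.2 * tau p Λ b.1 b.2 * tau p Λ c.1 c.2 * tau p Λ e.1 e.2 * tau p Λ f.1 f.2) ≤
      T (a.2 - a.1) * T (b.2 - b.1) * T (c.2 - c.1) * T (e.2 - e.1) * T (f.2 - f.1) := by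
    intro a b c e f
    have na := hn a.1 a.2
    have nb := hn b.1 b.2
    have nc := hn c.1 c.2
    have ne := hn e.1 e.2
    rw [ENNReal.ofReal_mul (by positivity), ENNReal.ofReal_mul (by positivity), ENNReal.ofReal_mul (by positivity), ENNReal.ofReal_mul (by positivity)]
    exact mul_le_mul' (mul_le_mul' (mul_le_mul' (mul_le_mul' (ht _ _) (ht _ _)) (ht _ _)) (ht _ _)) (ht _ _)
  have hPr : ∀ z b b', ENNReal.ofReal (Pr p Λ.sym2 (fun ω => R ω 0 z ∧ R ω 0 b ∧ R ω 0 b')) ≤ ∑' u, ∑' v,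
      ((T v * T (u - v) * T (z - u) * T (b - u) * T (b' - v) + T u * T (v - u) * T (z - v) * T (b - u) * T (b' - v)) +
        T u * T (z - u) * T (v - u) * T (b - v) * T (b' - v)) := by
    intro z b b'
    refine (ENNReal.ofReal_le_ofReal (tree_graph h0 h1 ho z b b')).trans ?_
    refine ofReal_sum_le _ _ _ fun u => ofReal_sum_le _ _ _ fun v => ?_
    refine ENNReal.ofReal_add_le.trans (add_le_add (ENNReal.ofReal_add_le.trans (add_le_add ?_ ?_)) ?_)
    · simpa using m5 (0, v) (v, u) (u, z) (u, b) (v, b')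
    · simpa using m5 (0, u) (u, v) (v, z) (u, b) (v, b')
    · simpa using m5 (0, u) (u, z) (u, v) (v, b) (v, b')
  calc _ ≤ ∑' z, ∑' b, ∑' b', (∑' u, ∑' v,
      ((T v * T (u - v) * T (z - u) * T (b - u) * T (b' - v) + T u * T (v - u) * T (z - v) * T (b - u) * T (b' - v)) +
        T u * T (z - u) * T (v - u) * T (b - v) * T (b' - v))) * T (z - b) * T (z - b') := by
        refine ofReal_sum_le _ _ _ fun z => ofReal_sum_le _ _ _ fun b => ofReal_sum_le _ _ _ fun b' => ?_
        have hPn := Pr_nonneg h0 h1 (E := Λ.sym2) (A := fun ω => R ω 0 z ∧ R ω 0 b ∧ R ω 0 b')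
        rw [ENNReal.ofReal_mul (mul_nonneg hPn (hn _ _)), ENNReal.ofReal_mul hPn]
        exact mul_le_mul' (mul_le_mul' (hPr z b b') (ht _ _)) (ht _ _)
    _ = _ := by
        have : Dg1 T + Dg1 T + Dg3 T = Dg1 T + (∑' z, ∑' b, ∑' b', ∑' u, ∑' v,
            T u * T (v - u) * T (z - v) * T (b - u) * T (b' - v) * T (z - b) * T (z - b')) + Dg3 T := by rw [Dg1_swap]
        rw [this]
        unfold Dg1 Dg3
        simp only [← ENNReal.tsum_mul_right, add_mul, ENNReal.tsum_add]

lemma mem_K {Λ : Finset (V d)} {ω : Finset (Sym2 (V d))} {x : V d} : x ∈ KB Λ {0} ω ↔ x ∈ Λ ∧ R ω 0 x := by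
  unfold KB; simp

lemma sum_K (Λ : Finset (V d)) (ω : Finset (Sym2 (V d))) (f : V d → ℝ) :
    ∑ x ∈ KB Λ {0} ω, f x = ∑ x ∈ Λ, ind (R ω 0 x) * f x := by
  unfold KB
  rw [Finset.sum_filter]
  refine Finset.sum_congr rfl fun x _ => ?_
  by_cases h : R ω 0 x
  · rw [ind_pos h, if_pos ⟨0, by simp, h⟩, one_mul]
  · rw [ind_neg h, zero_mul, if_neg]; simpa using h

lemma Ex_K (p : Sym2 (V d) → ℝ) (Λ : Finset (V d)) (f : V d → ℝ) :
    Ex p Λ.sym2 (fun ω => ∑ x ∈ KB Λ {0} ω, f x) = ∑ x ∈ Λ, tau p Λ 0 x * f x := by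
  simp_rw [sum_K, Ex_sum, Ex_mul_right]; rfl

lemma Ex_g (p : Sym2 (V d) → ℝ) (Λ : Finset (V d)) (t : V d → V d → ℝ) :
    Ex p Λ.sym2 (fun ω => ∑ z ∈ KB Λ {0} ω, (∑ b ∈ KB Λ {0} ω, t b z) ^ 2) =
    ∑ z ∈ Λ, ∑ b ∈ Λ, ∑ b' ∈ Λ, Pr p Λ.sym2 (fun ω => R ω 0 z ∧ R ω 0 b ∧ R ω 0 b') * t b z * t b' z := by
  unfold Pr
  simp_rw [← Ex_mul_right, ← Ex_sum]
  refine Ex_congr p fun ω _ => ?_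
  rw [sum_K]
  refine Finset.sum_congr rfl fun z _ => ?_
  rw [sq, sum_K, Finset.sum_mul_sum, Finset.mul_sum]
  refine Finset.sum_congr rfl fun b _ => ?_
  rw [Finset.mul_sum]
  refine Finset.sum_congr rfl fun b' _ => ?_
  have : ind (R ω 0 z ∧ R ω 0 b ∧ R ω 0 b') = ind (R ω 0 z) * (ind (R ω 0 b) * ind (R ω 0 b')) := by
    unfold ind; split_ifs <;> simp_all
  rw [this]; ring

/-- outgoing influence -/
noncomputable def Hh (I p : Sym2 (V d) → ℝ) (Λ K : Finset (V d)) (z : V d) : ℝ :=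
  ∑ z' ∈ Λ \ K, I s(z, z') * ∑ x ∈ Λ, tau p (Λ \ K) z' x

lemma sl_sum {I : Sym2 (V d) → ℝ} (hI : ∀ e, 0 ≤ I e) {β : ℝ} (hβ : 0 ≤ β) {Λ K : Finset (V d)} (hK : K ⊆ Λ) :
    ∑ b ∈ K, ∑ x ∈ Λ, tau (pb I β) Λ b x ≤ ∑ z ∈ K, (1 + β * Hh I (pb I β) Λ K z) * ∑ b ∈ K, tau (pb I β) Λ b z := by
  have h0 := pb_nonneg hI hβ
  have h1 := pb_le_one I β
  set p := pb I β
  have hb : ∀ b ∈ K, ∑ x ∈ Λ, tau p Λ b x ≤ ∑ z ∈ K, (1 + β * Hh I p Λ K z) * tau p Λ b z := by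
    intro b hb
    rw [← Finset.sum_sdiff hK]
    have hx : ∀ x ∈ Λ \ K, tau p Λ b x ≤ ∑ z ∈ K, (∑ a ∈ Λ \ K, β * (I s(z, a) * tau p (Λ \ K) a x)) * tau p Λ b z := by
      intro x hx
      have := simon_lieb h0 h1 (Finset.sdiff_subset : Λ \ K ⊆ Λ) hx b
      rw [tau_eq_zero p hx (by simp [hb]), zero_add, Finset.sdiff_sdiff_eq_self hK, Finset.sum_comm, tau_symm] at this
      refine this.trans (Finset.sum_le_sum fun z _ => ?_)
      rw [Finset.sum_mul]
      refine Finset.sum_le_sum fun a _ => ?_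
      rw [tau_symm p Λ z b]
      refine mul_le_mul_of_nonneg_right ?_ (tau_nonneg h0 h1 _ _ _)
      rw [tau_symm p _ x a, mul_comm, ← mul_assoc]
      refine mul_le_mul_of_nonneg_right ?_ (tau_nonneg h0 h1 _ _ _)
      rw [Sym2.eq_swap]; exact pb_le I β _
    refine (add_le_add (Finset.sum_le_sum hx) le_rfl).trans ?_
    rw [Finset.sum_comm, ← Finset.sum_add_distrib]
    refine Finset.sum_le_sum fun z _ => ?_
    rw [← Finset.sum_mul, add_mul, one_mul, add_comm]
    refine add_le_add le_rfl (mul_le_mul_of_nonneg_right ?_ (tau_nonneg h0 h1 _ _ _))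
    unfold Hh
    rw [Finset.sum_comm, Finset.mul_sum]
    refine Finset.sum_le_sum fun a _ => ?_
    rw [← Finset.mul_sum, ← Finset.mul_sum]
    refine mul_le_mul_of_nonneg_left (mul_le_mul_of_nonneg_left ?_ (hI _)) hβ
    exact Finset.sum_le_sum_of_subset_of_nonneg Finset.sdiff_subset fun x _ _ => tau_nonneg h0 h1 _ _ _
  refine (Finset.sum_le_sum hb).trans (le_of_eq ?_)
  rw [Finset.sum_comm]
  exact Finset.sum_congr rfl fun z _ => by rw [Finset.mul_sum]

lemma Hh_nonneg {I p : Sym2 (V d) → ℝ} (hI : ∀ e, 0 ≤ I e) (h0 : ∀ e, 0 ≤ p e) (h1 : ∀ e, p e ≤ 1) (Λ K : Finset (V d)) (z : V d) :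
    0 ≤ Hh I p Λ K z :=
  Finset.sum_nonneg fun z' _ => mul_nonneg (hI _) (Finset.sum_nonneg fun x _ => tau_nonneg h0 h1 _ _ _)

lemma sum_J_le {J : V d → V d → ℝ} {α c C : ℝ} (hJ : KernelHyp d J α c C) (z : V d) (S : Finset (V d)) :
    ∑ z' ∈ S, Js J s(z, z') ≤ ∑' x, J 0 x := by
  have e : ∀ z', Js J s(z, z') = J 0 (z' - z) := fun z' => by
    rw [Js_mk hJ, ← hJ.transInv 0 (z' - z) z]; simp
  simp_rw [e]
  rw [← (Equiv.subRight z).tsum_eq (fun x => J 0 x)]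
  exact Summable.sum_le_tsum (f := fun x => J 0 (x - z)) S (fun x _ => hJ.nonneg _ _)
    ((Equiv.subRight z).summable_iff (f := fun x => J 0 x) |>.2 hJ.integrable)

lemma dineq {J : V d → V d → ℝ} {α c C : ℝ} (hJ : KernelHyp d J α c C) {β : ℝ} (hβ : 0 ≤ β)
    (hX : ∑' x, ti (pb (Js J) β) 0 x ≠ ⊤) (n : ℕ) {M Y : ℝ} (hM : 0 < M) (hY : 0 ≤ Y)
    (hD : Dg1 (ti (pb (Js J) β) 0) + Dg1 (ti (pb (Js J) β) 0) + Dg3 (ti (pb (Js J) β) 0) ≤ ENNReal.ofReal Y) :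
    ∃ f', HasDerivAt (fun b => ∑ x ∈ Lm d n, tau (pb (Js J) b) (Lm d n) 0 x) f' β ∧
      ∑ b ∈ Lm d n, tau (pb (Js J) β) (Lm d n) 0 b * ∑ x ∈ Lm d n, tau (pb (Js J) β) (Lm d n) b x ≤
        M * (∑ x ∈ Lm d n, tau (pb (Js J) β) (Lm d n) 0 x + β * f') +
          (1 + β * ((∑' x, J 0 x) * (∑' x, ti (pb (Js J) β) 0 x).toReal)) / M * Y := by
  have hI := Js_nonneg hJ
  have h0 := pb_nonneg hI hβ
  have h1 := pb_le_one (Js J) β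
  have hp := TI_pb hJ β
  set Λ := Lm d n with hΛ
  set X := (∑' x, ti (pb (Js J) β) 0 x).toReal
  have hXn : 0 ≤ X := ENNReal.toReal_nonneg
  have hJn : 0 ≤ ∑' x, J 0 x := tsum_nonneg fun x => hJ.nonneg _ _
  have ho : (0 : V d) ∈ Λ := zero_mem_Lm n
  have e : ∀ b x, tau (pb (Js J) b) Λ 0 x = Pr (pb (Js J) b) Λ.sym2 (fun ω => ∃ b ∈ ({0} : Finset (V d)), R ω b x) := by
    intro b x; unfold tau; simp
  choose f hf hf2 using fun x => russo_lower hI hβ (Λ := Λ) (B := {0}) (by simpa using ho) x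
  refine ⟨∑ x ∈ Λ, f x, ?_, ?_⟩
  · simp_rw [e]
    exact HasDerivAt.fun_sum fun x _ => hf x
  set p := pb (Js J) β with hpdef
  have hH : Ex p Λ.sym2 (fun ω => ∑ z ∈ KB Λ {0} ω, Hh (Js J) p Λ (KB Λ {0} ω) z) ≤ ∑ x ∈ Λ, f x := by
    refine (Finset.sum_le_sum fun x _ => hf2 x).trans' (le_of_eq ?_)
    rw [← Ex_sum]
    refine Ex_congr p fun ω _ => ?_
    unfold Hh
    conv_rhs => rw [Finset.sum_comm]
    refine Finset.sum_congr rfl fun z _ => ?_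
    conv_rhs => rw [Finset.sum_comm]
    exact Finset.sum_congr rfl fun z' _ => by rw [Finset.mul_sum]
  have hHX : ∀ K z, Hh (Js J) p Λ K z ≤ (∑' x, J 0 x) * X := fun K z => by
    unfold Hh
    calc _ ≤ ∑ z' ∈ Λ \ K, Js J s(z, z') * X := Finset.sum_le_sum fun z' _ =>
          mul_le_mul_of_nonneg_left (sum_tau_le h0 h1 hp hX _ _ _) (hI _)
      _ = (∑ z' ∈ Λ \ K, Js J s(z, z')) * X := by rw [Finset.sum_mul]
      _ ≤ _ := mul_le_mul_of_nonneg_right (sum_J_le hJ z _) hXn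
  set A := (1 + β * ((∑' x, J 0 x) * X)) / M with hA
  have hpt : ∀ ω, ∑ b ∈ KB Λ {0} ω, ∑ x ∈ Λ, tau p Λ b x ≤
      M * (∑ z ∈ KB Λ {0} ω, (1:ℝ) + β * ∑ z ∈ KB Λ {0} ω, Hh (Js J) p Λ (KB Λ {0} ω) z) +
        A * ∑ z ∈ KB Λ {0} ω, (∑ b ∈ KB Λ {0} ω, tau p Λ b z) ^ 2 := by
    intro ω
    have hKs : KB Λ {0} ω ⊆ Λ := Finset.filter_subset _ _
    set K := KB Λ {0} ω
    refine (sl_sum hI hβ hKs).trans ?_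
    rw [Finset.mul_sum K _ β, ← Finset.sum_add_distrib, Finset.mul_sum, Finset.mul_sum, ← Finset.sum_add_distrib]
    refine Finset.sum_le_sum fun z _ => ?_
    change (1 + β * Hh (Js J) p Λ K z) * _ ≤ _
    set g := ∑ b ∈ K, tau p Λ b z
    have hHn := Hh_nonneg hI h0 h1 Λ K z
    have hg : g ≤ M + g ^ 2 / M := by
      have : 0 ≤ (g - M) ^ 2 := sq_nonneg _
      rw [← sub_nonneg]
      have e2 : M + g ^ 2 / M - g = (M ^ 2 + g ^ 2 - g * M) / M := by field_simp
      rw [e2]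
      exact div_nonneg (by nlinarith [sq_nonneg g, sq_nonneg M]) hM.le
    have hc : 0 ≤ 1 + β * Hh (Js J) p Λ K z := by positivity
    calc _ ≤ (1 + β * Hh (Js J) p Λ K z) * (M + g ^ 2 / M) := mul_le_mul_of_nonneg_left hg hc
      _ = M * (1 + β * Hh (Js J) p Λ K z) + (1 + β * Hh (Js J) p Λ K z) * (g ^ 2 / M) := by ring
      _ ≤ M * (1 + β * Hh (Js J) p Λ K z) + (1 + β * ((∑' x, J 0 x) * X)) * (g ^ 2 / M) := by
          have := mul_le_mul_of_nonneg_left (hHX K z) hβ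
          have h3 : 0 ≤ g ^ 2 / M := by positivity
          have := mul_le_mul_of_nonneg_right (add_le_add (le_refl (1:ℝ)) this) h3
          linarith
      _ = _ := by rw [hA]; ring
  have hE := Ex_mono h0 h1 (E := Λ.sym2) (fun ω _ => hpt ω)
  rw [Ex_add, Ex_mul, Ex_mul, Ex_add, Ex_mul, Ex_K, Ex_K, Ex_g] at hE
  refine hE.trans (add_le_add (mul_le_mul_of_nonneg_left (add_le_add (by simp) (mul_le_mul_of_nonneg_left hH hβ)) hM.le)
    (mul_le_mul_of_nonneg_left ?_ (by positivity)))
  exact (ENNReal.ofReal_le_ofReal_iff hY).1 ((diag_real h0 h1 hp ho).trans hD)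

end M13

section M14
open Classical
set_option linter.unusedSectionVars false
variable {d : ℕ}

lemma step_bound {bc θ K β₁ β₂ X : ℝ} {φ : ℝ → ℝ} {L g : ℝ → ℝ} (hbc : 0 < bc) (hθ : 0 < θ) (hθ1 : θ < 1) (hK : 0 < K)
    (h12 : β₁ < β₂) (hlo : bc / 2 ≤ β₁) (hhi : β₂ < bc) (hX1 : 1 ≤ X) (hX : 1024 * K ≤ X ^ (1 - θ))
    (hφ0 : 0 ≤ φ β₁) (hφ : ∀ b ∈ Set.Icc β₁ β₂, φ b ≤ g b) (hg0 : ∀ b ∈ Set.Icc β₁ β₂, 0 ≤ g b)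
    (hg : ∀ b ∈ Set.Icc β₁ β₂, g b ≤ 2 * X)
    (hL : ∀ b ∈ Set.Icc β₁ β₂, X ^ 2 / 2 ≤ L b)
    (hD : ∀ b ∈ Set.Icc β₁ β₂, ∀ M, 0 < M → ∃ f', HasDerivAt φ f' b ∧ L b ≤ M * (φ b + b * f') + K * g b ^ (2 + θ) / M) :
    β₂ - β₁ ≤ 512 * K * bc * X ^ (-(1 - θ)) := by
  have hX0 : 0 < X := by linarith
  have hXθ : 0 < X ^ θ := Real.rpow_pos_of_pos hX0 _
  set M := 64 * K * X ^ θ with hM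
  have hM0 : 0 < M := by positivity
  have key : ∀ b ∈ Set.Icc β₁ β₂, ∃ f', HasDerivAt φ f' b ∧ X ^ 2 / (4 * M * bc) ≤ f' := by
    intro b hb
    obtain ⟨f', hf, h⟩ := hD b hb M hM0
    refine ⟨f', hf, ?_⟩
    have e1 : K * g b ^ (2 + θ) / M ≤ X ^ 2 / 8 := by
      have h1 : g b ^ (2 + θ) ≤ (2 * X) ^ (2 + θ) := Real.rpow_le_rpow (hg0 b hb) (hg b hb) (by linarith)
      have h2 : (2 * X) ^ (2 + θ) ≤ 8 * (X ^ 2 * X ^ θ) := by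
        rw [Real.mul_rpow (by norm_num) hX0.le, Real.rpow_add hX0, Real.rpow_two]
        refine mul_le_mul_of_nonneg_right ?_ (by positivity)
        calc (2:ℝ) ^ (2 + θ) ≤ 2 ^ (3:ℝ) := Real.rpow_le_rpow_of_exponent_le (by norm_num) (by linarith)
          _ = 8 := by norm_num
      rw [div_le_iff₀ hM0, hM]
      calc K * g b ^ (2 + θ) ≤ K * (8 * (X ^ 2 * X ^ θ)) := mul_le_mul_of_nonneg_left (h1.trans h2) hK.le
        _ = _ := by ring
    have e2 : M * φ b ≤ X ^ 2 / 8 := by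
      have h1 : φ b ≤ 2 * X := (hφ b hb).trans (hg b hb)
      have h2 : X ^ θ * X ^ (1 - θ) = X := by rw [← Real.rpow_add hX0]; simp
      calc M * φ b ≤ M * (2 * X) := mul_le_mul_of_nonneg_left h1 hM0.le
        _ = (1024 * K) * (X ^ θ * X / 8) := by rw [hM]; ring
        _ ≤ X ^ (1 - θ) * (X ^ θ * X / 8) := mul_le_mul_of_nonneg_right hX (by positivity)
        _ = (X ^ θ * X ^ (1 - θ)) * X / 8 := by ring
        _ = _ := by rw [h2]; ring
    have e3 := hL b hb
    have e4 : X ^ 2 / 4 ≤ M * b * f' := by nlinarith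
    have hb0 : 0 < b := by linarith [hb.1]
    have hf0 : 0 ≤ f' := by
      by_contra hneg
      push Not at hneg
      have : M * b * f' < 0 := mul_neg_of_pos_of_neg (by positivity) hneg
      have : 0 ≤ X ^ 2 / 4 := by positivity
      linarith
    rw [div_le_iff₀ (by positivity)]
    have : M * b * f' ≤ M * bc * f' := mul_le_mul_of_nonneg_right (mul_le_mul_of_nonneg_left (by linarith [hb.2]) hM0.le) hf0
    linarith
  have hcont : ContinuousOn φ (Set.Icc β₁ β₂) := fun b hb => by
    obtain ⟨f', hf, _⟩ := key b hb
    exact hf.continuousAt.continuousWithinAt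
  have mv := (convex_Icc β₁ β₂).mul_sub_le_image_sub_of_le_deriv (f := φ) hcont
    (fun b hb => by
      obtain ⟨f', hf, _⟩ := key b (interior_subset hb)
      exact hf.differentiableAt.differentiableWithinAt)
    (C := X ^ 2 / (4 * M * bc))
    (fun b hb => by
      obtain ⟨f', hf, h⟩ := key b (interior_subset hb)
      rw [hf.deriv]; exact h)
    β₁ (Set.left_mem_Icc.2 h12.le) β₂ (Set.right_mem_Icc.2 h12.le) h12.le
  have hr := Set.right_mem_Icc.2 h12.le
  have h3 : φ β₂ - φ β₁ ≤ 2 * X := by linarith [hφ _ hr, hg _ hr]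
  have h4 : X ^ 2 / (4 * M * bc) * (β₂ - β₁) ≤ 2 * X := mv.trans h3
  have h5 : X ^ (-(1 - θ)) * X = X ^ θ := by
    nth_rewrite 2 [← Real.rpow_one X]
    rw [← Real.rpow_add hX0]; congr 1; ring
  have h6 : X ^ 2 * (β₂ - β₁) ≤ 2 * X * (4 * M * bc) := by
    rwa [div_mul_eq_mul_div, div_le_iff₀ (by positivity)] at h4
  have h7 : X * (β₂ - β₁) ≤ 512 * K * bc * X ^ θ := by
    have : X * (X * (β₂ - β₁)) ≤ X * (512 * K * bc * X ^ θ) := by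
      calc _ = X ^ 2 * (β₂ - β₁) := by ring
        _ ≤ _ := h6
        _ = _ := by rw [hM]; ring
    exact le_of_mul_le_mul_left this hX0
  rw [← h5] at h7
  refine le_of_mul_le_mul_left ?_ hX0
  calc _ ≤ _ := h7
    _ = _ := by ring

lemma doubling {lo bc ρ C X0 : ℝ} {g : ℝ → ℝ} (hρ : 0 < ρ) (hC : 0 < C) (hX0 : 0 < X0)
    (hstep : ∀ a b, lo ≤ a → a < b → b < bc → X0 ≤ g a → g b ≤ 2 * g a → b - a ≤ C * g a ^ (-ρ)) (k : ℕ) :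
    ∀ a b, lo ≤ a → a ≤ b → b < bc → X0 ≤ g a → g b ≤ 2 ^ k * g a → b - a ≤ C / (1 - 2 ^ (-ρ)) * g a ^ (-ρ) := by
  have h2 : (2:ℝ) ^ (-ρ) < 1 := Real.rpow_lt_one_of_one_lt_of_neg (by norm_num) (by linarith)
  have h2' : (0:ℝ) < 2 ^ (-ρ) := Real.rpow_pos_of_pos (by norm_num) _
  set D := C / (1 - 2 ^ (-ρ)) with hD
  have hD1 : D = C + D * 2 ^ (-ρ) := by
    have : 1 - (2:ℝ) ^ (-ρ) ≠ 0 := by linarith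
    rw [hD]; field_simp; ring
  have hD0 : 0 < D := div_pos hC (by linarith)
  have hCD : C ≤ D := by rw [hD1]; nlinarith
  have hstep' : ∀ a b, lo ≤ a → a ≤ b → b < bc → X0 ≤ g a → g b ≤ 2 * g a → b - a ≤ C * g a ^ (-ρ) := by
    intro a b ha hab hb hX h
    rcases hab.eq_or_lt with rfl | hlt
    · have : 0 < g a := by linarith
      rw [sub_self]; positivity
    · exact hstep a b ha hlt hb hX h
  induction k with
  | zero =>
    intro a b ha hab hb hX h
    have hga : 0 < g a := by linarith
    refine (hstep' a b ha hab hb hX (by simp at h; linarith)).trans ?_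
    exact mul_le_mul_of_nonneg_right hCD (Real.rpow_nonneg hga.le _)
  | succ k ih =>
    intro a b ha hab hb hX h
    have hga : 0 < g a := by linarith
    have hp : 0 < g a ^ (-ρ) := Real.rpow_pos_of_pos hga _
    set S := {t | a ≤ t ∧ t ≤ b ∧ g t ≤ 2 * g a} with hS
    have haS : a ∈ S := ⟨le_rfl, hab, by linarith⟩
    have hSb : BddAbove S := ⟨b, fun t ht => ht.2.1⟩
    have has : a ≤ sSup S := le_csSup hSb haS
    have hsb : sSup S ≤ b := csSup_le ⟨a, haS⟩ fun t ht => ht.2.1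
    have h1 : sSup S - a ≤ C * g a ^ (-ρ) := by
      have : sSup S ≤ a + C * g a ^ (-ρ) := csSup_le ⟨a, haS⟩ fun t ht => by
        have := hstep' a t ha ht.1 (ht.2.1.trans_lt hb) hX ht.2.2
        linarith
      linarith
    have h3 : b - sSup S ≤ D * 2 ^ (-ρ) * g a ^ (-ρ) := by
      by_contra hcon
      push Not at hcon
      set t := b - D * 2 ^ (-ρ) * g a ^ (-ρ) with ht
      have hpos : 0 < D * 2 ^ (-ρ) * g a ^ (-ρ) := by positivity
      obtain ⟨u, hu1, hu2⟩ := exists_between (show sSup S < t by linarith)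
      have hub : u ≤ b := by linarith
      have hau : a ≤ u := by linarith
      have hu : 2 * g a < g u := by
        by_contra hn
        push Not at hn
        have := le_csSup hSb (show u ∈ S from ⟨hau, hub, hn⟩)
        linarith
      have hgu : 0 < g u := by linarith
      have := ih u b (by linarith) hub hb (by linarith) (by
        refine h.trans ?_
        rw [pow_succ, mul_assoc]
        exact mul_le_mul_of_nonneg_left hu.le (by positivity))
      have h4 : g u ^ (-ρ) ≤ 2 ^ (-ρ) * g a ^ (-ρ) := by
        rw [← Real.mul_rpow (by norm_num) hga.le]
        exact Real.rpow_le_rpow_of_nonpos (by positivity) hu.le (by linarith)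
      have := mul_le_mul_of_nonneg_left h4 hD0.le
      nlinarith
    calc b - a ≤ C * g a ^ (-ρ) + D * 2 ^ (-ρ) * g a ^ (-ρ) := by linarith
      _ = (C + D * 2 ^ (-ρ)) * g a ^ (-ρ) := by ring
      _ = _ := by rw [← hD1]

/-- finite-volume susceptibility and its square proxy -/
noncomputable def phN (J : V d → V d → ℝ) (n : ℕ) (b : ℝ) : ℝ := ∑ x ∈ Lm d n, tau (pb (Js J) b) (Lm d n) 0 x
noncomputable def Lq (J : V d → V d → ℝ) (n : ℕ) (b : ℝ) : ℝ :=
  ∑ y ∈ Lm d n, tau (pb (Js J) b) (Lm d n) 0 y * ∑ x ∈ Lm d n, tau (pb (Js J) b) (Lm d n) y x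
noncomputable def gX (J : V d → V d → ℝ) (b : ℝ) : ℝ := (∑' x, ti (pb (Js J) b) 0 x).toReal

variable {J : V d → V d → ℝ} {α c C : ℝ}

lemma Lq_mono (hJ : KernelHyp d J α c C) (n : ℕ) {a b : ℝ} (ha : 0 ≤ a) (hab : a ≤ b) : Lq J n a ≤ Lq J n b := by
  have hI := Js_nonneg hJ
  unfold Lq
  refine Finset.sum_le_sum fun y hy => mul_le_mul (tau_mono_beta hJ ha hab _ (zero_mem_Lm n) y)
    (Finset.sum_le_sum fun x _ => tau_mono_beta hJ ha hab _ hy x)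
    (Finset.sum_nonneg fun x _ => tau_nonneg (pb_nonneg hI ha) (pb_le_one _ _) _ _ _)
    (tau_nonneg (pb_nonneg hI (ha.trans hab)) (pb_le_one _ _) _ _ _)

lemma Lq_lim (hJ : KernelHyp d J α c C) {b q : ℝ} (hb : 0 ≤ b) (hX : ∑' x, ti (pb (Js J) b) 0 x ≠ ⊤) (hq0 : 0 ≤ q) (hq : q < gX J b ^ 2) :
    ∃ n, q ≤ Lq J n b := by
  have hI := Js_nonneg hJ
  have h0 := pb_nonneg hI hb
  have h1 := pb_le_one (Js J) b
  have hp := TI_pb hJ b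
  set p := pb (Js J) b with hpd
  by_contra hcon
  push Not at hcon
  have hn := fun (n : ℕ) => tau_nonneg h0 h1 (Lm d n)
  have hb2 : (∑' x, ti p 0 x) * (∑' x, ti p 0 x) ≤ ENNReal.ofReal q := by
    have e : (∑' x, ti p 0 x) * (∑' x, ti p 0 x) = ∑' z : V d × V d, ti p 0 z.1 * ti p z.1 z.2 := by
      rw [ENNReal.tsum_prod' (f := fun z : V d × V d => ti p 0 z.1 * ti p z.1 z.2), ← ENNReal.tsum_mul_right]
      refine tsum_congr fun y => ?_
      change _ = ∑' x, ti p 0 y * ti p y x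
      rw [ENNReal.tsum_mul_left]
      congr 1
      simp_rw [ti_eq h0 h1 hp y]
      exact ((Equiv.subRight y).tsum_eq (fun x => ti p 0 x)).symm
    rw [e, ENNReal.tsum_eq_iSup_sum]
    refine iSup_le fun F => ?_
    have e2 : ∀ z : V d × V d, ti p 0 z.1 * ti p z.1 z.2 =
        ⨆ n, ENNReal.ofReal (tau p (Lm d n) 0 z.1) * ENNReal.ofReal (tau p (Lm d n) z.1 z.2) := fun z => by
      refine le_antisymm ?_ (iSup_le fun n => mul_le_mul' (tau_le_ti h0 h1 _ _ _) (tau_le_ti h0 h1 _ _ _))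
      unfold ti
      rw [ENNReal.iSup_mul]
      refine iSup_le fun i => ?_
      rw [ENNReal.mul_iSup]
      refine iSup_le fun j => ?_
      exact (mul_le_mul' (ti_mono_n h0 h1 _ _ (le_max_left i j)) (ti_mono_n h0 h1 _ _ (le_max_right i j))).trans
        (le_iSup (fun n => ENNReal.ofReal (tau p (Lm d n) 0 z.1) * ENNReal.ofReal (tau p (Lm d n) z.1 z.2)) (max i j))
    simp_rw [e2]
    have hmo : ∀ z : V d × V d, Monotone fun n => ENNReal.ofReal (tau p (Lm d n) 0 z.1) * ENNReal.ofReal (tau p (Lm d n) z.1 z.2) :=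
      fun z m n h => mul_le_mul' (ti_mono_n h0 h1 0 z.1 h) (ti_mono_n h0 h1 z.1 z.2 h)
    rw [ENNReal.finsetSum_iSup_of_monotone hmo]
    refine iSup_le fun n => ?_
    obtain ⟨m, hm⟩ := exists_Lm (F.image Prod.fst ∪ F.image Prod.snd)
    set k := max m n
    have hF : F ⊆ Lm d k ×ˢ Lm d k := fun z hz => Finset.mem_product.2
      ⟨Lm_mono (le_max_left _ _) (hm (Finset.mem_union_left _ (Finset.mem_image_of_mem _ hz))),
       Lm_mono (le_max_left _ _) (hm (Finset.mem_union_right _ (Finset.mem_image_of_mem _ hz)))⟩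
    calc _ ≤ ∑ z ∈ F, ENNReal.ofReal (tau p (Lm d k) 0 z.1 * tau p (Lm d k) z.1 z.2) := Finset.sum_le_sum fun z _ => by
          rw [ENNReal.ofReal_mul (hn _ _ _)]
          exact mul_le_mul' (ti_mono_n h0 h1 _ _ (le_max_right _ _)) (ti_mono_n h0 h1 _ _ (le_max_right _ _))
      _ = ENNReal.ofReal (∑ z ∈ F, tau p (Lm d k) 0 z.1 * tau p (Lm d k) z.1 z.2) :=
          (ENNReal.ofReal_sum_of_nonneg fun z _ => mul_nonneg (hn _ _ _) (hn _ _ _)).symm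
      _ ≤ ENNReal.ofReal (Lq J k b) := ENNReal.ofReal_le_ofReal (by
          refine (Finset.sum_le_sum_of_subset_of_nonneg hF fun z _ _ => mul_nonneg (hn _ _ _) (hn _ _ _)).trans (le_of_eq ?_)
          rw [Finset.sum_product]
          unfold Lq
          exact Finset.sum_congr rfl fun y _ => by rw [Finset.mul_sum])
      _ ≤ _ := ENNReal.ofReal_le_ofReal (hcon k).le
  have h3 := ENNReal.toReal_mono ENNReal.ofReal_ne_top hb2
  rw [ENNReal.toReal_mul, ENNReal.toReal_ofReal hq0, ← sq] at h3
  exact absurd hq (not_lt.2 h3)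

end M14

section M15
open Classical
set_option linter.unusedSectionVars false
variable {d : ℕ} {J : V d → V d → ℝ} {α c C : ℝ} {P : ℝ → Measure (Config d)}

lemma gX_mono (hJ : KernelHyp d J α c C) (hP : IsLRP J P) {a b : ℝ} (ha : 0 ≤ a) (hab : a ≤ b) (hb : b < betaC P) : gX J a ≤ gX J b := by
  unfold gX
  refine ENNReal.toReal_mono (chi_fin hJ hP (ha.trans hab) hb).ne (ENNReal.tsum_le_tsum fun x => ?_)
  exact iSup_mono fun n => ENNReal.ofReal_le_ofReal (tau_mono_beta hJ ha hab _ (zero_mem_Lm n) x)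

lemma gX_one (hJ : KernelHyp d J α c C) (hP : IsLRP J P) {b : ℝ} (hb0 : 0 ≤ b) (hb : b < betaC P) : 1 ≤ gX J b := by
  have h := chi_fin hJ hP hb0 hb
  unfold gX
  rw [← ENNReal.ofReal_le_iff_le_toReal h.ne, ENNReal.ofReal_one, ← ti_self (pb (Js J) b) 0]
  exact ENNReal.le_tsum (f := fun x => ti (pb (Js J) b) 0 x) 0

lemma main_dineq (hJ : KernelHyp d J α c C) (hP : IsLRP J P) (hbc : 0 < betaC P) (hα1 : α < 1) (h2 : 2 * α < d) (h3 : (d:ℝ) < 3 * α) :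
    ∃ K : ℝ, 0 < K ∧ ∀ b, betaC P / 2 ≤ b → b < betaC P → ∀ n M, 0 < M → ∃ f', HasDerivAt (phN J n) f' b ∧
      Lq J n b ≤ M * (phN J n b + b * f') + K * gX J b ^ (2 + 2 * (3 * α - d) / α) / M := by
  have hα := hJ.alpha_pos
  obtain ⟨A, hA, hSL⟩ := SL_perc hJ hP hbc
  obtain ⟨B, hB, hball⟩ := ball_bound hJ.d_pos hα hα1 hA
  obtain ⟨D, hD, hpt⟩ := pointwise hJ.d_pos hα hα1 hA
  obtain ⟨C0, hC0, hdiag⟩ := diag_bound h2 h3 hB hD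
  have hJt : 0 ≤ ∑' x, J 0 x := tsum_nonneg fun x => hJ.nonneg _ _
  refine ⟨(1 + betaC P * ∑' x, J 0 x) * (C0.toReal + 1), by positivity, ?_⟩
  intro b hb1 hb2 n M hM
  have hb0 : 0 ≤ b := by linarith
  have hfin := chi_fin hJ hP hb0 hb2
  have hX1 := gX_one hJ hP hb0 hb2
  have h0 := pb_nonneg (Js_nonneg hJ) hb0
  have h1 := pb_le_one (Js J) b
  have hp := TI_pb hJ b
  set X := gX J b with hX
  have hX0 : 0 < X := by linarith
  have hsym : ∀ x, ti (pb (Js J) b) 0 (-x) = ti (pb (Js J) b) 0 x := fun x => by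
    rw [ti_symm _ 0 x, ti_eq h0 h1 hp x 0, zero_sub]
  have hs := hSL b hb1 hb2
  have hd := hdiag _ hsym (hball _ hsym hfin hs) (hpt _ (fun x => ti_le_one h0 h1 _ _) hsym hfin hs) (X ^ (1 / α))
    (Real.rpow_pos_of_pos hX0 _) (by
      rw [← Real.rpow_mul hX0.le, one_div, inv_mul_cancel₀ hα.ne', Real.rpow_one, hX, gX, ENNReal.ofReal_toReal hfin.ne])
  set Y := C0.toReal * (X ^ (1 / α)) ^ (7 * α - 2 * d) with hY
  have hYn : 0 ≤ Y := by positivity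
  obtain ⟨f', hf, h⟩ := dineq hJ hb0 hfin.ne n hM hYn (by
    rw [hY, ENNReal.ofReal_mul ENNReal.toReal_nonneg, ENNReal.ofReal_toReal hC0]; exact hd)
  refine ⟨f', hf, ?_⟩
  change Lq J n b ≤ M * (phN J n b + b * f') + (1 + b * ((∑' x, J 0 x) * X)) / M * Y at h
  refine h.trans (add_le_add le_rfl ?_)
  rw [div_mul_eq_mul_div]
  refine div_le_div_of_nonneg_right ?_ hM.le
  have e : X * Y = C0.toReal * X ^ (2 + 2 * (3 * α - d) / α) := by
    rw [hY, ← Real.rpow_mul hX0.le]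
    have : (2 + 2 * (3 * α - d) / α) = 1 + 1 / α * (7 * α - 2 * d) := by field_simp; ring
    rw [this, Real.rpow_add hX0, Real.rpow_one]; ring
  have e2 : 1 + b * ((∑' x, J 0 x) * X) ≤ (1 + betaC P * ∑' x, J 0 x) * X := by
    have : b * ((∑' x, J 0 x) * X) ≤ betaC P * ((∑' x, J 0 x) * X) := mul_le_mul_of_nonneg_right hb2.le (by positivity)
    nlinarith
  have hq : 0 ≤ X ^ (2 + 2 * (3 * α - d) / α) := by positivity
  calc _ ≤ (1 + betaC P * ∑' x, J 0 x) * X * Y := mul_le_mul_of_nonneg_right e2 hYn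
    _ = (1 + betaC P * ∑' x, J 0 x) * (C0.toReal * X ^ (2 + 2 * (3 * α - d) / α)) := by rw [mul_assoc, e]
    _ ≤ (1 + betaC P * ∑' x, J 0 x) * ((C0.toReal + 1) * X ^ (2 + 2 * (3 * α - d) / α)) :=
        mul_le_mul_of_nonneg_left (mul_le_mul_of_nonneg_right (by linarith) hq) (by positivity)
    _ = _ := by ring

lemma gX_final (hJ : KernelHyp d J α c C) (hP : IsLRP J P) (hbc : 0 < betaC P) (hα1 : α < 1) (h2 : 5 * α < 2 * d) (h3 : (d:ℝ) < 3 * α) :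
    ∃ C₁ ε₀ : ℝ, 0 < C₁ ∧ 0 < ε₀ ∧ ε₀ ≤ betaC P / 2 ∧ ∀ β, betaC P - ε₀ < β → β < betaC P →
      gX J β ≤ C₁ * (betaC P - β) ^ (-(α / (2 * (d:ℝ) - 5 * α))) := by
  have hα := hJ.alpha_pos
  obtain ⟨K, hK, hmain⟩ := main_dineq hJ hP hbc hα1 (by linarith) h3
  set bc := betaC P with hbcd
  set θ := 2 * (3 * α - d) / α with hθ
  have hθ0 : 0 < θ := div_pos (by linarith) hα
  have hρ : 1 - θ = (2 * d - 5 * α) / α := by rw [hθ]; field_simp; ring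
  have hρ0 : 0 < 1 - θ := by rw [hρ]; exact div_pos (by linarith) hα
  have hγ : α / (2 * (d:ℝ) - 5 * α) = (1 - θ)⁻¹ := by rw [hρ, inv_div]
  rw [hγ]
  set ρ := 1 - θ with hρd
  set X0 := (1024 * K) ^ ρ⁻¹ + 1 with hX0
  have hX0p : 0 < X0 := by positivity
  have hstep : ∀ a b, bc / 2 ≤ a → a < b → b < bc → X0 ≤ gX J a → gX J b ≤ 2 * gX J a → b - a ≤ 512 * K * bc * gX J a ^ (-ρ) := by
    intro a b ha hab hb hX hg
    have ha0 : 0 ≤ a := by linarith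
    have hfa := chi_fin hJ hP ha0 (hab.trans hb)
    have hX1 := gX_one hJ hP ha0 (hab.trans hb)
    obtain ⟨n, hn⟩ := Lq_lim hJ ha0 hfa.ne (q := gX J a ^ 2 / 2) (by positivity) (by nlinarith)
    refine step_bound (φ := phN J n) (L := Lq J n) (g := gX J) hbc hθ0 (by linarith) hK hab ha hb hX1 ?_ ?_ ?_ ?_ ?_ ?_ ?_
    · calc 1024 * K = ((1024 * K) ^ ρ⁻¹) ^ ρ := by rw [← Real.rpow_mul (by positivity), inv_mul_cancel₀ hρ0.ne', Real.rpow_one]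
        _ ≤ gX J a ^ ρ := Real.rpow_le_rpow (by positivity) (by linarith) hρ0.le
    · exact Finset.sum_nonneg fun x _ => tau_nonneg (pb_nonneg (Js_nonneg hJ) ha0) (pb_le_one _ _) _ _ _
    · intro t ht
      have ht0 : 0 ≤ t := ha0.trans ht.1
      exact sum_tau_le (pb_nonneg (Js_nonneg hJ) ht0) (pb_le_one _ _) (TI_pb hJ t) (chi_fin hJ hP ht0 (ht.2.trans_lt hb)).ne _ _ _
    · exact fun t _ => ENNReal.toReal_nonneg
    · exact fun t ht => (gX_mono hJ hP (ha0.trans ht.1) ht.2 hb).trans hg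
    · exact fun t ht => hn.trans (Lq_mono hJ n ha0 ht.1)
    · exact fun t ht M hM => hmain t (ha.trans ht.1) (ht.2.trans_lt hb) n M hM
  have hdoub := doubling (g := gX J) hρ0 (show 0 < 512 * K * bc by positivity) hX0p hstep
  set D := 512 * K * bc / (1 - 2 ^ (-ρ)) with hD
  have hDp : 0 < D := div_pos (by positivity) (by
    have := Real.rpow_lt_one_of_one_lt_of_neg (show (1:ℝ) < 2 by norm_num) (show -ρ < 0 by linarith)
    linarith)
  have hDr : 0 < D ^ ρ⁻¹ := by positivity
  refine ⟨X0 + D ^ ρ⁻¹, min 1 (bc / 2), by positivity, lt_min one_pos (by linarith), min_le_right _ _, ?_⟩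
  intro β hβ1 hβ2
  have m1 := min_le_left 1 (bc / 2)
  have m2 := min_le_right 1 (bc / 2)
  have hδ : 0 < bc - β := by linarith
  have hβ0 : 0 ≤ β := by linarith
  have hpos : 0 < (bc - β) ^ (-ρ⁻¹) := Real.rpow_pos_of_pos hδ _
  by_cases hX : X0 ≤ gX J β
  · have hg0 : 0 < gX J β := by linarith
    have hlim : bc - β ≤ D * gX J β ^ (-ρ) := by
      have : bc ≤ β + D * gX J β ^ (-ρ) := by
        refine le_of_forall_lt fun t ht => ?_
        set t' := max β ((t + bc) / 2) with ht'
        have hl : (t + bc) / 2 ≤ t' := le_max_right _ _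
        have ht2 : t' < bc := max_lt hβ2 (by linarith)
        obtain ⟨k, hk⟩ := pow_unbounded_of_one_lt (gX J t' / gX J β) (show (1:ℝ) < 2 by norm_num)
        have := hdoub k β t' (by linarith) (le_max_left _ _) ht2 hX (by
          rw [div_lt_iff₀ hg0] at hk; exact hk.le)
        linarith
      linarith
    have h4 : gX J β ≤ D ^ ρ⁻¹ * (bc - β) ^ (-ρ⁻¹) := by
      have h5 : gX J β ^ ρ ≤ D / (bc - β) := by
        rw [le_div_iff₀ hδ]
        calc gX J β ^ ρ * (bc - β) ≤ gX J β ^ ρ * (D * gX J β ^ (-ρ)) := mul_le_mul_of_nonneg_left hlim (by positivity)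
          _ = D * (gX J β ^ ρ * gX J β ^ (-ρ)) := by ring
          _ = D := by rw [← Real.rpow_add hg0]; simp
      have h6 := Real.rpow_le_rpow (by positivity) h5 (inv_nonneg.2 hρ0.le)
      rw [← Real.rpow_mul hg0.le, mul_inv_cancel₀ hρ0.ne', Real.rpow_one, Real.div_rpow hDp.le hδ.le] at h6
      rw [Real.rpow_neg hδ.le]; exact h6
    refine h4.trans (mul_le_mul_of_nonneg_right (by linarith) hpos.le)
  · push Not at hX
    have h5 : 1 ≤ (bc - β) ^ (-ρ⁻¹) := Real.one_le_rpow_of_pos_of_le_one_of_nonpos hδ (by linarith) (by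
      have := inv_pos.2 hρ0; linarith)
    nlinarith

end M15

/-- If `d ∈ {1, 2}` and `d/3 < α < 2d/5` then
`χ(β) ≤ C₁ (β_c - β)^{-α/(2d-5α)}` for `β` slightly below `β_c`. -/
theorem susceptibility_gamma_bound {d : ℕ} {J : V d → V d → ℝ} {α c C : ℝ}
    (hJ : KernelHyp d J α c C)
    (P : ℝ → Measure (Config d)) (hP : IsLRP J P)
    (hd : d = 1 ∨ d = 2) (hα : (d : ℝ) / 3 < α) (hα' : α < 2 * (d : ℝ) / 5) :
    ∃ C₁ ε₀ : ℝ, 0 < C₁ ∧ 0 < ε₀ ∧ ∀ β : ℝ, betaC P - ε₀ < β → β < betaC P →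
      chi P β ≤ ENNReal.ofReal (C₁ * (betaC P - β) ^ (-(α / (2 * (d : ℝ) - 5 * α)))) := by
  have hd2 : (d:ℝ) ≤ 2 := by rcases hd with rfl | rfl <;> norm_num
  rcases le_or_gt (betaC P) 0 with hbc | hbc
  · refine ⟨1, 1, one_pos, one_pos, fun β h1 h2 => ?_⟩
    have hb0 : 0 ≤ betaC P := Real.sInf_nonneg fun x hx => hx.1
    rw [chi_neg hP hJ (by linarith), ← ENNReal.ofReal_one]
    refine ENNReal.ofReal_le_ofReal ?_
    rw [one_mul]
    exact Real.one_le_rpow_of_pos_of_le_one_of_nonpos (by linarith) (by linarith) (by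
      have : 0 ≤ α / (2 * (d:ℝ) - 5 * α) := div_nonneg hJ.alpha_pos.le (by linarith)
      linarith)
  · obtain ⟨C₁, ε₀, hC, hε, hε2, h⟩ := gX_final hJ hP hbc (by linarith) (by linarith) (by linarith)
    refine ⟨C₁, ε₀, hC, hε, fun β h1 h2 => ?_⟩
    have hβ0 : 0 ≤ β := by linarith
    have : chi P β = ENNReal.ofReal (gX J β) := by
      unfold chi gX
      simp_rw [twoPoint_eq hP hJ hβ0]
      rw [ENNReal.ofReal_toReal (chi_fin hJ hP hβ0 h2).ne]
    rw [this]
    exact ENNReal.ofReal_le_ofReal (h β h1 h2)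

end LRP
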